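/- Let C be a bounded open convex subset of ℝ². Then the bottom of the spectrum λ₁(C) is nonzero if and only if there exists δ ≥ 0 such that the metric space (C, d_C) is δ-hyperbolic. -/

import Mathlib

open MeasureTheory Set Filter
open scoped ENNReal NNReal

noncomputable section

/-- Euclidean `n`-space. -/
abbrev Euc (n : ℕ) : Type := EuclideanSpace ℝ (Fin n)

/-- The set of parameters `t` such that `p + t • v` lies in `C`. For `C` open bounded
convex, `p ∈ C` and `v ≠ 0` this is an open interval `(t⁻, t⁺)` with `t⁻ < 0 < t⁺`;
the points `p + t⁻ • v` and `p + t⁺ • v` are the two intersections of the boundary `∂C`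
with the line through `p` directed by `v`. -/
def lineParams {n : ℕ} (C : Set (Euc n)) (p v : Euc n) : Set ℝ := {t : ℝ | p + t • v ∈ C}

open Classical in
/-- The Hilbert distance of the convex set `C`: with `a = p + t⁻ • (q - p)` and
`b = p + t⁺ • (q - p)` the two boundary points (so that `a, p, q, b` are in this order),
the cross-ratio `(‖q-a‖ ‖p-b‖)/(‖p-a‖ ‖q-b‖)` equals `((1 - t⁻) t⁺)/((-t⁻)(t⁺ - 1))`. -/
def hDist {n : ℕ} (C : Set (Euc n)) (p q : Euc n) : ℝ :=
  if p = q then 0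
  else
    (1 / 2) * Real.log
      (((1 - sInf (lineParams C p (q - p))) * sSup (lineParams C p (q - p))) /
        ((-sInf (lineParams C p (q - p))) * (sSup (lineParams C p (q - p)) - 1)))

open Classical in
/-- The Hilbert Finsler norm of `u` at `p`: with `p⁺ = p + t⁺ • u`, `p⁻ = p + t⁻ • u`
the two boundary points on the line through `p` directed by `u`, one has
`(1/2)‖u‖(1/‖p-p⁺‖ + 1/‖p-p⁻‖) = (1/2)(1/t⁺ - 1/t⁻)`. -/
def fNorm {n : ℕ} (C : Set (Euc n)) (p u : Euc n) : ℝ :=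
  if u = 0 then 0
  else (1 / 2) * (1 / sSup (lineParams C p u) - 1 / sInf (lineParams C p u))

/-- The dual norm of a linear form `l` at `p`: `sup {l u : ‖u‖_{C,p} = 1}`. -/
def dualNorm {n : ℕ} (C : Set (Euc n)) (p : Euc n) (l : Euc n →L[ℝ] ℝ) : ℝ :=
  sSup ((fun u => l u) '' {u : Euc n | fNorm C p u = 1})

/-- The tangent ball `TB_R(p) = {u : ‖u‖_{C,p} < R}`. -/
def tangentBall {n : ℕ} (C : Set (Euc n)) (p : Euc n) (R : ℝ) : Set (Euc n) :=
  {u : Euc n | fNorm C p u < R}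

/-- `ωₙ`, the Lebesgue volume of the Euclidean unit ball of `ℝⁿ`. -/
def omegaVol (n : ℕ) : ℝ := (volume (Metric.ball (0 : Euc n) 1)).toReal

/-- The Hilbert (Busemann) measure of `C`: density `ωₙ / vol_e(TB_C(p))` against
Lebesgue measure, supported on `C`. -/
def hMeasure {n : ℕ} (C : Set (Euc n)) : Measure (Euc n) :=
  (volume.restrict C).withDensity fun p =>
    ENNReal.ofReal (omegaVol n / (volume (tangentBall C p 1)).toReal)

/-- Admissible test functions: nonzero Lipschitz functions with compact support
contained in `Ω`. -/
def testFuns {n : ℕ} (Ω : Set (Euc n)) : Set (Euc n → ℝ) :=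
  {f : Euc n → ℝ |
    (∃ K : ℝ≥0, LipschitzWith K f) ∧ f ≠ 0 ∧ HasCompactSupport f ∧ tsupport f ⊆ Ω}

/-- The Rayleigh quotient of `f` on `Ω`, with respect to the Hilbert geometry of `C`
(`df` is the a.e.-defined differential of the Lipschitz function `f`). -/
def rayleigh {n : ℕ} (C Ω : Set (Euc n)) (f : Euc n → ℝ) : ℝ :=
  (∫ p in Ω, dualNorm C p (fderiv ℝ f p) ^ 2 ∂hMeasure C) /
    ∫ p in Ω, f p ^ 2 ∂hMeasure C

/-- The Dirichlet bottom of the spectrum `λ₁^C(Ω)`. -/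
def lambda1D {n : ℕ} (C Ω : Set (Euc n)) : ℝ := sInf (rayleigh C Ω '' testFuns Ω)

/-- The bottom of the spectrum `λ₁(C)` of the Hilbert geometry of `C`. -/
def lambda1 {n : ℕ} (C : Set (Euc n)) : ℝ := lambda1D C C

/-- The Gromov product `(x|y)_t = (d(x,t) + d(y,t) - d(x,y))/2`. -/
def gromovProd {n : ℕ} (d : Euc n → Euc n → ℝ) (x y t : Euc n) : ℝ :=
  (d x t + d y t - d x y) / 2

/-- `(C, d_C)` is `δ`-hyperbolic: for all `x y z t` in `C`,
`(x|y)_t ≥ min((x|z)_t, (y|z)_t) - δ`. -/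
def IsDeltaHyp {n : ℕ} (C : Set (Euc n)) (δ : ℝ) : Prop :=
  ∀ x ∈ C, ∀ y ∈ C, ∀ z ∈ C, ∀ t ∈ C,
    gromovProd (hDist C) x y t ≥
      min (gromovProd (hDist C) x z t) (gromovProd (hDist C) y z t) - δ

/-- The metric ball `B_R(x)` of the Hilbert metric of `C`. -/
def hBall {n : ℕ} (C : Set (Euc n)) (x : Euc n) (R : ℝ) : Set (Euc n) :=
  {y ∈ C | hDist C x y < R}

/-- The image of `C` under the homothety of center `P₀` and ratio `r`. -/
def homoth {n : ℕ} (P₀ : Euc n) (r : ℝ) (C : Set (Euc n)) : Set (Euc n) :=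
  (fun x => P₀ + r • (x - P₀)) '' C

/-- Diameter of a set with respect to a distance function `d`. -/
def ediamD {α : Type*} (d : α → α → ℝ) (S : Set α) : ℝ≥0∞ :=
  ⨆ x ∈ S, ⨆ y ∈ S, ENNReal.ofReal (d x y)

/-- The `k`-dimensional Hausdorff measure of `S` with respect to the distance
function `d`. -/
def hausD {α : Type*} (k : ℝ) (d : α → α → ℝ) (S : Set α) : ℝ≥0∞ :=
  ⨆ (ε : ℝ≥0∞) (_ : 0 < ε),
    ⨅ (U : ℕ → Set α) (_ : S ⊆ ⋃ i, U i) (_ : ∀ i, ediamD d (U i) ≤ ε),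
      ∑' i, ediamD d (U i) ^ k

/-- The frontier of `U` is a rectifiable closed curve (for the Hilbert metric of `C`):
it is the image of a closed continuous curve and has finite one-dimensional Hausdorff
measure. -/
def RectCurveBoundary (C U : Set (Euc 2)) : Prop :=
  ∃ c : ℝ → Euc 2, ContinuousOn c (Icc 0 1) ∧ c '' Icc (0 : ℝ) 1 = frontier U ∧
    c 0 = c 1 ∧ hausD 1 (hDist C) (frontier U) < ⊤

/-- The Cheeger constant `I_∞^C(Ω)` in dimension `2`: infimum of
`ν_C(∂U)/μ_C(U)` over open sets `U` with closure contained in `Ω` whose boundary is a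
rectifiable curve, `ν_C` being the `1`-dimensional Hausdorff measure of `(C, d_C)`. -/
def cheeger2D (C Ω : Set (Euc 2)) : ℝ :=
  sInf {r : ℝ | ∃ U : Set (Euc 2), IsOpen U ∧ U.Nonempty ∧ closure U ⊆ Ω ∧
    RectCurveBoundary C U ∧
    r = (hausD 1 (hDist C) (frontier U)).toReal / (hMeasure C U).toReal}

/-- The Cheeger constant `I_∞(C)` of a planar Hilbert geometry. -/
def cheeger2 (C : Set (Euc 2)) : ℝ := cheeger2D C C

/-- `S` is a `C¹` hypersurface: near each of its points it is the zero set of a `C¹`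
function with nonvanishing differential. -/
def IsC1Hypersurface {n : ℕ} (S : Set (Euc n)) : Prop :=
  ∀ x ∈ S, ∃ (f : Euc n → ℝ) (U : Set (Euc n)), U ∈ nhds x ∧ ContDiffOn ℝ 1 f U ∧
    (∀ y ∈ U, fderiv ℝ f y ≠ 0) ∧ S ∩ U = {y ∈ U | f y = 0}

/-- The Cheeger constant `I_∞^C(Ω)` in dimension `n`: infimum of `ν_C(∂U)/μ_C(U)` over
open sets `U` with closure contained in `Ω` whose boundary is a `C¹` hypersurface,
`ν_C` being the `(n-1)`-dimensional Hausdorff measure of `(C, d_C)`. -/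
def cheegerND {n : ℕ} (C Ω : Set (Euc n)) : ℝ :=
  sInf {r : ℝ | ∃ U : Set (Euc n), IsOpen U ∧ U.Nonempty ∧ closure U ⊆ Ω ∧
    IsC1Hypersurface (frontier U) ∧
    r = (hausD ((n : ℝ) - 1) (hDist C) (frontier U)).toReal / (hMeasure C U).toReal}

/-- The boundary of the convex set `C` is of class `C¹`: through each boundary point
passes a unique supporting hyperplane. -/
def HasC1Boundary {n : ℕ} (C : Set (Euc n)) : Prop :=
  ∀ x ∈ frontier C, ∃! l : Euc n →L[ℝ] ℝ, ‖l‖ = 1 ∧ ∀ y ∈ C, l y ≤ l x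

/-- The convex set `C` is strictly convex: the open segment joining two distinct
boundary points is contained in `C`. -/
def IsStrictlyConvexSet {n : ℕ} (C : Set (Euc n)) : Prop :=
  ∀ x ∈ frontier C, ∀ y ∈ frontier C, x ≠ y → openSegment ℝ x y ⊆ C

end



section
open MeasureTheory Set Filter
open scoped ENNReal NNReal

structure GoodC {n : ℕ} (C : Set (Euc n)) : Prop where
  conv : Convex ℝ C
  op : IsOpen C
  bdd : Bornology.IsBounded C

/-- gauge of `C` seen from `p`. -/
noncomputable def gg {n : ℕ} (C : Set (Euc n)) (p u : Euc n) : ℝ :=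
  gauge ((fun x => p + x) ⁻¹' C) u

section base
variable {n : ℕ} {C : Set (Euc n)} {p q u v : Euc n}

theorem gg_conv (h : GoodC C) : Convex ℝ ((fun x => p + x) ⁻¹' C) := by
  have := h.conv.translate_preimage_right p
  exact this

theorem gg_open (h : GoodC C) : IsOpen ((fun x => p + x) ⁻¹' C) :=
  h.op.preimage (by fun_prop)

theorem gg_nhds (h : GoodC C) (hp : p ∈ C) : ((fun x => p + x) ⁻¹' C) ∈ nhds (0 : Euc n) :=
  (gg_open h).mem_nhds (by simpa using hp)

theorem gg_abs (h : GoodC C) (hp : p ∈ C) : Absorbent ℝ ((fun x => p + x) ⁻¹' C) :=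
  absorbent_nhds_zero (gg_nhds h hp)

theorem gg_nonneg : 0 ≤ gg C p u := gauge_nonneg _

@[simp] theorem gg_zero : gg C p 0 = 0 := gauge_zero

theorem gg_smul {c : ℝ} (hc : 0 ≤ c) : gg C p (c • u) = c * gg C p u := by
  unfold gg; rw [gauge_smul_of_nonneg hc]; rfl

theorem gg_add_le (h : GoodC C) (hp : p ∈ C) : gg C p (u + v) ≤ gg C p u + gg C p v :=
  gauge_add_le (gg_conv h) (gg_abs h hp) u v

theorem gg_continuous (h : GoodC C) (hp : p ∈ C) : Continuous (gg C p) :=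
  continuous_gauge (gg_conv h) (gg_nhds h hp)

theorem gg_lt_one_iff (h : GoodC C) (hp : p ∈ C) : gg C p u < 1 ↔ p + u ∈ C := by
  have := setOfPred_gauge_lt_one_eq_self_of_isOpen (gg_conv h (p := p)) (by simpa using hp) (gg_open h)
  have h2 := Set.ext_iff.1 this u
  simpa [gg] using h2

theorem gg_lt_iff (h : GoodC C) (hp : p ∈ C) {a : ℝ} (ha : 0 < a) :
    gg C p u < a ↔ p + a⁻¹ • u ∈ C := by
  rw [← gg_lt_one_iff h hp, gg_smul (by positivity), inv_mul_lt_iff₀ ha, mul_one]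

theorem gg_pos (h : GoodC C) (hp : p ∈ C) (hu : u ≠ 0) : 0 < gg C p u := by
  refine (gauge_pos (gg_abs h hp) ?_).2 hu
  rw [NormedSpace.isVonNBounded_iff]
  have : ((fun x => p + x) ⁻¹' C) = (fun x => -p + x) '' C := by
    ext x; simp
  rw [this]
  exact h.bdd.vadd (-p)

theorem mem_of_lineParam (h : GoodC C) (hp : p ∈ C) {t : ℝ} (h1 : 0 ≤ t)
    (h2 : t * gg C p u < 1) : p + t • u ∈ C := by
  rw [← gg_lt_one_iff h hp, gg_smul h1]; exact h2

theorem lineParams_eq (h : GoodC C) (hp : p ∈ C) (hu : u ≠ 0) :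
    lineParams C p u = Ioo (-(gg C p (-u))⁻¹) (gg C p u)⁻¹ := by
  have h1 := gg_pos h hp hu
  have h2 := gg_pos h hp (neg_ne_zero.2 hu)
  ext t
  simp only [lineParams, mem_ofPred_eq, mem_Ioo]
  rcases le_total 0 t with ht | ht
  · rw [← gg_lt_one_iff h hp, gg_smul ht]
    constructor
    · intro h3
      have := inv_pos.2 h2
      exact ⟨by linarith, by rw [← one_div, lt_div_iff₀ h1]; exact h3⟩
    · rintro ⟨_, h3⟩
      calc t * gg C p u < (gg C p u)⁻¹ * gg C p u := by gcongr
        _ = 1 := inv_mul_cancel₀ h1.ne'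
  · have e : t • u = (-t) • (-u) := by simp
    rw [e, ← gg_lt_one_iff h hp, gg_smul (by linarith)]
    constructor
    · intro h3
      have := inv_pos.2 h1
      refine ⟨?_, by linarith⟩
      rw [neg_lt, ← one_div, lt_div_iff₀ h2]; exact h3
    · rintro ⟨h3, _⟩
      rw [neg_lt, ← one_div, lt_div_iff₀ h2] at h3; exact h3

theorem sSup_line (h : GoodC C) (hp : p ∈ C) (hu : u ≠ 0) :
    sSup (lineParams C p u) = (gg C p u)⁻¹ := by
  have h1 := inv_pos.2 (gg_pos h hp hu)
  have h2 := inv_pos.2 (gg_pos h hp (neg_ne_zero.2 hu))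
  rw [lineParams_eq h hp hu, csSup_Ioo (by linarith)]

theorem sInf_line (h : GoodC C) (hp : p ∈ C) (hu : u ≠ 0) :
    sInf (lineParams C p u) = -(gg C p (-u))⁻¹ := by
  have h1 := inv_pos.2 (gg_pos h hp hu)
  have h2 := inv_pos.2 (gg_pos h hp (neg_ne_zero.2 hu))
  rw [lineParams_eq h hp hu, csInf_Ioo (by linarith)]

theorem fNorm_eq (h : GoodC C) (hp : p ∈ C) :
    fNorm C p u = (1 / 2) * (gg C p u + gg C p (-u)) := by
  unfold fNorm
  split_ifs with hu
  · subst hu; simp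
  · rw [sSup_line h hp hu, sInf_line h hp hu]; simp

theorem hDist_eq (h : GoodC C) (hp : p ∈ C) (hq : q ∈ C) :
    hDist C p q = (1 / 2) * Real.log ((1 + gg C p (p - q)) / (1 - gg C p (q - p))) := by
  unfold hDist
  split_ifs with hu
  · subst hu; simp
  · have hv : q - p ≠ 0 := sub_ne_zero.2 (Ne.symm hu)
    have h1 := gg_pos h hp hv
    have h2 := gg_pos h hp (neg_ne_zero.2 hv)
    have h3 : gg C p (q - p) < 1 := (gg_lt_one_iff h hp).2 (by simpa using hq)
    rw [sSup_line h hp hv, sInf_line h hp hv]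
    rw [neg_sub] at *
    congr 2
    have : 1 - gg C p (q - p) ≠ 0 := by linarith
    generalize gg C p (q - p) = a at *
    generalize gg C p (p - q) = b at *
    have e : a⁻¹ - 1 = (1 - a) / a := by field_simp
    rw [e]
    field_simp
    ring

theorem gg_lt_one (h : GoodC C) (hp : p ∈ C) (hq : q ∈ C) : gg C p (q - p) < 1 :=
  (gg_lt_one_iff h hp).2 (by simpa using hq)

theorem hDist_nonneg (h : GoodC C) (hp : p ∈ C) (hq : q ∈ C) : 0 ≤ hDist C p q := by
  rw [hDist_eq h hp hq]
  have h1 := gg_lt_one h hp hq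
  have h2 : 0 ≤ gg C p (q - p) := gg_nonneg
  have h3 : 0 ≤ gg C p (p - q) := gg_nonneg
  refine mul_nonneg (by norm_num) (Real.log_nonneg ?_)
  rw [le_div_iff₀ (by linarith)]; linarith

@[simp] theorem hDist_self : hDist C p p = 0 := by simp [hDist]

/-- gauge at a shifted base point -/
theorem gg_shift (h : GoodC C) (hp : p ∈ C) {s : ℝ} (hs : p + s • v ∈ C) (hs0 : 0 ≤ s) :
    gg C (p + s • v) v = gg C p v / (1 - s * gg C p v) := by
  have h1 : s * gg C p v < 1 := by rw [← gg_smul hs0]; exact (gg_lt_one_iff h hp).2 hs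
  rcases eq_or_ne v 0 with rfl | hv
  · simp
  have hg := gg_pos h hp hv
  have hg2 := gg_pos h hs hv
  have key : ∀ a : ℝ, 0 < a → (gg C (p + s • v) v < a ↔ gg C p v / (1 - s * gg C p v) < a) := by
    intro a ha
    rw [gg_lt_iff h hs ha, add_assoc, ← add_smul, ← gg_lt_one_iff h hp, gg_smul (by positivity),
      div_lt_iff₀ (by linarith)]
    have : a * ((s + a⁻¹) * gg C p v) = a * (s * gg C p v) + gg C p v := by field_simp
    constructor
    · intro h3
      have := mul_lt_mul_of_pos_left h3 ha
      linarith
    · intro h3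
      have h4 : a * ((s + a⁻¹) * gg C p v) < a * 1 := by linarith
      exact lt_of_mul_lt_mul_left h4 ha.le
  have hpos : 0 < gg C p v / (1 - s * gg C p v) := div_pos hg (by linarith)
  apply le_antisymm
  · by_contra! hc
    exact lt_irrefl _ ((key _ hg2).2 hc)
  · by_contra! hc
    exact lt_irrefl _ ((key _ hpos).1 hc)

theorem gg_shift_neg (h : GoodC C) (hp : p ∈ C) {s : ℝ} (hs : p + s • v ∈ C) (hs0 : 0 ≤ s) :
    gg C (p + s • v) (-v) = gg C p (-v) / (1 + s * gg C p (-v)) := by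
  have h1 : 0 ≤ gg C p (-v) := gg_nonneg
  have h2 : 0 ≤ gg C (p + s • v) (-v) := gg_nonneg
  have e : p + s • v + s • (-v) = p := by simp
  have h4 := gg_shift (p := p + s • v) (v := -v) h hs (by rw [e]; exact hp) hs0
  rw [e] at h4
  have h3 : s * gg C (p + s • v) (-v) < 1 := by
    rw [← gg_smul hs0]; exact (gg_lt_one_iff h hs).2 (by rw [e]; exact hp)
  have h5 : 0 < 1 + s * gg C p (-v) := by positivity
  rw [eq_div_iff h5.ne', h4]
  generalize gg C (p + s • v) (-v) = w at *
  have h6 : 1 - s * w ≠ 0 := by linarith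
  rw [eq_div_iff h6]
  have h7 : (1 + s * (w / (1 - s * w))) * (1 - s * w) = 1 := by
    rw [add_mul, mul_assoc, div_mul_cancel₀ _ h6]; ring
  rw [mul_assoc, h7, mul_one]

theorem hDist_line (h : GoodC C) (hp : p ∈ C) {s r : ℝ} (hs0 : 0 ≤ s) (hsr : s ≤ r)
    (hr : p + r • v ∈ C) :
    hDist C (p + s • v) (p + r • v) = (1 / 2) * (Real.log (1 + r * gg C p (-v))
      - Real.log (1 - r * gg C p v) - (Real.log (1 + s * gg C p (-v))
      - Real.log (1 - s * gg C p v))) := by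
  have h1 : r * gg C p v < 1 := by
    rw [← gg_smul (by linarith)]; exact (gg_lt_one_iff h hp).2 hr
  have g0 : 0 ≤ gg C p v := gg_nonneg
  have g1 : 0 ≤ gg C p (-v) := gg_nonneg
  have h2 : s * gg C p v < 1 := by nlinarith
  have hs : p + s • v ∈ C := mem_of_lineParam h hp hs0 h2
  rw [hDist_eq h hs hr]
  have e1 : p + s • v - (p + r • v) = (r - s) • (-v) := by module
  have e2 : p + r • v - (p + s • v) = (r - s) • v := by module
  rw [e1, e2, gg_smul (by linarith), gg_smul (by linarith), gg_shift h hp hs hs0,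
    gg_shift_neg h hp hs hs0]
  have k1 : 0 < 1 + s * gg C p (-v) := by positivity
  have k2 : 0 < 1 + r * gg C p (-v) := by have : 0 ≤ r := by linarith
                                          positivity
  have k3 : 0 < 1 - s * gg C p v := by linarith
  have k4 : 0 < 1 - r * gg C p v := by linarith
  have e3 : 1 + (r - s) * (gg C p (-v) / (1 + s * gg C p (-v)))
      = (1 + r * gg C p (-v)) / (1 + s * gg C p (-v)) := by field_simp; ring
  have e4 : 1 - (r - s) * (gg C p v / (1 - s * gg C p v))
      = (1 - r * gg C p v) / (1 - s * gg C p v) := by field_simp; ring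
  rw [e3, e4, Real.log_div (by positivity) (by positivity), Real.log_div (by positivity)
    (by positivity), Real.log_div (by positivity) (by positivity)]
  ring

theorem hDist_comm (h : GoodC C) (hp : p ∈ C) (hq : q ∈ C) : hDist C p q = hDist C q p := by
  obtain ⟨v, rfl⟩ : ∃ v, q = p + v := ⟨q - p, by simp⟩
  have hq' : p + (1 : ℝ) • v ∈ C := by simpa using hq
  have g1 := gg_lt_one h hp hq
  have g0 : 0 ≤ gg C p v := gg_nonneg
  have g2 : 0 ≤ gg C p (-v) := gg_nonneg
  have s1 := gg_shift h hp hq' zero_le_one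
  have s2 := gg_shift_neg h hp hq' zero_le_one
  rw [hDist_eq h hp hq, hDist_eq h hq hp]
  simp only [one_smul, one_mul, sub_add_cancel_left, add_sub_cancel_left] at *
  rw [s1, s2]
  congr 2
  have : 1 - gg C p v ≠ 0 := by linarith
  have : 1 + gg C p (-v) ≠ 0 := by positivity
  have : 1 - gg C p (-v) / (1 + gg C p (-v)) ≠ 0 := by
    have : 1 - gg C p (-v) / (1 + gg C p (-v)) = 1 / (1 + gg C p (-v)) := by field_simp; ring
    rw [this]; positivity
  field_simp
  ring

theorem hDist_add_seg (h : GoodC C) (hp : p ∈ C) (hq : q ∈ C) {z : Euc n}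
    (hz : z ∈ segment ℝ p q) : hDist C p q = hDist C p z + hDist C z q := by
  obtain ⟨s, ⟨hs0, hs1⟩, rfl⟩ := (segment_eq_image_lineMap ℝ p q) ▸ hz
  have e : AffineMap.lineMap p q s = p + s • (q - p) := by
    simp [AffineMap.lineMap_apply, add_comm]
  have hq' : p + (1 : ℝ) • (q - p) ∈ C := by simpa using hq
  have hm : p + s • (q - p) ∈ C := h.conv.add_smul_sub_mem hp hq ⟨hs0, hs1⟩
  have a1 := hDist_line h hp (v := q - p) (s := 0) (r := 1) le_rfl zero_le_one hq'
  have a2 := hDist_line h hp (v := q - p) (s := 0) (r := s) le_rfl hs0 hm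
  have a3 := hDist_line h hp (v := q - p) (s := s) (r := 1) hs0 hs1 hq'
  rw [e]
  simp only [zero_smul, add_zero, one_smul, add_sub_cancel] at *
  rw [a1, a2, a3]; ring

theorem gg_tri (h : GoodC C) {x y z : Euc n} (hx : x ∈ C) (hy : y ∈ C) (hz : z ∈ C) :
    (1 - gg C x (y - x)) * (1 - gg C y (z - y)) ≤ 1 - gg C x (z - x) := by
  have g1 := gg_lt_one h hx hy
  have g2 := gg_lt_one h hy hz
  have key : ∀ ε : ℝ, 0 < ε → ε < 1 - gg C x (y - x) → ε < 1 - gg C y (z - y) →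
      (1 - gg C x (y - x) - ε) * (1 - gg C y (z - y) - ε) ≤ 1 - gg C x (z - x) := by
    intro ε he he1 he2
    set a := gg C x (y - x) + ε with ha
    set b := gg C y (z - y) + ε with hb
    have n1 : 0 ≤ gg C x (y - x) := gg_nonneg
    have n2 : 0 ≤ gg C y (z - y) := gg_nonneg
    have ha0 : 0 < a := by positivity
    have hb0 : 0 < b := by positivity
    have P1 : x + a⁻¹ • (y - x) ∈ C := (gg_lt_iff h hx ha0).1 (by linarith)
    have P2 : y + b⁻¹ • (z - y) ∈ C := (gg_lt_iff h hy hb0).1 (by linarith)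
    have hc0 : 0 < 1 - (1 - a) * (1 - b) := by nlinarith
    have : gg C x (z - x) < 1 - (1 - a) * (1 - b) := by
      rw [gg_lt_iff h hx hc0]
      have hm := h.conv P1 P2 (a := (1 - b) * a / (1 - (1 - a) * (1 - b)))
        (b := b / (1 - (1 - a) * (1 - b)))
        (div_nonneg (mul_nonneg (by linarith) ha0.le) hc0.le) (div_nonneg hb0.le hc0.le)
        (by rw [← add_div, div_eq_one_iff_eq hc0.ne']; ring)
      convert hm using 1
      generalize hc : 1 - (1 - a) * (1 - b) = c at *
      have : c = a + b - a * b := by rw [← hc]; ring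
      have hz : z = c • (((1 - b) * a / c) • (x + a⁻¹ • (y - x)) + (b / c) • (y + b⁻¹ • (z - y)))
          + (1 - c) • x := by
        simp only [smul_add, smul_smul, smul_sub]
        match_scalars <;> field_simp <;> (try rw [this]) <;> ring
      nth_rewrite 1 [hz]
      match_scalars <;> field_simp <;> ring
    have e : (1 - gg C x (y - x) - ε) * (1 - gg C y (z - y) - ε) = (1 - a) * (1 - b) := by
      rw [ha, hb]; ring
    rw [e]; linarith
  have hcont : Tendsto (fun ε : ℝ => (1 - gg C x (y - x) - ε) * (1 - gg C y (z - y) - ε))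
      (nhdsWithin 0 (Ioi 0)) (nhds ((1 - gg C x (y - x) - 0) * (1 - gg C y (z - y) - 0))) := by
    apply Tendsto.mono_left _ nhdsWithin_le_nhds
    apply Continuous.tendsto; fun_prop
  rw [sub_zero, sub_zero] at hcont
  refine le_of_tendsto hcont ?_
  have A := Ioo_mem_nhdsGT (show (0 : ℝ) < 1 - gg C x (y - x) by linarith)
  have B := Ioo_mem_nhdsGT (show (0 : ℝ) < 1 - gg C y (z - y) by linarith)
  filter_upwards [A, B] with ε h1 h2
  exact key ε h1.1 h1.2 h2.2

theorem hDist_eq2 (h : GoodC C) (hp : p ∈ C) (hq : q ∈ C) :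
    hDist C p q = (1 / 2) * (-Real.log (1 - gg C p (q - p)) - Real.log (1 - gg C q (p - q))) := by
  rw [hDist_eq h hp hq]
  have g1 := gg_lt_one h hp hq
  have g2 : 0 ≤ gg C p (p - q) := gg_nonneg
  have s2 := gg_shift_neg h hp (v := q - p) (s := 1) (by simpa using hq) zero_le_one
  simp only [one_smul, one_mul, add_sub_cancel, neg_sub] at s2
  have : 1 - gg C q (p - q) = (1 + gg C p (p - q))⁻¹ := by
    rw [s2]; have : 1 + gg C p (p - q) ≠ 0 := by positivity
    field_simp; ring
  rw [this, Real.log_inv, Real.log_div (by positivity) (by linarith)]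
  ring

theorem hDist_tri (h : GoodC C) {x y z : Euc n} (hx : x ∈ C) (hy : y ∈ C) (hz : z ∈ C) :
    hDist C x z ≤ hDist C x y + hDist C y z := by
  rw [hDist_eq2 h hx hy, hDist_eq2 h hy hz, hDist_eq2 h hx hz]
  have t1 := gg_tri h hx hy hz
  have t2 := gg_tri h hz hy hx
  have a1 := gg_lt_one h hx hy
  have a2 := gg_lt_one h hy hz
  have a4 := gg_lt_one h hz hy
  have a5 := gg_lt_one h hy hx
  have l1 := Real.log_le_log (mul_pos (by linarith) (by linarith)) t1
  have l2 := Real.log_le_log (mul_pos (by linarith) (by linarith)) t2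
  rw [Real.log_mul (by linarith) (by linarith)] at l1 l2
  linarith

theorem hDist_near (h : GoodC C) (hq : q ∈ C) {ε : ℝ} (he : 0 < ε) :
    ∀ᶠ y in nhds q, y ∈ C ∧ hDist C q y < ε := by
  have h1 : ∀ᶠ y in nhds q, y ∈ C := h.op.mem_nhds hq
  have hc := gg_continuous h hq
  have h2 : ContinuousAt (fun y => (1 / 2) * Real.log ((1 + gg C q (q - y)) / (1 - gg C q (y - q)))) q := by
    apply ContinuousAt.mul continuousAt_const
    apply ContinuousAt.log
    · apply ContinuousAt.div
      · exact (continuous_const.add (hc.comp (by fun_prop))).continuousAt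
      · exact (continuous_const.sub (hc.comp (by fun_prop))).continuousAt
      · simp
    · simp
  have h3 := h2.eventually_lt (continuousAt_const (y := ε)) (by simpa using he)
  filter_upwards [h1, h3] with y hy1 hy2
  exact ⟨hy1, by rw [hDist_eq h hq hy1]; exact hy2⟩

/-- functional bound -/
theorem func_bound (h : GoodC C) (hp : p ∈ C) (f : Euc n →L[ℝ] ℝ) (a : ℝ)
    (hf : ∀ x ∈ C, 0 < a + f x) : -f v ≤ gg C p v * (a + f p) := by
  have key : ∀ ε : ℝ, 0 < ε → -f v ≤ (gg C p v + ε) * (a + f p) := by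
    intro ε he
    have g0 : 0 ≤ gg C p v := gg_nonneg
    have hc : 0 < gg C p v + ε := by positivity
    have := hf _ ((gg_lt_iff h hp hc).1 (by linarith))
    rw [map_add, map_smul, smul_eq_mul] at this
    have h3 : 0 < (gg C p v + ε) * (a + (f p + (gg C p v + ε)⁻¹ * f v)) := by positivity
    have e : (gg C p v + ε) * (a + (f p + (gg C p v + ε)⁻¹ * f v))
      = (gg C p v + ε) * (a + f p) + f v := by field_simp; ring
    linarith
  have hp' := hf p hp
  apply le_of_forall_pos_le_add
  intro δ hd
  have := key (δ / (a + f p)) (by positivity)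
  have e : (gg C p v + δ / (a + f p)) * (a + f p) = gg C p v * (a + f p) + δ := by field_simp
  linarith

theorem hDist_lower (h : GoodC C) (hp : p ∈ C) (hq : q ∈ C) (f k : Euc n →L[ℝ] ℝ) (a b : ℝ)
    (hf : ∀ x ∈ C, 0 < a + f x) (hk : ∀ x ∈ C, 0 < b + k x) :
    (1 / 2) * Real.log ((a + f p) / (a + f q) * ((b + k q) / (b + k p))) ≤ hDist C p q := by
  rw [hDist_eq h hp hq]
  have f1 := func_bound (v := q - p) h hp f a hf
  have f2 := func_bound (v := p - q) h hp k b hk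
  rw [map_sub] at f1 f2
  have p1 := hf p hp
  have p2 := hf q hq
  have p3 := hk p hp
  have p4 := hk q hq
  have g1 := gg_lt_one h hp hq
  have g2 : 0 ≤ gg C p (p - q) := gg_nonneg
  gcongr ?_ * Real.log ?_
  have e : (1 + gg C p (p - q)) / (1 - gg C p (q - p))
    = 1 / (1 - gg C p (q - p)) * (1 + gg C p (p - q)) := by ring
  rw [e]
  apply mul_le_mul _ _ (by positivity) (by apply div_nonneg <;> linarith)
  · rw [div_le_div_iff₀ p2 (by linarith)]; linarith
  · rw [div_le_iff₀ p3]; linarith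

theorem hDist_upper (h : GoodC C) (hp : p ∈ C) (hq : q ∈ C) {α β : ℝ} (ha : 0 < α) (hb : 0 < β)
    (h1 : p + α • (p - q) ∈ C) (h2 : q + β • (q - p) ∈ C) :
    hDist C p q ≤ (1 / 2) * Real.log ((1 + 1 / α) * (1 + 1 / β)) := by
  rw [hDist_eq h hp hq]
  have g1 : gg C p (p - q) < 1 / α := by rw [gg_lt_iff h hp (by positivity)]; simpa using h1
  have g2 : gg C p (q - p) < 1 / (1 + β) := by
    rw [gg_lt_iff h hp (by positivity)]
    convert h2 using 1
    rw [one_div, inv_inv]; module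
  have n1 : 0 ≤ gg C p (p - q) := gg_nonneg
  have n2 : 0 ≤ gg C p (q - p) := gg_nonneg
  have n3 : (1 : ℝ) / (1 + β) < 1 := by rw [div_lt_one (by positivity)]; linarith
  have : 0 < (1 + gg C p (p - q)) / (1 - gg C p (q - p)) := by
    apply div_pos <;> linarith
  gcongr ?_ * Real.log ?_
  rw [div_le_iff₀ (by linarith)]
  have e : (1 + 1 / β) * (1 - 1 / (1 + β)) = 1 := by field_simp; ring
  have e2 : 0 ≤ (1 + 1 / α) * (1 + 1 / β) := by positivity
  calc 1 + gg C p (p - q) ≤ (1 + 1 / α) * ((1 + 1 / β) * (1 - 1 / (1 + β))) := by rw [e]; linarith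
    _ = (1 + 1 / α) * (1 + 1 / β) * (1 - 1 / (1 + β)) := by ring
    _ ≤ _ := by gcongr

end base

end

section
open MeasureTheory Set Filter
open scoped ENNReal NNReal

section geo
variable {n : ℕ} {C : Set (Euc n)} {p q u v x y z t : Euc n}

theorem seg_sub (h : GoodC C) (hx : x ∈ C) (hy : y ∈ C) (hp : p ∈ segment ℝ x y) : p ∈ C :=
  h.conv.segment_subset hx hy hp

def nbC (C : Set (Euc n)) (S : Set (Euc n)) (M : ℝ) : Set (Euc n) :=
  {p | p ∈ C ∧ ∃ q ∈ S, hDist C p q < M}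

theorem nbC_open (h : GoodC C) {S : Set (Euc n)} (hS : S ⊆ C) (M : ℝ) : IsOpen (nbC C S M) := by
  rw [isOpen_iff_mem_nhds]
  rintro p ⟨hp, q, hq, hd⟩
  filter_upwards [hDist_near h hp (sub_pos.2 hd)] with y hy
  refine ⟨hy.1, q, hq, ?_⟩
  have := hDist_tri h hy.1 hp (hS hq)
  rw [hDist_comm h hy.1 hp] at this
  linarith [hy.2]

theorem nbC_conn (h : GoodC C) {K S T : Set (Euc n)} {M : ℝ} (hK : IsPreconnected K)
    (hS : S ⊆ C) (hT : T ⊆ C) (hc : ∀ p ∈ K, p ∈ C ∧ ∃ q ∈ S ∪ T, hDist C p q < M)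
    (h1 : (K ∩ nbC C S M).Nonempty) (h2 : (K ∩ nbC C T M).Nonempty) :
    ∃ p ∈ K, (∃ q ∈ S, hDist C p q < M) ∧ (∃ q ∈ T, hDist C p q < M) := by
  obtain ⟨p, hp, h3, h4⟩ := hK _ _ (nbC_open h hS M) (nbC_open h hT M) (by
    intro p hp
    obtain ⟨a, q, hq | hq, hd⟩ := hc p hp
    · exact Or.inl ⟨a, q, hq, hd⟩
    · exact Or.inr ⟨a, q, hq, hd⟩) h1 h2
  exact ⟨p, hp, h3.2, h4.2⟩

def ThinC (C : Set (Euc n)) (M : ℝ) : Prop :=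
  ∀ x ∈ C, ∀ y ∈ C, ∀ z ∈ C, ∀ p ∈ segment ℝ x y,
    ∃ q ∈ segment ℝ x z ∪ segment ℝ z y, hDist C p q < M

theorem thin_hyp (h : GoodC C) {M : ℝ} (hM : 0 < M) (ht : ThinC C M) : IsDeltaHyp C (3 * M) := by
  intro x hx y hy z hz t htC
  obtain ⟨p, hp, ⟨a, ha, hda⟩, ⟨b, hb, hdb⟩⟩ := nbC_conn h (K := segment ℝ x y)
    (S := segment ℝ x t) (T := segment ℝ t y) (M := M) (convex_segment x y).isPreconnected
    (h.conv.segment_subset hx htC) (h.conv.segment_subset htC hy)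
    (fun p hp => ⟨seg_sub h hx hy hp, ht x hx y hy t htC p hp⟩)
    ⟨x, left_mem_segment _ _ _, hx, x, left_mem_segment _ _ _, by simpa using hM⟩
    ⟨y, right_mem_segment _ _ _, hy, y, right_mem_segment _ _ _, by simpa using hM⟩
  have hpC := seg_sub h hx hy hp
  have haC := seg_sub h hx htC ha
  have hbC := seg_sub h htC hy hb
  have e1 := hDist_add_seg h hx hy hp
  have e2 := hDist_add_seg h hx htC ha
  have e3 := hDist_add_seg h htC hy hb
  have t1 := hDist_tri h hx haC hpC
  have t2 := hDist_tri h hpC haC htC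
  have t3 := hDist_tri h hpC hbC htC
  have t4 := hDist_tri h hpC hbC hy
  rw [hDist_comm h haC hpC] at t1
  rw [hDist_comm h htC hy, hDist_comm h htC hbC] at e3
  have k1 : hDist C p t - 2 * M ≤ gromovProd (hDist C) x y t := by
    unfold gromovProd; linarith
  have k2 : min (gromovProd (hDist C) x z t) (gromovProd (hDist C) y z t) ≤ hDist C p t + M := by
    obtain ⟨c, hc | hc, hdc⟩ := ht x hx y hy z hz p hp
    · refine (min_le_left _ _).trans ?_
      have hcC := seg_sub h hx hz hc
      have f1 := hDist_add_seg h hx hz hc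
      have f2 := hDist_tri h hx hcC htC
      have f3 := hDist_tri h hz hcC htC
      have f4 := hDist_tri h hcC hpC htC
      rw [hDist_comm h hz hcC] at f3
      rw [hDist_comm h hcC hpC] at f4
      unfold gromovProd; linarith
    · refine (min_le_right _ _).trans ?_
      have hcC := seg_sub h hz hy hc
      have f1 := hDist_add_seg h hz hy hc
      have f2 := hDist_tri h hy hcC htC
      have f3 := hDist_tri h hz hcC htC
      have f4 := hDist_tri h hcC hpC htC
      rw [hDist_comm h hz hcC] at f3 f1
      rw [hDist_comm h hy hcC] at f2
      rw [hDist_comm h hcC hpC] at f4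
      unfold gromovProd
      rw [hDist_comm h hy hz, f1]
      linarith
  linarith

theorem seg_union (hz : z ∈ range (AffineMap.lineMap x y : ℝ → Euc n)) (hp : p ∈ segment ℝ x y) :
    p ∈ segment ℝ x z ∪ segment ℝ z y := by
  rw [← insert_endpoints_openSegment] at hp
  rcases hp with rfl | rfl | hp
  · exact Or.inl (left_mem_segment _ _ _)
  · exact Or.inr (right_mem_segment _ _ _)
  · rcases openSegment_subset_union x y hz hp with rfl | h1 | h1
    · exact Or.inl (right_mem_segment _ _ _)
    · exact Or.inl (openSegment_subset_segment _ _ _ h1)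
    · exact Or.inr (openSegment_subset_segment _ _ _ h1)

theorem seg_range (hz : z ∈ segment ℝ x y) : z ∈ range (AffineMap.lineMap x y : ℝ → Euc n) := by
  rw [segment_eq_image_lineMap] at hz
  exact image_subset_range _ _ hz

/-- point at distance `r` from `p` in direction `Z`. -/
noncomputable def ptAt (C : Set (Euc n)) (p : Euc n) (r : ℝ) (Z : Euc n) : Euc n :=
  p + ((Real.exp (2 * r) - 1) / (Real.exp (2 * r) * gg C p (Z - p) + gg C p (p - Z))) • (Z - p)

theorem ptAt_spec (h : GoodC C) (hp : p ∈ C) (hz : z ∈ C) {r : ℝ} (hr : 0 < r)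
    (hd : r < hDist C p z) : ptAt C p r z ∈ segment ℝ p z ∧ hDist C p (ptAt C p r z) = r := by
  have hzp : z ≠ p := by rintro rfl; rw [hDist_self] at hd; linarith
  have g1 : 0 < gg C p (z - p) := gg_pos h hp (sub_ne_zero.2 hzp)
  have g2 : 0 < gg C p (p - z) := gg_pos h hp (sub_ne_zero.2 hzp.symm)
  have g3 := gg_lt_one h hp hz
  have hE : 1 < Real.exp (2 * r) := Real.one_lt_exp_iff.2 (by linarith)
  rw [hDist_eq h hp hz] at hd
  have h1 : Real.exp (2 * r) < (1 + gg C p (p - z)) / (1 - gg C p (z - p)) := by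
    rw [← Real.lt_log_iff_exp_lt (div_pos (by linarith) (by linarith))]; linarith
  rw [lt_div_iff₀ (by linarith)] at h1
  have hD : 0 < Real.exp (2 * r) * gg C p (z - p) + gg C p (p - z) := by positivity
  set E := Real.exp (2 * r) with hEdef
  set D := E * gg C p (z - p) + gg C p (p - z) with hDdef
  have l0 : 0 < (E - 1) / D := div_pos (by linarith) hD
  have l1 : (E - 1) / D < 1 := by rw [div_lt_one hD]; linarith
  have hs : ptAt C p r z ∈ segment ℝ p z := by
    rw [segment_eq_image']
    exact ⟨(E - 1) / D, ⟨l0.le, l1.le⟩, rfl⟩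
  refine ⟨hs, ?_⟩
  rw [hDist_eq h hp (seg_sub h hp hz hs)]
  have e1 : ptAt C p r z - p = ((E - 1) / D) • (z - p) := by simp [ptAt, ← hEdef, ← hDdef]
  have e2 : p - ptAt C p r z = ((E - 1) / D) • (p - z) := by
    rw [← neg_sub, e1, ← smul_neg, neg_sub]
  rw [e1, e2, gg_smul l0.le, gg_smul l0.le]
  have : (1 + (E - 1) / D * gg C p (p - z)) / (1 - (E - 1) / D * gg C p (z - p)) = E := by
    rw [div_eq_iff (by nlinarith)]
    have : (E - 1) / D * D = E - 1 := by field_simp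
    have e : (E - 1) / D * D = E * ((E - 1) / D * gg C p (z - p)) + (E - 1) / D * gg C p (p - z) := by
      conv_lhs => rw [hDdef]
      ring
    linarith
  rw [this, hEdef, Real.log_exp]; ring

theorem ptAt_cont (h : GoodC C) (hp : p ∈ C) {r : ℝ} {K : Set (Euc n)} (hK : p ∉ K) :
    ContinuousOn (ptAt C p r) K := by
  have hc := gg_continuous h hp
  unfold ptAt
  apply ContinuousOn.add continuousOn_const
  refine ContinuousOn.fun_smul ?_ (by fun_prop)
  apply ContinuousOn.div continuousOn_const
  · exact ((continuous_const.mul (hc.comp (by fun_prop))).add (hc.comp (by fun_prop))).continuousOn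
  · intro z hz
    have hzp : z ≠ p := by rintro rfl; exact hK hz
    have g1 : 0 < gg C p (z - p) := gg_pos h hp (sub_ne_zero.2 hzp)
    have g2 : 0 < gg C p (p - z) := gg_pos h hp (sub_ne_zero.2 hzp.symm)
    have := Real.exp_pos (2 * r)
    positivity

theorem fat_center (h : GoodC C) {M : ℝ} (hM : 0 < M) (hx : x ∈ C) (hy : y ∈ C) (hz : z ∈ C)
    (hp : p ∈ segment ℝ x y)
    (hfar : ∀ q ∈ segment ℝ x z ∪ segment ℝ z y, M ≤ hDist C p q) :
    ∃ Z ∈ segment ℝ x z ∪ segment ℝ z y, ∃ q ∈ segment ℝ p Z,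
      ∀ w ∈ segment ℝ x y ∪ (segment ℝ x z ∪ segment ℝ z y), M / 10 ≤ hDist C q w := by
  have hpC := seg_sub h hx hy hp
  set K := segment ℝ x z ∪ segment ℝ z y with hKdef
  have hKC : K ⊆ C := union_subset (h.conv.segment_subset hx hz) (h.conv.segment_subset hz hy)
  have hpK : p ∉ K := fun hh => by have := hfar p hh; rw [hDist_self] at this; linarith
  have hKconn : IsPreconnected K :=
    IsPreconnected.union z (right_mem_segment _ _ _) (left_mem_segment _ _ _)
      (convex_segment x z).isPreconnected (convex_segment z y).isPreconnected
  have hspec : ∀ Z ∈ K, ptAt C p (M / 2) Z ∈ segment ℝ p Z ∧ hDist C p (ptAt C p (M / 2) Z) = M / 2 :=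
    fun Z hZ => ptAt_spec h hpC (hKC hZ) (by linarith) (by linarith [hfar Z hZ])
  have hqC : ∀ Z ∈ K, ptAt C p (M / 2) Z ∈ C := fun Z hZ => seg_sub h hpC (hKC hZ) (hspec Z hZ).1
  have hxK : x ∈ K := Or.inl (left_mem_segment _ _ _)
  have hyK : y ∈ K := Or.inr (right_mem_segment _ _ _)
  by_contra hcon
  push Not at hcon
  have hnear : ∀ Z ∈ K, ∃ q ∈ segment ℝ x p ∪ segment ℝ p y, hDist C (ptAt C p (M / 2) Z) q < M / 10 := by
    intro Z hZ
    obtain ⟨w, hw, hd⟩ := hcon Z hZ _ (hspec Z hZ).1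
    rcases hw with hw | hw
    · exact ⟨w, seg_union (seg_range hp) hw, hd⟩
    · exfalso
      have := hfar w hw
      have := hDist_tri h hpC (hqC Z hZ) (hKC hw)
      linarith [(hspec Z hZ).2]
  obtain ⟨_, ⟨Z, hZ, rfl⟩, ⟨a, ha, hda⟩, ⟨b, hb, hdb⟩⟩ := nbC_conn h (M := M / 10)
    (hKconn.image _ (ptAt_cont h hpC (r := M / 2) hpK))
    (h.conv.segment_subset hx hpC) (h.conv.segment_subset hpC hy)
    (by rintro _ ⟨Z, hZ, rfl⟩; exact ⟨hqC Z hZ, hnear Z hZ⟩)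
    ⟨_, ⟨x, hxK, rfl⟩, hqC x hxK, _, by rw [segment_symm]; exact (hspec x hxK).1, by simp; linarith⟩
    ⟨_, ⟨y, hyK, rfl⟩, hqC y hyK, _, (hspec y hyK).1, by simp; linarith⟩
  have haC := seg_sub h hx hpC ha
  have hbC := seg_sub h hpC hy hb
  have hqC' := hqC Z hZ
  have e1 := hDist_add_seg h hx hy hp
  have e2 := hDist_add_seg h hx hpC ha
  have e3 := hDist_add_seg h hpC hy hb
  have t1 := hDist_tri h hx haC hy
  have t2 := hDist_tri h haC hbC hy
  have t3 := hDist_tri h haC hqC' hbC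
  have t4 := hDist_tri h hpC haC hqC'
  have t5 := hDist_tri h hpC hbC hqC'
  rw [hDist_comm h haC hqC'] at t3 t4
  rw [hDist_comm h hbC hqC'] at t5
  rw [hDist_comm h hpC haC] at t4
  have := (hspec Z hZ).2
  linarith

end geo

/-- A triangle in the plane with barycentric functionals. -/
structure Tri (C : Set (Euc 2)) where
  z : Euc 2
  e₁ : Euc 2
  e₂ : Euc 2
  A : Euc 2 →L[ℝ] ℝ
  B : Euc 2 →L[ℝ] ℝ
  hz : z ∈ C
  h1 : z + e₁ ∈ C
  h2 : z + e₂ ∈ C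
  dec : ∀ v, v = A v • e₁ + B v • e₂
  A1 : A e₁ = 1
  A2 : A e₂ = 0
  B1 : B e₁ = 0
  B2 : B e₂ = 1

namespace Tri
variable {C : Set (Euc 2)} (T : Tri C)
def l₁ (p : Euc 2) : ℝ := T.A (p - T.z)
def l₂ (p : Euc 2) : ℝ := T.B (p - T.z)
def l₃ (p : Euc 2) : ℝ := 1 - T.A (p - T.z) - T.B (p - T.z)
def Dl : Set (Euc 2) := {p | 0 < T.l₁ p ∧ 0 < T.l₂ p ∧ 0 < T.l₃ p}

theorem eq_pt (p : Euc 2) : p = T.l₃ p • T.z + T.l₁ p • (T.z + T.e₁) + T.l₂ p • (T.z + T.e₂) := by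
  have := T.dec (p - T.z)
  have h : p = T.z + (p - T.z) := by abel
  conv_lhs => rw [h, this]
  unfold l₁ l₂ l₃
  module

theorem Dl_sub (h : Convex ℝ C) : T.Dl ⊆ C := by
  rintro p ⟨h1, h2, h3⟩
  rw [T.eq_pt p]
  have hs : T.l₃ p + T.l₁ p + T.l₂ p = 1 := by unfold l₁ l₂ l₃; ring
  have h4 := h T.hz T.h1 (a := T.l₃ p / (T.l₃ p + T.l₁ p)) (b := T.l₁ p / (T.l₃ p + T.l₁ p))
    (by positivity) (by positivity) (by field_simp)
  have := h h4 T.h2 (a := T.l₃ p + T.l₁ p) (b := T.l₂ p) (by positivity) h2.le hs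
  convert this using 2
  match_scalars <;> field_simp

theorem side {p : Euc 2} (h1 : 0 ≤ T.l₁ p) (h2 : 0 ≤ T.l₂ p) (h3 : 0 ≤ T.l₃ p)
    (h0 : p ∉ T.Dl) : p ∈ segment ℝ (T.z + T.e₁) (T.z + T.e₂) ∪
      (segment ℝ (T.z + T.e₁) T.z ∪ segment ℝ T.z (T.z + T.e₂)) := by
  have hs : T.l₃ p + T.l₁ p + T.l₂ p = 1 := by unfold l₁ l₂ l₃; ring
  have he := T.eq_pt p
  rcases h3.eq_or_lt with e | e
  · left
    refine ⟨T.l₁ p, T.l₂ p, h1, h2, by linarith, ?_⟩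
    conv_rhs => rw [he, ← e]
    module
  rcases h2.eq_or_lt with e' | e'
  · right; left
    refine ⟨T.l₁ p, T.l₃ p, h1, h3, by linarith, ?_⟩
    conv_rhs => rw [he, ← e']
    module
  rcases h1.eq_or_lt with e'' | e''
  · right; right
    refine ⟨T.l₃ p, T.l₂ p, h3, h2, by linarith, ?_⟩
    conv_rhs => rw [he, ← e'']
    module
  exact absurd ⟨e'', e', e⟩ h0

theorem l_comb₁ {x y : Euc 2} {a b : ℝ} (hab : a + b = 1) :
    T.l₁ (a • x + b • y) = a * T.l₁ x + b * T.l₁ y := by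
  unfold l₁; simp only [map_sub, map_add, map_smul, smul_eq_mul]
  linear_combination (T.A T.z) * hab
theorem l_comb₂ {x y : Euc 2} {a b : ℝ} (hab : a + b = 1) :
    T.l₂ (a • x + b • y) = a * T.l₂ x + b * T.l₂ y := by
  unfold l₂; simp only [map_sub, map_add, map_smul, smul_eq_mul]
  linear_combination (T.B T.z) * hab
theorem l_comb₃ {x y : Euc 2} {a b : ℝ} (hab : a + b = 1) :
    T.l₃ (a • x + b • y) = a * T.l₃ x + b * T.l₃ y := by
  unfold l₃; simp only [map_sub, map_add, map_smul, smul_eq_mul]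
  linear_combination (-T.A T.z - T.B T.z - 1) * hab

def cl : Set (Euc 2) := {p | 0 ≤ T.l₁ p ∧ 0 ≤ T.l₂ p ∧ 0 ≤ T.l₃ p}
theorem cl_conv : Convex ℝ T.cl := by
  intro x hx y hy a b ha hb hab
  obtain ⟨x1, x2, x3⟩ := hx
  obtain ⟨y1, y2, y3⟩ := hy
  refine ⟨?_, ?_, ?_⟩
  · rw [T.l_comb₁ hab]; positivity
  · rw [T.l_comb₂ hab]; positivity
  · rw [T.l_comb₃ hab]; positivity
theorem cl_v : T.z ∈ T.cl ∧ T.z + T.e₁ ∈ T.cl ∧ T.z + T.e₂ ∈ T.cl := by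
  simp [cl, l₁, l₂, l₃, T.A1, T.A2, T.B1, T.B2, add_comm]

theorem ball_sub (h : GoodC C) {q : Euc 2} {r : ℝ} (hr : 0 < r) (hqc : q ∈ T.cl) (hqC : q ∈ C)
    (hq : ∀ w ∈ segment ℝ (T.z + T.e₁) (T.z + T.e₂) ∪
      (segment ℝ (T.z + T.e₁) T.z ∪ segment ℝ T.z (T.z + T.e₂)), r ≤ hDist C q w) :
    q ∈ T.Dl ∧ ∀ w ∈ C, hDist C q w < r → w ∈ T.Dl := by
  have hqD : q ∈ T.Dl := by
    by_contra hc
    have := hq q (T.side hqc.1 hqc.2.1 hqc.2.2 hc)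
    rw [hDist_self] at this; linarith
  refine ⟨hqD, fun w hw hd => ?_⟩
  by_contra hc
  set m : ℝ → ℝ := fun s => min (T.l₁ (q + s • (w - q))) (min (T.l₂ (q + s • (w - q))) (T.l₃ (q + s • (w - q))))
  have hm : Continuous m := by
    simp only [m, l₁, l₂, l₃]; fun_prop
  have m0 : 0 < m 0 := by
    simp only [m, zero_smul, add_zero]
    exact lt_min hqD.1 (lt_min hqD.2.1 hqD.2.2)
  have m1 : m 1 ≤ 0 := by
    by_contra hm
    push Not at hm
    simp only [m, one_smul, add_sub_cancel] at hm
    rw [lt_min_iff, lt_min_iff] at hm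
    exact hc hm
  obtain ⟨s, hs, hms⟩ := intermediate_value_Icc' zero_le_one hm.continuousOn ⟨m1, m0.le⟩
  have hseg : q + s • (w - q) ∈ segment ℝ q w := by
    rw [segment_eq_image']; exact ⟨s, hs, rfl⟩
  have hsd := hms.ge
  simp only [m, le_min_iff] at hsd
  have := hq _ (T.side hsd.1 hsd.2.1 hsd.2.2 (by
    intro hD
    have : 0 < m s := lt_min hD.1 (lt_min hD.2.1 hD.2.2)
    linarith))
  have e := hDist_add_seg h hqC hw hseg
  have := hDist_nonneg h (seg_sub h hqC hw hseg) hw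
  linarith
end Tri

theorem fat_tri {C : Set (Euc 2)} (h : GoodC C) {M : ℝ} (hM : 0 < M) (hn : ¬ ThinC C M) :
    ∃ (T : Tri C) (q : Euc 2), q ∈ T.Dl ∧ ∀ w ∈ C, hDist C q w < M / 10 → w ∈ T.Dl := by
  unfold ThinC at hn
  push Not at hn
  obtain ⟨x, hx, y, hy, z, hz, p, hp, hfar⟩ := hn
  have hpK : p ∉ segment ℝ x z ∪ segment ℝ z y := fun hh => by
    have := hfar p hh; rw [hDist_self] at this; linarith
  have hli : LinearIndependent ℝ ![x - z, y - z] := by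
    rw [LinearIndependent.pair_iff]
    intro a b hab
    by_contra hne
    by_cases hs : a + b = 0
    · have ha : a ≠ 0 := by
        intro ha; apply hne; exact ⟨ha, by linarith⟩
      have : a • (x - y) = 0 := by
        rw [← hab, (by linarith : b = -a)]; module
      have hxy : x = y := by
        have := (smul_eq_zero.1 this).resolve_left ha
        exact sub_eq_zero.1 this
      subst hxy
      rw [segment_same] at hp
      rw [mem_singleton_iff] at hp
      subst hp
      exact hpK (Or.inl (left_mem_segment _ _ _))
    · apply hpK
      apply seg_union _ hp
      refine ⟨b / (a + b), ?_⟩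
      rw [AffineMap.lineMap_apply]
      simp only [vsub_eq_sub, vadd_eq_add]
      have e : z = (a + b)⁻¹ • (a • x + b • y) := by
        rw [eq_inv_smul_iff₀ hs]
        have : a • x + b • y - (a + b) • z = 0 := by rw [← hab]; module
        exact (sub_eq_zero.1 this).symm
      rw [e]
      have e2 : x = (a + b)⁻¹ • ((a + b) • x) := by rw [inv_smul_smul₀ hs]
      rw [div_eq_inv_mul, mul_smul]
      conv_lhs => rw [add_comm]; lhs; rw [e2]
      rw [← smul_add]; congr 1; module
  let bs := basisOfLinearIndependentOfCardEqFinrank hli (by simp)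
  have hb : ∀ i, bs i = ![x - z, y - z] i := by intro i; simp [bs]
  let T : Tri C :=
    { z := z, e₁ := x - z, e₂ := y - z
      A := LinearMap.toContinuousLinearMap (bs.coord 0)
      B := LinearMap.toContinuousLinearMap (bs.coord 1)
      hz := hz
      h1 := by simpa using hx
      h2 := by simpa using hy
      dec := by
        intro v
        have := bs.sum_repr v
        rw [Fin.sum_univ_two, hb, hb] at this
        simpa using this.symm
      A1 := by
        have := hb 0; simp at this; simp [← this]
      A2 := by
        have := hb 1; simp at this; simp [← this]
      B1 := by
        have := hb 0; simp at this; simp [← this]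
      B2 := by
        have := hb 1; simp at this; simp [← this] }
  obtain ⟨Z, hZ, q, hq, hqf⟩ := fat_center h hM hx hy hz hp hfar
  have ex : T.z + T.e₁ = x := by simp [T]
  have ey : T.z + T.e₂ = y := by simp [T]
  have ez : T.z = z := rfl
  obtain ⟨c1, c2, c3⟩ := T.cl_v
  rw [ex] at c2; rw [ey] at c3; rw [ez] at c1
  have hcv := T.cl_conv
  have hpc : p ∈ T.cl := hcv.segment_subset c2 c3 hp
  have hZc : Z ∈ T.cl := by
    rcases hZ with hZ | hZ
    · exact hcv.segment_subset c2 c1 hZ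
    · exact hcv.segment_subset c1 c3 hZ
  have hZC : Z ∈ C := by
    rcases hZ with hZ | hZ
    · exact seg_sub h hx hz hZ
    · exact seg_sub h hz hy hZ
  have hqC : q ∈ C := seg_sub h (seg_sub h hx hy hp) hZC hq
  refine ⟨T, q, T.ball_sub h (by linarith) (hcv.segment_subset hpc hZc hq) hqC ?_⟩
  rw [ex, ey, ez]; exact hqf

end

section
open MeasureTheory Set Filter
open scoped ENNReal NNReal

section dual
variable {n : ℕ} {C : Set (Euc n)} {p q u v x y z t : Euc n}

theorem fNorm_neg (h : GoodC C) (hp : p ∈ C) : fNorm C p (-u) = fNorm C p u := by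
  rw [fNorm_eq h hp, fNorm_eq h hp, neg_neg, add_comm]

theorem fNorm_smul (h : GoodC C) (hp : p ∈ C) {c : ℝ} (hc : 0 ≤ c) :
    fNorm C p (c • u) = c * fNorm C p u := by
  rw [fNorm_eq h hp, fNorm_eq h hp, ← smul_neg, gg_smul hc, gg_smul hc]; ring

theorem fNorm_nonneg (h : GoodC C) (hp : p ∈ C) : 0 ≤ fNorm C p u := by
  rw [fNorm_eq h hp]
  have : 0 ≤ gg C p u := gg_nonneg
  have : 0 ≤ gg C p (-u) := gg_nonneg
  positivity

theorem fNorm_pos (h : GoodC C) (hp : p ∈ C) (hu : u ≠ 0) : 0 < fNorm C p u := by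
  rw [fNorm_eq h hp]
  have : 0 < gg C p u := gg_pos h hp hu
  have : 0 ≤ gg C p (-u) := gg_nonneg
  positivity

theorem fNorm_cont (h : GoodC C) (hp : p ∈ C) : Continuous (fNorm C p) := by
  have : fNorm C p = fun u => (1 / 2) * (gg C p u + gg C p (-u)) := by
    ext u; exact fNorm_eq h hp
  rw [this]
  have hc := gg_continuous h hp
  exact continuous_const.mul (hc.add (hc.comp continuous_neg))

theorem fNorm_lt_one (h : GoodC C) (h1 : p + u ∈ C) (h2 : p - u ∈ C) (hp : p ∈ C) :
    fNorm C p u < 1 := by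
  rw [fNorm_eq h hp]
  have := (gg_lt_one_iff h hp).2 h1
  have := (gg_lt_one_iff h hp (u := -u)).2 (by rwa [← sub_eq_add_neg])
  linarith

theorem dualNorm_nonneg (h : GoodC C) (hp : p ∈ C) (l : Euc n →L[ℝ] ℝ) :
    0 ≤ dualNorm C p l := by
  unfold dualNorm
  rcases ((fun u => l u) '' {u : Euc n | fNorm C p u = 1}).eq_empty_or_nonempty with he | ⟨_, u, hu, rfl⟩
  · rw [he]; simp
  · apply Real.sSup_nonneg'
    rcases le_total 0 (l u) with h0 | h0
    · exact ⟨_, ⟨u, hu, rfl⟩, h0⟩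
    · refine ⟨_, ⟨-u, ?_, rfl⟩, by simpa using h0⟩
      have : fNorm C p u = 1 := hu
      show fNorm C p (-u) = 1
      rw [fNorm_neg h hp, this]

theorem dualNorm_le {l : Euc n →L[ℝ] ℝ} {K : ℝ} (hK : 0 ≤ K) (hl : ∀ u, l u ≤ K * fNorm C p u) :
    dualNorm C p l ≤ K := by
  unfold dualNorm
  apply Real.sSup_le _ hK
  rintro _ ⟨u, hu, rfl⟩
  have : fNorm C p u = 1 := hu
  have := hl u
  simp_all

theorem dualNorm_zero : dualNorm C p 0 = 0 := by
  unfold dualNorm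
  rcases ({u : Euc n | fNorm C p u = 1}).eq_empty_or_nonempty with he | he
  · rw [he]; simp
  · simp [he.image_const]

end dual

namespace Tri
variable {C : Set (Euc 2)} (T : Tri C)

theorem l_add₁ (p u : Euc 2) : T.l₁ (p + u) = T.l₁ p + T.A u := by
  unfold l₁; rw [add_sub_right_comm, map_add]
theorem l_add₂ (p u : Euc 2) : T.l₂ (p + u) = T.l₂ p + T.B u := by
  unfold l₂; rw [add_sub_right_comm, map_add]
theorem l_add₃ (p u : Euc 2) : T.l₃ (p + u) = T.l₃ p - (T.A u + T.B u) := by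
  unfold l₃; rw [add_sub_right_comm, map_add, map_add]; ring
theorem l_sum (p : Euc 2) : T.l₁ p + T.l₂ p + T.l₃ p = 1 := by unfold l₁ l₂ l₃; ring

theorem l_cont₁ : Continuous T.l₁ := by unfold l₁; fun_prop
theorem l_cont₂ : Continuous T.l₂ := by unfold l₂; fun_prop
theorem l_cont₃ : Continuous T.l₃ := by unfold l₃; fun_prop

theorem Dl_open : IsOpen T.Dl :=
  (isOpen_lt continuous_const T.l_cont₁).inter
    ((isOpen_lt continuous_const T.l_cont₂).inter (isOpen_lt continuous_const T.l_cont₃))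

noncomputable def H₁ (p : Euc 2) : ℝ := Real.log (T.l₁ p) - Real.log (T.l₃ p)
noncomputable def H₂ (p : Euc 2) : ℝ := Real.log (T.l₂ p) - Real.log (T.l₃ p)

theorem ratio_aux {a1 a2 a3 b1 b2 b3 r : ℝ} (ha1 : 0 < a1) (ha2 : 0 < a2) (ha3 : 0 < a3)
    (hb1 : 0 < b1) (hb2 : 0 < b2) (hb3 : 0 < b3) (hr : 0 ≤ r)
    (sa : a1 + a2 + a3 = 1) (sb : b1 + b2 + b3 = 1)
    (h1 : |(Real.log a1 - Real.log a3) - (Real.log b1 - Real.log b3)| ≤ r)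
    (h2 : |(Real.log a2 - Real.log a3) - (Real.log b2 - Real.log b3)| ≤ r) :
    a1 ≤ Real.exp (2 * r) * b1 ∧ a2 ≤ Real.exp (2 * r) * b2 ∧ a3 ≤ Real.exp (2 * r) * b3 := by
  have key : Real.log a3 - Real.log b3 ≤ r := by
    by_contra hc
    push Not at hc
    rw [abs_le] at h1 h2
    have c1 : b1 < a1 := (Real.log_lt_log_iff hb1 ha1).1 (by linarith)
    have c2 : b2 < a2 := (Real.log_lt_log_iff hb2 ha2).1 (by linarith)
    have c3 : b3 < a3 := (Real.log_lt_log_iff hb3 ha3).1 (by linarith)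
    linarith
  rw [abs_le] at h1 h2
  have he : Real.log (Real.exp (2 * r)) = 2 * r := Real.log_exp _
  have hp := Real.exp_pos (2 * r)
  refine ⟨?_, ?_, ?_⟩
  · rw [← Real.log_le_log_iff ha1 (by positivity), Real.log_mul hp.ne' hb1.ne', he]; linarith
  · rw [← Real.log_le_log_iff ha2 (by positivity), Real.log_mul hp.ne' hb2.ne', he]; linarith
  · rw [← Real.log_le_log_iff ha3 (by positivity), Real.log_mul hp.ne' hb3.ne', he]; linarith

theorem ratio {p q : Euc 2} (hp : p ∈ T.Dl) (hq : q ∈ T.Dl) {r : ℝ} (hr : 0 ≤ r)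
    (h1 : |T.H₁ p - T.H₁ q| ≤ r) (h2 : |T.H₂ p - T.H₂ q| ≤ r) :
    T.l₁ p ≤ Real.exp (2 * r) * T.l₁ q ∧ T.l₂ p ≤ Real.exp (2 * r) * T.l₂ q ∧
      T.l₃ p ≤ Real.exp (2 * r) * T.l₃ q :=
  ratio_aux hp.1 hp.2.1 hp.2.2 hq.1 hq.2.1 hq.2.2 hr (T.l_sum p) (T.l_sum q) h1 h2

theorem ext_mem {p q : Euc 2} (hp : p ∈ T.Dl) {a : ℝ} (ha : 0 < a)
    (h1 : T.l₁ q ≤ a * T.l₁ p) (h2 : T.l₂ q ≤ a * T.l₂ p) (h3 : T.l₃ q ≤ a * T.l₃ p) :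
    p + a⁻¹ • (p - q) ∈ T.Dl := by
  have e1 : T.A (p - q) = T.l₁ p - T.l₁ q := by unfold l₁; simp
  have e2 : T.B (p - q) = T.l₂ p - T.l₂ q := by unfold l₂; simp
  have hai : 0 < a⁻¹ := by positivity
  have e : a⁻¹ * a = 1 := by field_simp
  have s1 := T.l_sum p
  have s2 := T.l_sum q
  obtain ⟨p1, p2, p3⟩ := hp
  have k1 := mul_le_mul_of_nonneg_left h1 hai.le
  have k2 := mul_le_mul_of_nonneg_left h2 hai.le
  have k3 := mul_le_mul_of_nonneg_left h3 hai.le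
  rw [← mul_assoc, e, one_mul] at k1 k2 k3
  have m1 := mul_pos hai p1
  have m2 := mul_pos hai p2
  have m3 := mul_pos hai p3
  refine ⟨?_, ?_, ?_⟩
  · rw [T.l_add₁, map_smul, e1, smul_eq_mul]; linarith
  · rw [T.l_add₂, map_smul, e2, smul_eq_mul]; linarith
  · have : a⁻¹ * (T.l₁ p - T.l₁ q) + a⁻¹ * (T.l₂ p - T.l₂ q) = - (a⁻¹ * (T.l₃ p - T.l₃ q)) := by
      rw [← mul_add, ← mul_neg]; congr 1; linarith
    rw [T.l_add₃, map_smul, map_smul, e1, e2, smul_eq_mul, smul_eq_mul, this]; linarith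

theorem dist_bound (h : GoodC C) {p q : Euc 2} (hp : p ∈ T.Dl) (hq : q ∈ T.Dl) {r : ℝ} (hr : 0 ≤ r)
    (h1 : |T.H₁ p - T.H₁ q| ≤ r) (h2 : |T.H₂ p - T.H₂ q| ≤ r) : hDist C p q ≤ 2 * r + 1 := by
  have hD := T.Dl_sub h.conv
  obtain ⟨a1, a2, a3⟩ := T.ratio hp hq hr h1 h2
  obtain ⟨b1, b2, b3⟩ := T.ratio hq hp hr (by rwa [abs_sub_comm]) (by rwa [abs_sub_comm])
  have he := Real.exp_pos (2 * r)
  have := hDist_upper h (hD hp) (hD hq) (inv_pos.2 he) (inv_pos.2 he)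
    (hD (T.ext_mem hp he b1 b2 b3)) (hD (T.ext_mem hq he a1 a2 a3))
  refine this.trans ?_
  simp only [one_div, inv_inv]
  rw [Real.log_mul (by positivity) (by positivity)]
  have : Real.log (1 + Real.exp (2 * r)) ≤ 2 * r + 1 := by
    rw [Real.log_le_iff_le_exp (by positivity), Real.exp_add]
    have : 1 ≤ Real.exp (2 * r) := Real.one_le_exp (by positivity)
    have : 2 ≤ Real.exp 1 := by have := Real.add_one_le_exp (1 : ℝ); linarith
    nlinarith
  linarith

def InH (p u : Euc 2) : Prop := |T.A u| < T.l₁ p ∧ |T.B u| < T.l₂ p ∧ |T.A u + T.B u| < T.l₃ p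

theorem InH_iff {p u : Euc 2} : T.InH p u ↔ p + u ∈ T.Dl ∧ p - u ∈ T.Dl := by
  unfold InH Dl
  simp only [abs_lt, mem_ofPred_eq, sub_eq_add_neg p u, T.l_add₁, T.l_add₂, T.l_add₃, map_neg]
  constructor
  · rintro ⟨⟨_, _⟩, ⟨_, _⟩, _, _⟩; refine ⟨⟨?_, ?_, ?_⟩, ?_, ?_, ?_⟩ <;> linarith
  · rintro ⟨⟨_, _, _⟩, _, _, _⟩; refine ⟨⟨?_, ?_⟩, ⟨?_, ?_⟩, ?_, ?_⟩ <;> linarith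

theorem InH_fNorm (h : GoodC C) {p u : Euc 2} (hp : p ∈ T.Dl) (hu : T.InH p u) : fNorm C p u < 1 := by
  have hD := T.Dl_sub h.conv
  obtain ⟨a, b⟩ := T.InH_iff.1 hu
  exact fNorm_lt_one h (hD a) (hD b) (hD hp)

theorem fNorm_InH (h : GoodC C) {p u : Euc 2} (hp : p ∈ C)
    (hb : ∀ w ∈ C, hDist C p w < 1 → w ∈ T.Dl) (hu : fNorm C p u < 1 / 4) : T.InH p u := by
  have key : ∀ u, fNorm C p u < 1 / 4 → p + u ∈ T.Dl := by
    intro u hu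
    rw [fNorm_eq h hp] at hu
    have g1 : 0 ≤ gg C p u := gg_nonneg
    have g2 : 0 ≤ gg C p (-u) := gg_nonneg
    have hw : p + u ∈ C := (gg_lt_one_iff h hp).1 (by linarith)
    apply hb _ hw
    rw [hDist_eq h hp hw]
    have e1 : p - (p + u) = -u := by abel
    have e2 : p + u - p = u := by abel
    rw [e1, e2]
    have : Real.log ((1 + gg C p (-u)) / (1 - gg C p u)) < 2 := by
      rw [Real.log_lt_iff_lt_exp (div_pos (by linarith) (by linarith)), div_lt_iff₀ (by linarith)]
      have : 3 ≤ Real.exp 2 := by have := Real.add_one_le_exp (2 : ℝ); linarith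
      nlinarith
    linarith
  rw [T.InH_iff]
  refine ⟨key u hu, ?_⟩
  rw [sub_eq_add_neg]; exact key _ (by rwa [fNorm_neg h hp])

theorem dl_bound (h : GoodC C) {p : Euc 2} (hp : p ∈ C)
    (hb : ∀ w ∈ C, hDist C p w < 1 → w ∈ T.Dl) (u : Euc 2) :
    |T.A u| ≤ 4 * fNorm C p u * T.l₁ p ∧ |T.B u| ≤ 4 * fNorm C p u * T.l₂ p ∧
      |T.A u + T.B u| ≤ 4 * fNorm C p u * T.l₃ p := by
  have h0 := fNorm_nonneg h hp (u := u)
  have hpD := hb p hp (by simp)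
  have key : ∀ c > 4 * fNorm C p u, |T.A u| ≤ c * T.l₁ p ∧ |T.B u| ≤ c * T.l₂ p ∧
      |T.A u + T.B u| ≤ c * T.l₃ p := by
    intro c hc
    have hc0 : 0 < c := by linarith
    have := T.fNorm_InH h hp hb (u := c⁻¹ • u) (by
      rw [fNorm_smul h hp (by positivity), inv_mul_lt_iff₀ hc0]; linarith)
    obtain ⟨a, b, d⟩ := this
    simp only [map_smul, smul_eq_mul, ← mul_add, abs_mul, abs_of_pos (inv_pos.2 hc0)] at a b d
    rw [inv_mul_lt_iff₀ hc0] at a b d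
    exact ⟨a.le, b.le, d.le⟩
  refine ⟨?_, ?_, ?_⟩ <;>
  · refine le_of_forall_gt_imp_ge_of_dense fun y hy => ?_
    first
    | (have := (key (y / T.l₁ p) (by rw [gt_iff_lt, lt_div_iff₀ hpD.1]; exact hy)).1
       rwa [div_mul_cancel₀ _ hpD.1.ne'] at this)
    | (have := (key (y / T.l₂ p) (by rw [gt_iff_lt, lt_div_iff₀ hpD.2.1]; exact hy)).2.1
       rwa [div_mul_cancel₀ _ hpD.2.1.ne'] at this)
    | (have := (key (y / T.l₃ p) (by rw [gt_iff_lt, lt_div_iff₀ hpD.2.2]; exact hy)).2.2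
       rwa [div_mul_cancel₀ _ hpD.2.2.ne'] at this)

end Tri

end

section
open MeasureTheory Set Filter
open scoped ENNReal NNReal

section vol
variable {n : ℕ} {C : Set (Euc n)} {p q u v x y z t : Euc n}

theorem TB_bdd (h : GoodC C) (hp : p ∈ C) : Bornology.IsBounded (tangentBall C p 1) := by
  obtain ⟨R, hR⟩ := h.bdd.subset_ball p
  apply (Metric.isBounded_ball (x := (0 : Euc n)) (r := 2 * R)).subset
  intro u hu
  have hu' : fNorm C p u < 1 := hu
  rw [fNorm_eq h hp] at hu'
  have g2 : 0 ≤ gg C p (-u) := gg_nonneg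
  have : gg C p u < 2 := by linarith
  have := hR ((gg_lt_iff h hp two_pos).1 this)
  rw [mem_ball_iff_norm, add_sub_cancel_left, norm_smul] at this
  rw [mem_ball_zero_iff]
  norm_num at this
  linarith

theorem TB_open (h : GoodC C) (hp : p ∈ C) : IsOpen (tangentBall C p 1) :=
  isOpen_lt (fNorm_cont h hp) continuous_const

theorem TB_vol_lt_top (h : GoodC C) (hp : p ∈ C) : volume (tangentBall C p 1) < ⊤ :=
  (TB_bdd h hp).measure_lt_top

theorem TB_vol_pos (h : GoodC C) (hp : p ∈ C) : 0 < (volume (tangentBall C p 1)).toReal := by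
  apply ENNReal.toReal_pos _ (TB_vol_lt_top h hp).ne
  refine ((TB_open h hp).measure_pos volume ⟨0, ?_⟩).ne'
  show fNorm C p 0 < 1
  rw [fNorm_eq h hp]; simp

theorem omega_pos : 0 < omegaVol n :=
  ENNReal.toReal_pos (Metric.measure_ball_pos _ _ one_pos).ne' measure_ball_lt_top.ne

noncomputable def dens (C : Set (Euc n)) (p : Euc n) : ℝ :=
  omegaVol n / (volume (tangentBall C p 1)).toReal

theorem dens_pos (h : GoodC C) (hp : p ∈ C) : 0 < dens C p :=
  div_pos omega_pos (TB_vol_pos h hp)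

theorem hMeasure_apply (S : Set (Euc n)) (hS : MeasurableSet S) (hSC : S ⊆ C) :
    hMeasure C S = ∫⁻ p in S, ENNReal.ofReal (dens C p) := by
  unfold hMeasure
  rw [withDensity_apply _ hS, Measure.restrict_restrict hS, inter_eq_left.2 hSC]
  rfl

end vol

namespace Tri
variable {C : Set (Euc 2)} (T : Tri C)

def HS (p : Euc 2) : Set (Euc 2) := {u | T.InH p u}

theorem HS_open (p : Euc 2) : IsOpen (T.HS p) := by
  have c1 : Continuous fun u => |T.A u| := by fun_prop
  have c2 : Continuous fun u => |T.B u| := by fun_prop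
  have c3 : Continuous fun u => |T.A u + T.B u| := by fun_prop
  exact (isOpen_lt c1 continuous_const).inter
    ((isOpen_lt c2 continuous_const).inter (isOpen_lt c3 continuous_const))

theorem HS_vol (h : GoodC C) {p : Euc 2} (hp : p ∈ T.Dl) : volume (T.HS p) ≠ ⊤ :=
  ((measure_mono (fun _ hu => T.InH_fNorm h hp hu)).trans_lt
    (TB_vol_lt_top h (T.Dl_sub h.conv hp))).ne

theorem HS_vol_pos (h : GoodC C) {p : Euc 2} (hp : p ∈ T.Dl) : 0 < (volume (T.HS p)).toReal := by
  apply ENNReal.toReal_pos _ (T.HS_vol h hp)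
  refine ((T.HS_open p).measure_pos volume ⟨0, ?_⟩).ne'
  simpa [HS, InH] using (show 0 < T.l₁ p ∧ 0 < T.l₂ p ∧ 0 < T.l₃ p from hp)

open Pointwise in
theorem HS_scale (p : Euc 2) {a : ℝ} (ha : 0 < a) :
    volume {u | T.InH p (a⁻¹ • u)} = ENNReal.ofReal (a ^ 2) * volume (T.HS p) := by
  have : {u | T.InH p (a⁻¹ • u)} = a • T.HS p := by
    ext u; rw [mem_smul_set_iff_inv_smul_mem₀ ha.ne']; rfl
  rw [this, Measure.addHaar_smul]
  simp [abs_of_pos ha]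

theorem TB_ge (h : GoodC C) {p q : Euc 2} (hp : p ∈ T.Dl) {a : ℝ} (ha : 0 < a)
    (h1 : T.l₁ q ≤ a * T.l₁ p) (h2 : T.l₂ q ≤ a * T.l₂ p) (h3 : T.l₃ q ≤ a * T.l₃ p) :
    (a⁻¹) ^ 2 * (volume (T.HS q)).toReal ≤ (volume (tangentBall C p 1)).toReal := by
  have hs : {u | T.InH q (a⁻¹⁻¹ • u)} ⊆ tangentBall C p 1 := by
    intro u hu
    rw [mem_ofPred_eq, inv_inv] at hu
    apply T.InH_fNorm h hp
    obtain ⟨k1, k2, k3⟩ := hu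
    simp only [map_smul, smul_eq_mul, ← mul_add, abs_mul, abs_of_pos ha] at k1 k2 k3
    exact ⟨lt_of_mul_lt_mul_left (k1.trans_le h1) ha.le,
      lt_of_mul_lt_mul_left (k2.trans_le h2) ha.le, lt_of_mul_lt_mul_left (k3.trans_le h3) ha.le⟩
  have := measure_mono (μ := volume) hs
  rw [T.HS_scale q (inv_pos.2 ha)] at this
  have := ENNReal.toReal_mono (TB_vol_lt_top h (T.Dl_sub h.conv hp)).ne this
  rwa [ENNReal.toReal_mul, ENNReal.toReal_ofReal (by positivity)] at this

theorem cell_le (h : GoodC C) {q : Euc 2} (hq : q ∈ T.Dl) {r : ℝ} (hr : 0 ≤ r) {S : Set (Euc 2)}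
    (hS : MeasurableSet S) (hSD : S ⊆ T.Dl)
    (hH : ∀ p ∈ S, |T.H₁ p - T.H₁ q| ≤ r ∧ |T.H₂ p - T.H₂ q| ≤ r) :
    hMeasure C S ≤ ENNReal.ofReal (omegaVol 2 * Real.exp (8 * r)) := by
  have hD := T.Dl_sub h.conv
  have hV := T.HS_vol_pos h hq
  set V := (volume (T.HS q)).toReal with hVdef
  have he := Real.exp_pos (2 * r)
  have he1 : 1 ≤ Real.exp (2 * r) := Real.one_le_exp (by positivity)
  have hω := omega_pos (n := 2)
  rw [hMeasure_apply S hS (hSD.trans hD)]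
  have b1 : ∀ p ∈ S, ENNReal.ofReal (dens C p) ≤
      ENNReal.ofReal (omegaVol 2 / ((Real.exp (2 * r))⁻¹ ^ 2 * V)) := by
    intro p hp
    apply ENNReal.ofReal_le_ofReal
    unfold dens
    obtain ⟨x1, x2⟩ := hH p hp
    obtain ⟨k1, k2, k3⟩ := T.ratio hq (hSD hp) hr (by rwa [abs_sub_comm]) (by rwa [abs_sub_comm])
    have := T.TB_ge h (hSD hp) he k1 k2 k3
    gcongr
  have b2 : volume S ≤ ENNReal.ofReal (Real.exp (2 * r) ^ 2) * volume (T.HS q) := by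
    rw [← T.HS_scale q he]
    rw [← measure_preimage_add volume q S]
    apply measure_mono
    intro u hu
    have hu' : q + u ∈ S := hu
    obtain ⟨x1, x2⟩ := hH _ hu'
    obtain ⟨k1, k2, k3⟩ := T.ratio (hSD hu') hq hr x1 x2
    obtain ⟨d1, d2, d3⟩ := hSD hu'
    rw [T.l_add₁] at k1 d1
    rw [T.l_add₂] at k2 d2
    rw [T.l_add₃] at k3 d3
    obtain ⟨q1, q2, q3⟩ := hq
    have m1 := mul_le_mul_of_nonneg_right he1 q1.le
    have m2 := mul_le_mul_of_nonneg_right he1 q2.le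
    have m3 := mul_le_mul_of_nonneg_right he1 q3.le
    simp only [mem_ofPred_eq, InH, map_smul, smul_eq_mul, ← mul_add, abs_mul, abs_of_pos (inv_pos.2 he)]
    rw [inv_mul_lt_iff₀ he, inv_mul_lt_iff₀ he, inv_mul_lt_iff₀ he, abs_lt, abs_lt, abs_lt]
    refine ⟨⟨?_, ?_⟩, ⟨?_, ?_⟩, ?_, ?_⟩ <;> linarith
  refine (setLIntegral_mono' hS b1).trans ?_
  rw [setLIntegral_const]
  refine (mul_le_mul_right b2 _).trans ?_
  rw [← ENNReal.ofReal_toReal (T.HS_vol h hq), ← hVdef, ← ENNReal.ofReal_mul (by positivity),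
    ← ENNReal.ofReal_mul (by positivity)]
  apply ENNReal.ofReal_le_ofReal
  have e8 : Real.exp (8 * r) = Real.exp (2 * r) ^ 4 := by rw [← Real.exp_nat_mul]; ring_nf
  rw [e8]
  apply le_of_eq
  field_simp

def SS (q : Euc 2) (r : ℝ) : Set (Euc 2) :=
  {p | p ∈ T.Dl ∧ |T.H₁ p - T.H₁ q| < r ∧ |T.H₂ p - T.H₂ q| < r}

theorem H₁_meas : Measurable T.H₁ := by
  have := T.l_cont₁.measurable
  have := T.l_cont₃.measurable
  unfold H₁; fun_prop
theorem H₂_meas : Measurable T.H₂ := by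
  have := T.l_cont₂.measurable
  have := T.l_cont₃.measurable
  unfold H₂; fun_prop

theorem SS_meas (q : Euc 2) (r : ℝ) : MeasurableSet (T.SS q r) := by
  have c1 := T.H₁_meas
  have c2 := T.H₂_meas
  refine T.Dl_open.measurableSet.inter (MeasurableSet.inter ?_ ?_)
  · exact measurableSet_lt (f := fun p => |T.H₁ p - T.H₁ q|) (by fun_prop) measurable_const
  · exact measurableSet_lt (f := fun p => |T.H₂ p - T.H₂ q|) (by fun_prop) measurable_const

theorem SS_upper (h : GoodC C) (q : Euc 2) (N : ℕ) :
    hMeasure C (T.SS q N) ≤ ENNReal.ofReal (4 * N ^ 2 * (omegaVol 2 * Real.exp 8)) := by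
  have hω := omega_pos (n := 2)
  let I : Finset (ℤ × ℤ) := Finset.Ico (-(N : ℤ)) N ×ˢ Finset.Ico (-(N : ℤ)) N
  let c : ℤ × ℤ → Set (Euc 2) := fun i =>
    {p | p ∈ T.Dl ∧ ⌊T.H₁ p - T.H₁ q⌋ = i.1 ∧ ⌊T.H₂ p - T.H₂ q⌋ = i.2}
  have hsub : T.SS q N ⊆ ⋃ i ∈ I, c i := by
    rintro p ⟨hp, h1, h2⟩
    rw [abs_lt] at h1 h2
    simp only [mem_iUnion]
    refine ⟨(⌊T.H₁ p - T.H₁ q⌋, ⌊T.H₂ p - T.H₂ q⌋), ?_, hp, rfl, rfl⟩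
    simp only [I, Finset.mem_product, Finset.mem_Ico, Int.le_floor, Int.floor_lt]
    push_cast
    exact ⟨⟨h1.1.le, h1.2⟩, h2.1.le, h2.2⟩
  have hc : ∀ i, hMeasure C (c i) ≤ ENNReal.ofReal (omegaVol 2 * Real.exp 8) := by
    intro i
    rcases (c i).eq_empty_or_nonempty with he | ⟨p', hp', hp1, hp2⟩
    · rw [he]; simp
    have c1 := T.H₁_meas
    have c2 := T.H₂_meas
    have := T.cell_le h hp' zero_le_one (S := c i) (by
      refine T.Dl_open.measurableSet.inter (MeasurableSet.inter ?_ ?_)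
      · exact measurableSet_eq_fun (f := fun p => ⌊T.H₁ p - T.H₁ q⌋) (by fun_prop) measurable_const
      · exact measurableSet_eq_fun (f := fun p => ⌊T.H₂ p - T.H₂ q⌋) (by fun_prop) measurable_const)
      (fun p hp => hp.1) (by
        rintro p ⟨hp, h1, h2⟩
        rw [Int.floor_eq_iff] at h1 h2 hp1 hp2
        rw [abs_le, abs_le]
        refine ⟨⟨?_, ?_⟩, ?_, ?_⟩ <;> linarith [h1.1, h1.2, h2.1, h2.2, hp1.1, hp1.2, hp2.1, hp2.2])
    simpa using this
  calc hMeasure C (T.SS q N) ≤ hMeasure C (⋃ i ∈ I, c i) := measure_mono hsub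
    _ ≤ ∑ i ∈ I, hMeasure C (c i) := measure_biUnion_finset_le _ _
    _ ≤ ∑ i ∈ I, ENNReal.ofReal (omegaVol 2 * Real.exp 8) := Finset.sum_le_sum fun i _ => hc i
    _ = _ := by
      rw [Finset.sum_const, Finset.card_product, Int.card_Ico]
      have : ((N : ℤ) - -N).toNat = 2 * N := by omega
      rw [this, nsmul_eq_mul, ← ENNReal.ofReal_natCast, ← ENNReal.ofReal_mul (by positivity)]
      push_cast
      congr 1; ring

theorem SS_lower (h : GoodC C) {q : Euc 2} (hq : q ∈ T.Dl)
    (hb : ∀ w ∈ C, hDist C q w < 5 → w ∈ T.Dl) :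
    ENNReal.ofReal (omegaVol 2 / 400) ≤ hMeasure C (T.SS q 1) := by
  have hω := omega_pos (n := 2)
  have hD := T.Dl_sub h.conv
  have hV := T.HS_vol_pos h hq
  set V := (volume (T.HS q)).toReal with hVdef
  let P : Set (Euc 2) := {p | T.InH q ((4 : ℝ)  • (p - q))}
  have hPm : MeasurableSet P :=
    ((T.HS_open q).preimage (by fun_prop : Continuous fun p : Euc 2 => (4 : ℝ) • (p - q))).measurableSet
  have hq' := hq
  obtain ⟨q1, q2, q3⟩ := hq'
  have hP : ∀ p ∈ P, (3 / 4 * T.l₁ q < T.l₁ p ∧ T.l₁ p < 5 / 4 * T.l₁ q) ∧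
      (3 / 4 * T.l₂ q < T.l₂ p ∧ T.l₂ p < 5 / 4 * T.l₂ q) ∧
      (3 / 4 * T.l₃ q < T.l₃ p ∧ T.l₃ p < 5 / 4 * T.l₃ q) := by
    intro p hp
    obtain ⟨a1, a2, a3⟩ := hp
    simp only [map_smul, smul_eq_mul, abs_lt] at a1 a2 a3
    have e : p = q + (p - q) := by abel
    rw [e, T.l_add₁, T.l_add₂, T.l_add₃]
    refine ⟨⟨?_, ?_⟩, ⟨?_, ?_⟩, ?_, ?_⟩ <;> linarith [a1.1, a1.2, a2.1, a2.2, a3.1, a3.2]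
  have hPS : P ⊆ T.SS q 1 := by
    intro p hp
    obtain ⟨⟨a1, b1⟩, ⟨a2, b2⟩, a3, b3⟩ := hP p hp
    have hpD : p ∈ T.Dl := ⟨by linarith, by linarith, by linarith⟩
    have aux : ∀ a b : ℝ, 0 < a → 3 / 4 * a < b → b < 5 / 4 * a →
        -(1/3) ≤ Real.log b - Real.log a ∧ Real.log b - Real.log a ≤ 1 / 4 := by
      intro a b ha h1 h2
      have hb : 0 < b := by linarith
      rw [← Real.log_div hb.ne' ha.ne']
      have := Real.one_sub_inv_le_log_of_pos (div_pos hb ha)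
      have := Real.log_le_sub_one_of_pos (div_pos hb ha)
      have k1 : b / a < 5 / 4 := by rw [div_lt_iff₀ ha]; exact h2
      have k2 : (b / a)⁻¹ < 4 / 3 := by rw [inv_div, div_lt_iff₀ hb]; linarith
      constructor <;> linarith
    obtain ⟨x1, y1⟩ := aux _ _ q1 a1 b1
    obtain ⟨x2, y2⟩ := aux _ _ q2 a2 b2
    obtain ⟨x3, y3⟩ := aux _ _ q3 a3 b3
    refine ⟨hpD, ?_, ?_⟩ <;> rw [abs_lt] <;> simp only [H₁, H₂] <;> constructor <;> linarith
  refine le_trans ?_ (measure_mono hPS)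
  rw [hMeasure_apply P hPm (fun p hp => hD (hPS hp).1)]
  have hPb : ∀ p ∈ P, ENNReal.ofReal (omegaVol 2 / (25 * V)) ≤ ENNReal.ofReal (dens C p) := by
    intro p hp
    obtain ⟨hpD, s1, s2⟩ := hPS hp
    have hd := T.dist_bound h hpD hq zero_le_one s1.le s2.le
    have hpb : ∀ w ∈ C, hDist C p w < 1 → w ∈ T.Dl := by
      intro w hw hdw
      apply hb w hw
      have := hDist_tri h (hD hq) (hD hpD) hw
      rw [hDist_comm h (hD hq) (hD hpD)] at this
      linarith
    have hsub : tangentBall C p 1 ⊆ {u | T.InH q ((5 : ℝ)⁻¹ • u)} := by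
      intro u hu
      have hu : fNorm C p u < 1 := hu
      have hu0 := fNorm_nonneg h (hD hpD) (u := u)
      obtain ⟨⟨a1, b1⟩, ⟨a2, b2⟩, a3, b3⟩ := hP p hp
      obtain ⟨c1, c2, c3⟩ := T.dl_bound h (hD hpD) hpb u
      simp only [mem_ofPred_eq, InH, map_smul, smul_eq_mul, ← mul_add, abs_mul]
      rw [abs_of_pos (by norm_num : (0 : ℝ) < 5⁻¹)]
      refine ⟨?_, ?_, ?_⟩ <;> nlinarith [hpD.1, hpD.2.1, hpD.2.2]
    have := measure_mono (μ := volume) hsub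
    rw [T.HS_scale q (by norm_num : (0 : ℝ) < 5)] at this
    have := ENNReal.toReal_mono (ENNReal.mul_ne_top (by simp) (T.HS_vol h hq)) this
    rw [ENNReal.toReal_mul, ENNReal.toReal_ofReal (by positivity), ← hVdef] at this
    norm_num at this
    apply ENNReal.ofReal_le_ofReal
    unfold dens
    have := TB_vol_pos h (hD hpD)
    gcongr
  refine le_trans ?_ (setLIntegral_mono' hPm hPb)
  rw [setLIntegral_const]
  have hvP : volume P = ENNReal.ofReal ((4⁻¹ : ℝ) ^ 2) * volume (T.HS q) := by
    rw [← T.HS_scale q (by norm_num), ← measure_preimage_add volume q P]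
    congr 1
    ext u; simp [P]
  rw [hvP, ← ENNReal.ofReal_toReal (T.HS_vol h hq), ← hVdef, ← ENNReal.ofReal_mul (by positivity),
    ← ENNReal.ofReal_mul (by positivity)]
  apply ENNReal.ofReal_le_ofReal
  apply le_of_eq
  field_simp
  norm_num

end Tri

end

section
open MeasureTheory Set Filter
open scoped ENNReal NNReal

theorem smooth_bound : ∃ K : ℝ, 0 < K ∧ ∀ x, |deriv Real.smoothTransition x| ≤ K := by
  have hc : Continuous (deriv Real.smoothTransition) :=
    (Real.smoothTransition.contDiff (n := 1)).continuous_deriv le_rfl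
  obtain ⟨K, hK⟩ := (isCompact_Icc (a := (0 : ℝ)) (b := 1)).exists_bound_of_continuousOn hc.continuousOn
  refine ⟨max K 1, by positivity, fun x => ?_⟩
  by_cases hx : x ∈ Icc (0 : ℝ) 1
  · exact (hK x hx).trans (le_max_left _ _)
  · have : deriv Real.smoothTransition x = 0 := by
      rw [mem_Icc, not_and_or, not_le, not_le] at hx
      rcases hx with hx | hx
      · apply IsLocalMin.deriv_eq_zero
        filter_upwards with y
        rw [Real.smoothTransition.zero_of_nonpos hx.le]
        exact Real.smoothTransition.nonneg y
      · apply IsLocalMax.deriv_eq_zero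
        filter_upwards with y
        rw [Real.smoothTransition.one_of_one_le hx.le]
        exact Real.smoothTransition.le_one y
    rw [this]; simp

namespace Tri
variable {C : Set (Euc 2)} (T : Tri C)

noncomputable def ff (q : Euc 2) (r : ℝ) (p : Euc 2) : ℝ :=
  Real.smoothTransition (r + 1 - (T.H₁ p - T.H₁ q)) * Real.smoothTransition (r + 1 + (T.H₁ p - T.H₁ q))
  * (Real.smoothTransition (r + 1 - (T.H₂ p - T.H₂ q)) * Real.smoothTransition (r + 1 + (T.H₂ p - T.H₂ q)))

open Classical in
noncomputable def tf (q : Euc 2) (r : ℝ) (p : Euc 2) : ℝ := if p ∈ T.Dl then T.ff q r p else 0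

theorem st_mem (x : ℝ) : Real.smoothTransition x ∈ Icc (0 : ℝ) 1 :=
  ⟨Real.smoothTransition.nonneg x, Real.smoothTransition.le_one x⟩

theorem ff_mem (q : Euc 2) (r : ℝ) (p : Euc 2) : T.ff q r p ∈ Icc (0 : ℝ) 1 :=
  unitInterval.mul_mem (unitInterval.mul_mem (st_mem _) (st_mem _))
    (unitInterval.mul_mem (st_mem _) (st_mem _))

theorem tf_mem (q : Euc 2) (r : ℝ) (p : Euc 2) : T.tf q r p ∈ Icc (0 : ℝ) 1 := by
  unfold tf; split_ifs
  · exact T.ff_mem q r p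
  · simp

theorem tf_one {q p : Euc 2} {r : ℝ} (hp : p ∈ T.SS q r) : T.tf q r p = 1 := by
  obtain ⟨h1, h2, h3⟩ := hp
  rw [abs_lt] at h2 h3
  unfold tf ff
  rw [if_pos h1, Real.smoothTransition.one_of_one_le (by linarith),
    Real.smoothTransition.one_of_one_le (by linarith),
    Real.smoothTransition.one_of_one_le (by linarith),
    Real.smoothTransition.one_of_one_le (by linarith)]
  norm_num

theorem tf_zero {q p : Euc 2} {r : ℝ} (hp : p ∉ T.SS q (r + 1)) : T.tf q r p = 0 := by
  unfold tf
  split_ifs with h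
  · by_contra hne
    apply hp
    unfold ff at hne
    simp only [mul_eq_zero, not_or, Real.smoothTransition.zero_iff_nonpos, not_le] at hne
    obtain ⟨⟨a, b⟩, c, d⟩ := hne
    refine ⟨h, ?_, ?_⟩ <;> rw [abs_lt] <;> constructor <;> linarith
  · rfl

def KK (q : Euc 2) (r : ℝ) : Set (Euc 2) :=
  {p | T.l₁ q ≤ Real.exp (2 * (r + 1)) * T.l₁ p ∧ T.l₂ q ≤ Real.exp (2 * (r + 1)) * T.l₂ p ∧
    T.l₃ q ≤ Real.exp (2 * (r + 1)) * T.l₃ p}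

theorem KK_closed (q : Euc 2) (r : ℝ) : IsClosed (T.KK q r) :=
  (isClosed_le continuous_const (continuous_const.mul T.l_cont₁)).inter
    ((isClosed_le continuous_const (continuous_const.mul T.l_cont₂)).inter
      (isClosed_le continuous_const (continuous_const.mul T.l_cont₃)))

theorem KK_sub {q : Euc 2} (hq : q ∈ T.Dl) (r : ℝ) : T.KK q r ⊆ T.Dl := by
  rintro p ⟨h1, h2, h3⟩
  have he := Real.exp_pos (2 * (r + 1))
  exact ⟨pos_of_mul_pos_right (hq.1.trans_le h1) he.le, pos_of_mul_pos_right (hq.2.1.trans_le h2) he.le,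
    pos_of_mul_pos_right (hq.2.2.trans_le h3) he.le⟩

theorem KK_compact (h : GoodC C) {q : Euc 2} (hq : q ∈ T.Dl) (r : ℝ) : IsCompact (T.KK q r) :=
  Metric.isCompact_of_isClosed_isBounded (T.KK_closed q r)
    (h.bdd.subset ((T.KK_sub hq r).trans (T.Dl_sub h.conv)))

theorem tf_KK {q : Euc 2} (hq : q ∈ T.Dl) {r : ℝ} (hr : 0 ≤ r) {p : Euc 2} (hp : p ∉ T.KK q r) :
    T.tf q r p = 0 := by
  by_contra hne
  have hS : p ∈ T.SS q (r + 1) := by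
    by_contra hc; exact hne (T.tf_zero hc)
  obtain ⟨h1, h2, h3⟩ := hS
  apply hp
  rw [abs_sub_comm] at h2 h3
  exact T.ratio hq h1 (by linarith) h2.le h3.le

theorem tf_contDiff {q : Euc 2} (hq : q ∈ T.Dl) {r : ℝ} (hr : 0 ≤ r) : ContDiff ℝ 1 (T.tf q r) := by
  rw [contDiff_iff_contDiffAt]
  intro p
  by_cases hp : p ∈ T.Dl
  · have hev : T.tf q r =ᶠ[nhds p] T.ff q r := by
      filter_upwards [T.Dl_open.mem_nhds hp] with y hy
      exact if_pos hy
    refine ContDiffAt.congr_of_eventuallyEq ?_ hev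
    have a1 : ContDiffAt ℝ 1 T.l₁ p := by unfold l₁; fun_prop
    have a2 : ContDiffAt ℝ 1 T.l₂ p := by unfold l₂; fun_prop
    have a3 : ContDiffAt ℝ 1 T.l₃ p := by unfold l₃; fun_prop
    have b1 : ContDiffAt ℝ 1 T.H₁ p := (a1.log hp.1.ne').sub (a3.log hp.2.2.ne')
    have b2 : ContDiffAt ℝ 1 T.H₂ p := (a2.log hp.2.1.ne').sub (a3.log hp.2.2.ne')
    have hs := Real.smoothTransition.contDiff (n := 1)
    unfold ff
    refine ContDiffAt.mul (ContDiffAt.mul ?_ ?_) (ContDiffAt.mul ?_ ?_) <;>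
      exact hs.contDiffAt.comp p (by fun_prop)
  · have hev : T.tf q r =ᶠ[nhds p] fun _ => 0 := by
      filter_upwards [(T.KK_closed q r).isOpen_compl.mem_nhds (fun hk => hp (T.KK_sub hq r hk))] with y hy
      exact T.tf_KK hq hr hy
    exact contDiffAt_const.congr_of_eventuallyEq hev

theorem tf_cs (h : GoodC C) {q : Euc 2} (hq : q ∈ T.Dl) {r : ℝ} (hr : 0 ≤ r) :
    HasCompactSupport (T.tf q r) :=
  HasCompactSupport.intro (T.KK_compact h hq r) fun _ hx => T.tf_KK hq hr hx

theorem tf_test (h : GoodC C) {q : Euc 2} (hq : q ∈ T.Dl) {r : ℝ} (hr : 0 < r) :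
    T.tf q r ∈ testFuns C := by
  refine ⟨?_, ?_, T.tf_cs h hq hr.le, ?_⟩
  · exact ⟨_, ((T.tf_contDiff hq hr.le).lipschitzWith_of_hasCompactSupport (T.tf_cs h hq hr.le) (by simp)).choose_spec⟩
  · intro h0
    have := T.tf_one (q := q) (p := q) (r := r) ⟨hq, by simpa using hr, by simpa using hr⟩
    rw [h0] at this
    simp at this
  · refine (closure_minimal ?_ (T.KK_closed q r)).trans ((T.KK_sub hq r).trans (T.Dl_sub h.conv))
    intro x hx
    by_contra hc
    exact hx (T.tf_KK hq hr.le hc)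

theorem prod4_bound {K : ℝ} {a b c d a' b' c' d' : ℝ} (ha : a ∈ Icc (0 : ℝ) 1) (hb : b ∈ Icc (0 : ℝ) 1)
    (hc : c ∈ Icc (0 : ℝ) 1) (hd : d ∈ Icc (0 : ℝ) 1) (ha' : |a'| ≤ K) (hb' : |b'| ≤ K)
    (hc' : |c'| ≤ K) (hd' : |d'| ≤ K) :
    (a' * b + a * b') * (c * d) + (a * b) * (c' * d + c * d') ≤ 4 * K := by
  have key : ∀ x y z w : ℝ, y ∈ Icc (0 : ℝ) 1 → z ∈ Icc (0 : ℝ) 1 → w ∈ Icc (0 : ℝ) 1 → |x| ≤ K →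
      x * (y * (z * w)) ≤ K := by
    intro x y z w hy hz hw hx
    have m := unitInterval.mul_mem hy (unitInterval.mul_mem hz hw)
    have m0 := m.1
    have m1 := m.2
    have := le_abs_self x
    have := abs_nonneg x
    nlinarith
  have k1 := key a' b c d hb hc hd ha'
  have k2 := key b' a c d ha hc hd hb'
  have k3 := key c' a b d ha hb hd hc'
  have k4 := key d' a b c ha hb hc hd'
  linarith

theorem tf_deriv (h : GoodC C) {q : Euc 2} (hq : q ∈ T.Dl) {r : ℝ} (hr : 0 ≤ r) {K : ℝ}
    (hK : ∀ x, |deriv Real.smoothTransition x| ≤ K) {p : Euc 2} (hp : p ∈ T.Dl)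
    (hb : ∀ w ∈ C, hDist C p w < 1 → w ∈ T.Dl) (u : Euc 2) :
    fderiv ℝ (T.tf q r) p u ≤ 32 * K * fNorm C p u := by
  have hpC := T.Dl_sub h.conv hp
  have hdf : DifferentiableAt ℝ (T.tf q r) p := (T.tf_contDiff hq hr).differentiable (by simp) p
  have hline : HasDerivAt (fun s : ℝ => p + s • u) u 0 := by
    simpa using ((hasDerivAt_id (0 : ℝ)).smul_const u).const_add p
  have hd1 : HasDerivAt (fun s : ℝ => T.tf q r (p + s • u)) (fderiv ℝ (T.tf q r) p u) 0 := by
    have : HasFDerivAt (T.tf q r) (fderiv ℝ (T.tf q r) p) (p + (0 : ℝ) • u) := by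
      simpa using hdf.hasFDerivAt
    exact this.comp_hasDerivAt (0 : ℝ) hline
  have hs1 : ∀ x, HasDerivAt Real.smoothTransition (deriv Real.smoothTransition x) x := fun x =>
    ((Real.smoothTransition.contDiff (n := 1)).differentiable (by simp) x).hasDerivAt
  have a1 : HasDerivAt (fun s : ℝ => T.l₁ (p + s • u)) (T.A u) 0 := by
    have : (fun s : ℝ => T.l₁ (p + s • u)) = fun s => T.l₁ p + s * T.A u := by
      ext s; rw [T.l_add₁, map_smul, smul_eq_mul]
    rw [this]
    simpa using ((hasDerivAt_id (0 : ℝ)).mul_const (T.A u)).const_add (T.l₁ p)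
  have a2 : HasDerivAt (fun s : ℝ => T.l₂ (p + s • u)) (T.B u) 0 := by
    have : (fun s : ℝ => T.l₂ (p + s • u)) = fun s => T.l₂ p + s * T.B u := by
      ext s; rw [T.l_add₂, map_smul, smul_eq_mul]
    rw [this]
    simpa using ((hasDerivAt_id (0 : ℝ)).mul_const (T.B u)).const_add (T.l₂ p)
  have a3 : HasDerivAt (fun s : ℝ => T.l₃ (p + s • u)) (-(T.A u + T.B u)) 0 := by
    have : (fun s : ℝ => T.l₃ (p + s • u)) = fun s => T.l₃ p + s * -(T.A u + T.B u) := by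
      ext s; rw [T.l_add₃, map_smul, map_smul, smul_eq_mul, smul_eq_mul]; ring
    rw [this]
    simpa using ((hasDerivAt_id (0 : ℝ)).mul_const (-(T.A u + T.B u))).const_add (T.l₃ p)
  have z1 : T.l₁ (p + (0 : ℝ) • u) = T.l₁ p := by simp
  have z2 : T.l₂ (p + (0 : ℝ) • u) = T.l₂ p := by simp
  have z3 : T.l₃ (p + (0 : ℝ) • u) = T.l₃ p := by simp
  have b1 := ((a1.log (by rw [z1]; exact hp.1.ne')).sub (a3.log (by rw [z3]; exact hp.2.2.ne'))).sub_const (T.H₁ q)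
  have b2 := ((a2.log (by rw [z2]; exact hp.2.1.ne')).sub (a3.log (by rw [z3]; exact hp.2.2.ne'))).sub_const (T.H₂ q)
  rw [z1, z3] at b1
  rw [z2, z3] at b2
  have c1 := (hs1 _).comp (0 : ℝ) (b1.const_sub (r + 1))
  have c2 := (hs1 _).comp (0 : ℝ) (b1.const_add (r + 1))
  have c3 := (hs1 _).comp (0 : ℝ) (b2.const_sub (r + 1))
  have c4 := (hs1 _).comp (0 : ℝ) (b2.const_add (r + 1))
  have hev : (fun s : ℝ => T.tf q r (p + s • u)) =ᶠ[nhds 0] fun s => T.ff q r (p + s • u) := by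
    have : ContinuousAt (fun s : ℝ => p + s • u) 0 := by fun_prop
    have := this.preimage_mem_nhds (T.Dl_open.mem_nhds (by simpa using hp))
    filter_upwards [this] with s hs
    exact if_pos hs
  have hd2 := (c1.mul c2).mul (c3.mul c4)
  have := hd1.unique (hd2.congr_of_eventuallyEq hev)
  rw [this]
  obtain ⟨d1, d2, d3⟩ := T.dl_bound h hpC hb u
  have hF := fNorm_nonneg h hpC (u := u)
  set F := fNorm C p u
  have e1 : |T.A u / T.l₁ p - -(T.A u + T.B u) / T.l₃ p| ≤ 8 * F := by
    refine (abs_sub _ _).trans ?_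
    rw [abs_div, abs_div, abs_neg, abs_of_pos hp.1, abs_of_pos hp.2.2]
    have := (div_le_iff₀ hp.1).2 d1
    have := (div_le_iff₀ hp.2.2).2 d3
    linarith
  have e2 : |T.B u / T.l₂ p - -(T.A u + T.B u) / T.l₃ p| ≤ 8 * F := by
    refine (abs_sub _ _).trans ?_
    rw [abs_div, abs_div, abs_neg, abs_of_pos hp.2.1, abs_of_pos hp.2.2]
    have := (div_le_iff₀ hp.2.1).2 d2
    have := (div_le_iff₀ hp.2.2).2 d3
    linarith
  have hK0 : 0 ≤ K := (abs_nonneg _).trans (hK 0)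
  have e3 : ∀ x y : ℝ, |y| ≤ 8 * F → |deriv Real.smoothTransition x * y| ≤ K * (8 * F) := by
    intro x y hy
    rw [abs_mul]
    exact mul_le_mul (hK x) hy (abs_nonneg _) hK0
  simp only [Pi.mul_apply, Function.comp_apply]
  refine le_trans (prod4_bound (K := K * (8 * F)) (st_mem _) (st_mem _) (st_mem _) (st_mem _)
    (e3 _ _ (by rw [abs_neg]; exact e1)) (e3 _ _ e1) (e3 _ _ (by rw [abs_neg]; exact e2)) (e3 _ _ e2)) ?_
  linarith

theorem step (h : GoodC C) {q : Euc 2} (hq : q ∈ T.Dl) {K : ℝ}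
    (hK : ∀ x, |deriv Real.smoothTransition x| ≤ K) {N r : ℕ} (hr : 1 ≤ r) (hrN : r + 1 ≤ N)
    (hb : ∀ w ∈ C, hDist C q w < 2 * N + 3 → w ∈ T.Dl) {c : ℝ} (hc : 0 < c)
    (hray : ∀ f ∈ testFuns C, c ≤ rayleigh C C f) :
    c * (hMeasure C (T.SS q r)).toReal ≤ (32 * K) ^ 2 * ((hMeasure C (T.SS q (r + 1 : ℕ))).toReal
      - (hMeasure C (T.SS q r)).toReal) := by
  have hD := T.Dl_sub h.conv
  have hK0 : 0 ≤ K := (abs_nonneg _).trans (hK 0)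
  have hfin : ∀ m : ℕ, hMeasure C (T.SS q m) ≠ ⊤ := fun m =>
    ((T.SS_upper h q m).trans_lt ENNReal.ofReal_lt_top).ne
  set f := T.tf q r with hf
  have hr' : (0 : ℝ) < r := by exact_mod_cast hr
  have hrc := hray f (T.tf_test h hq hr')
  have hcd := T.tf_contDiff hq hr'.le
  have hsub : T.SS q r ⊆ T.SS q (r + 1 : ℕ) := by
    rintro p ⟨a, b, d⟩
    push_cast
    exact ⟨a, by linarith, by linarith⟩
  have hSC : ∀ m : ℝ, T.SS q m ⊆ C := fun m p hp => hD hp.1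
  have hmC : MeasurableSet C := h.op.measurableSet
  have hball : ∀ p ∈ T.SS q (r + 1 : ℕ), ∀ w ∈ C, hDist C p w < 1 → w ∈ T.Dl := by
    rintro p ⟨hpD, s1, s2⟩ w hw hdw
    have hd := T.dist_bound h hpD hq (by positivity) s1.le s2.le
    apply hb w hw
    have := hDist_tri h (hD hq) (hD hpD) hw
    rw [hDist_comm h (hD hq) (hD hpD)] at this
    have : ((r + 1 : ℕ) : ℝ) ≤ N := by exact_mod_cast hrN
    linarith
  unfold rayleigh at hrc
  have hnum : ∫ p in C, dualNorm C p (fderiv ℝ f p) ^ 2 ∂hMeasure C ≤ (32 * K) ^ 2 *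
      ((hMeasure C (T.SS q (r + 1 : ℕ))).toReal - (hMeasure C (T.SS q r)).toReal) := by
    have hm := (T.SS_meas q (r + 1 : ℕ)).diff (T.SS_meas q r)
    have hbd : ∀ p ∈ C, dualNorm C p (fderiv ℝ f p) ^ 2 ≤
        (T.SS q (r + 1 : ℕ) \ T.SS q r).indicator (fun _ => (32 * K) ^ 2) p := by
      intro p hp
      by_cases hin : p ∈ T.SS q (r + 1 : ℕ) \ T.SS q r
      · rw [indicator_of_mem hin]
        have := dualNorm_le (C := C) (p := p) (by positivity : 0 ≤ 32 * K)
          (T.tf_deriv h hq hr'.le hK hin.1.1 (hball p hin.1))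
        have := dualNorm_nonneg h hp (fderiv ℝ f p)
        gcongr
      · rw [indicator_of_notMem hin]
        have hz : fderiv ℝ f p = 0 := by
          by_cases hin2 : p ∈ T.SS q (r + 1 : ℕ)
          · have h1 : f p = 1 := T.tf_one (by by_contra hc; exact hin ⟨hin2, hc⟩)
            apply IsLocalMax.fderiv_eq_zero
            filter_upwards with y
            rw [h1]; exact (T.tf_mem q r y).2
          · have h1 : f p = 0 := T.tf_zero (by push_cast at hin2; exact hin2)
            apply IsLocalMin.fderiv_eq_zero
            filter_upwards with y
            rw [h1]; exact (T.tf_mem q r y).1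
        rw [hz, dualNorm_zero]; simp
    have hint : Integrable ((T.SS q (r + 1 : ℕ) \ T.SS q r).indicator (fun _ => (32 * K) ^ 2))
        ((hMeasure C).restrict C) := by
      rw [integrable_indicator_iff hm]
      refine integrableOn_const ?_ (by finiteness)
      · exact ((Measure.restrict_apply_le _ _).trans_lt
          ((measure_mono sdiff_subset).trans_lt (hfin _).lt_top)).ne
    refine (integral_mono_of_nonneg (ae_of_all _ fun p => sq_nonneg _) hint
      ((ae_restrict_iff' hmC).2 (ae_of_all _ hbd))).trans ?_
    rw [integral_indicator hm, Measure.restrict_restrict hm, setIntegral_const, smul_eq_mul, mul_comm,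
      inter_eq_left.2 (sdiff_subset.trans (hSC _)), measureReal_def,
      measure_sdiff hsub (T.SS_meas q r).nullMeasurableSet (hfin _),
      ENNReal.toReal_sub_of_le (measure_mono hsub) (hfin _)]
  have hden : (hMeasure C (T.SS q r)).toReal ≤ ∫ p in C, f p ^ 2 ∂hMeasure C := by
    have e1 : (hMeasure C (T.SS q r)).toReal =
        ∫ p in C, (T.SS q r).indicator (fun _ => (1 : ℝ)) p ∂hMeasure C := by
      rw [integral_indicator (T.SS_meas q r), Measure.restrict_restrict (T.SS_meas q r), setIntegral_const,
        inter_eq_left.2 (hSC _), measureReal_def]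
      simp
    rw [e1]
    have hi : ∀ m : ℕ, Integrable ((T.SS q m).indicator (fun _ => (1 : ℝ))) ((hMeasure C).restrict C) := by
      intro m
      rw [integrable_indicator_iff (T.SS_meas q m)]
      refine integrableOn_const ?_ (by finiteness)
      exact ((Measure.restrict_apply_le _ _).trans_lt (hfin _).lt_top).ne
    apply integral_mono (hi r)
    · refine (hi (r + 1)).mono' (hcd.continuous.pow 2).aestronglyMeasurable (ae_of_all _ fun p => ?_)
      obtain ⟨m0, m1⟩ := T.tf_mem q r p
      by_cases hin : p ∈ T.SS q (r + 1 : ℕ)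
      · rw [indicator_of_mem hin, Real.norm_of_nonneg (sq_nonneg _)]
        exact pow_le_one₀ m0 m1
      · have h1 : f p = 0 := T.tf_zero (by push_cast at hin; exact hin)
        rw [indicator_of_notMem hin, h1]; simp
    · intro p
      show _ ≤ f p ^ 2
      by_cases hin : p ∈ T.SS q r
      · rw [indicator_of_mem hin, hf, T.tf_one hin]; simp
      · rw [indicator_of_notMem hin]; positivity
  have hpos : 0 < ∫ p in C, f p ^ 2 ∂hMeasure C := by
    have h00 : 0 ≤ ∫ p in C, f p ^ 2 ∂hMeasure C := integral_nonneg fun p => sq_nonneg _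
    rcases h00.eq_or_lt with h0 | h0
    · rw [← h0] at hrc; simp at hrc; linarith
    · exact h0
  rw [le_div_iff₀ hpos] at hrc
  calc _ ≤ c * ∫ p in C, f p ^ 2 ∂hMeasure C := by gcongr
    _ ≤ _ := hrc.trans hnum

end Tri

theorem dirA {C : Set (Euc 2)} (h : GoodC C) {c : ℝ} (hc : 0 < c)
    (hray : ∀ f ∈ testFuns C, c ≤ rayleigh C C f) : ∃ δ : ℝ, 0 ≤ δ ∧ IsDeltaHyp C δ := by
  suffices hs : ∃ M : ℝ, 0 < M ∧ ThinC C M by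
    obtain ⟨M, hM, ht⟩ := hs
    exact ⟨3 * M, by positivity, thin_hyp h hM ht⟩
  by_contra hcon
  push Not at hcon
  obtain ⟨K, hK0, hK⟩ := smooth_bound
  have hω := omega_pos (n := 2)
  set κ := c / (32 * K) ^ 2 with hκ
  have hκ0 : 0 < κ := by positivity
  have hlim := tendsto_pow_const_div_const_pow_of_one_lt 2 (show (1 : ℝ) < 1 + κ by linarith)
  have hε : 0 < 1 / (1600 * Real.exp 8 * (1 + κ)) := by positivity
  obtain ⟨N, hN, hN1⟩ := ((hlim.eventually (gt_mem_nhds hε)).and (eventually_ge_atTop 1)).exists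
  obtain ⟨T, q, hq, hb⟩ := fat_tri h (M := 10 * (2 * N + 3)) (by positivity) (hcon _ (by positivity))
  have hb' : ∀ w ∈ C, hDist C q w < 2 * N + 3 → w ∈ T.Dl := fun w hw hd => hb w hw (by linarith)
  have hN1' : (1 : ℝ) ≤ N := by exact_mod_cast hN1
  have h1 : omegaVol 2 / 400 ≤ (hMeasure C (T.SS q (1 : ℕ))).toReal := by
    have hl := T.SS_lower h hq (fun w hw hd => hb' w hw (by linarith))
    rw [Nat.cast_one]
    have := ENNReal.toReal_mono (by
      have := ((T.SS_upper h q 1).trans_lt ENNReal.ofReal_lt_top).ne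
      rwa [Nat.cast_one] at this) hl
    rwa [ENNReal.toReal_ofReal (by positivity)] at this
  have hgrow : ∀ m : ℕ, m + 1 ≤ N →
      (1 + κ) ^ m * (omegaVol 2 / 400) ≤ (hMeasure C (T.SS q (m + 1 : ℕ))).toReal := by
    intro m
    induction m with
    | zero => intro _; simpa using h1
    | succ m ih =>
      intro hm
      have := ih (by omega)
      have hs := T.step h hq hK (N := N) (r := m + 1) (by omega) hm hb' hc hray
      have hs' : κ * (hMeasure C (T.SS q (m + 1 : ℕ))).toReal ≤
          (hMeasure C (T.SS q (m + 1 + 1 : ℕ))).toReal - (hMeasure C (T.SS q (m + 1 : ℕ))).toReal := by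
        rw [hκ, div_mul_eq_mul_div, div_le_iff₀ (by positivity), mul_comm _ ((32 * K) ^ 2)]; exact hs
      calc (1 + κ) ^ (m + 1) * (omegaVol 2 / 400) = (1 + κ) * ((1 + κ) ^ m * (omegaVol 2 / 400)) := by ring
        _ ≤ (1 + κ) * (hMeasure C (T.SS q (m + 1 : ℕ))).toReal := by gcongr
        _ ≤ _ := by linarith
  have hg := hgrow (N - 1) (by omega)
  rw [Nat.sub_add_cancel hN1] at hg
  have hup := ENNReal.toReal_mono ENNReal.ofReal_ne_top (T.SS_upper h q N)
  rw [ENNReal.toReal_ofReal (by positivity)] at hup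
  have hpw : (1 + κ) ^ N = (1 + κ) ^ (N - 1) * (1 + κ) := by
    rw [← pow_succ, Nat.sub_add_cancel hN1]
  rw [div_lt_iff₀ (by positivity), hpw, div_mul_eq_mul_div, lt_div_iff₀ (by positivity)] at hN
  have h8 := Real.exp_pos 8
  have hfin := hg.trans hup
  have : (1 + κ) ^ (N - 1) ≤ 1600 * N ^ 2 * Real.exp 8 := by
    have : (1 + κ) ^ (N - 1) * (omegaVol 2 / 400) ≤ (1600 * N ^ 2 * Real.exp 8) * (omegaVol 2 / 400) := by
      refine hfin.trans (le_of_eq ?_); ring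
    exact le_of_mul_le_mul_right this (by positivity)
  nlinarith

end

section
open MeasureTheory Set Filter
open scoped ENNReal NNReal

section PartB
variable {n : ℕ} {C : Set (Euc n)} {p q u v : Euc n}

set_option maxHeartbeats 1000000 in
theorem key_hyp (h : GoodC C) {δ K Y : ℝ} (hd0 : 0 ≤ δ) (hδ : IsDeltaHyp C δ)
    (hK : 200 * Real.exp (4 * δ) ≤ K)
    {b d e : Euc n} (φ : Euc n →L[ℝ] ℝ) (hφ : ∀ x ∈ C, 0 < -φ b + φ x) (hφd : φ d = 1) (hφe : φ e = 0)
    (h1 : b + (1 : ℝ) • d + (1 : ℝ) • e ∉ C) (hA : ∀ x : ℝ, |x| < 1 → b + (1 : ℝ) • d + x • e ∈ C)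
    (hB1 : b + (1 / K) • d + (1 - 2 / K) • e ∈ C) (hB2 : b + (1 / K) • d + (-(1 - 2 / K)) • e ∈ C)
    (hY : K ≤ Y) (hYC : b + Y • d + (0 : ℝ) • e ∈ C) : False := by
  have hex : 1 ≤ Real.exp (4 * δ) := Real.one_le_exp (by positivity)
  have hK200 : 200 ≤ K := by linarith
  have hK0 : 0 < K := by linarith
  obtain ⟨ε, hε⟩ : ∃ ε, ε = 2 / K := ⟨_, rfl⟩
  rw [← hε] at hB1 hB2
  have hεK : ε * K = 2 := by rw [hε]; field_simp
  have hε0 : 0 < ε := by rw [hε]; positivity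
  have hε1 : ε ≤ 1 / 100 := by rw [hε, div_le_iff₀ hK0]; linarith
  have hi : 1 / K = ε / 2 := by rw [hε]; field_simp
  rw [hi] at hB1 hB2
  have hmem1 : ∀ x : ℝ, |x| ≤ 1 - ε → b + (ε / 2) • d + x • e ∈ C := by
    intro x hx
    obtain ⟨x1, x2⟩ := abs_le.1 hx
    have hk : 0 < 1 - ε := by linarith
    have := h.conv hB1 hB2 (a := (1 - ε + x) / (2 * (1 - ε))) (b := (1 - ε - x) / (2 * (1 - ε)))
      (div_nonneg (by linarith) (by linarith)) (div_nonneg (by linarith) (by linarith))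
      (by field_simp; ring)
    convert this using 1
    match_scalars <;> field_simp <;> ring
  have hmem : ∀ x y : ℝ, |x| ≤ 1 - ε → ε / 2 ≤ y → y ≤ 1 → b + y • d + x • e ∈ C := by
    intro x y hx hy1 hy2
    have hk : 0 < 2 - ε := by linarith
    have := h.conv (hmem1 x hx) (hA x (by linarith)) (a := (2 - 2 * y) / (2 - ε))
      (b := (2 * y - ε) / (2 - ε)) (div_nonneg (by linarith) hk.le) (div_nonneg (by linarith) hk.le)
      (by field_simp; ring)
    convert this using 1
    match_scalars <;> field_simp <;> ring
  set P : ℝ → ℝ → Euc n := fun x y => b + y • d + x • e with hP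
  have hPm : ∀ x y : ℝ, |x| ≤ 1 - ε → ε / 2 ≤ y → y ≤ 1 → P x y ∈ C := hmem
  obtain ⟨c, hc⟩ : ∃ c, c = 1 - 2 * ε := ⟨_, rfl⟩
  have hK4 : 1 / 2 / ε = K / 4 := by rw [hε]; field_simp; norm_num
  have hcabs : |c| ≤ 1 - ε := by rw [abs_of_nonneg (by linarith)]; linarith
  have h0abs : |(0 : ℝ)| ≤ 1 - ε := by simp; linarith
  have vert : ∀ x, |x| ≤ 1 - ε → hDist C (P x (1 / 2)) (P x ε) ≤ (1 / 2) * Real.log K := by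
    intro x hx
    have hh : 0 < c := by linarith
    have := hDist_upper h (hPm x (1 / 2) hx (by linarith) (by linarith)) (hPm x ε hx (by linarith) (by linarith))
      (α := 1 / c) (β := (ε / c)) (by positivity) (by positivity)
      (by
        convert hPm x 1 hx (by linarith) (by linarith) using 1
        simp only [hP]
        match_scalars <;> field_simp <;> (try rw [hc]) <;> ring)
      (by
        convert hPm x (ε / 2) hx (by linarith) (by linarith) using 1
        simp only [hP]
        match_scalars <;> field_simp <;> (try rw [hc]) <;> ring)
    refine this.trans ?_
    gcongr
    rw [one_div_div, one_div_div]
    calc (1 + c / 1) * (1 + c / ε) ≤ 2 * (1 / ε) := by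
          gcongr
          · linarith
          · field_simp; linarith
      _ = K := by rw [← hεK]; field_simp
  have horiz : ∀ y, ε / 2 ≤ y → y ≤ 1 → hDist C (P 0 y) (P c y) ≤ (1 / 2) * Real.log K := by
    intro y hy1 hy2
    have hc0 : 0 < c := by linarith
    have := hDist_upper h (hPm 0 y h0abs hy1 hy2) (hPm c y hcabs hy1 hy2)
      (α := (1 - ε) / c) (β := ε / c) (div_pos (by linarith) hc0) (by positivity)
      (by
        convert hPm (-(1 - ε)) y (by rw [abs_neg, abs_of_nonneg]; linarith) hy1 hy2 using 1
        simp only [hP]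
        match_scalars <;> field_simp <;> ring)
      (by
        convert hPm (1 - ε) y (by rw [abs_of_nonneg]; linarith) hy1 hy2 using 1
        simp only [hP]
        match_scalars <;> field_simp <;> (try rw [hc]) <;> ring)
    refine this.trans ?_
    have h3 : 0 ≤ c / (1 - ε) := div_nonneg hc0.le (by linarith)
    gcongr
    rw [one_div_div, one_div_div]
    calc (1 + c / (1 - ε)) * (1 + c / ε) ≤ 2 * (1 / ε) := by
          gcongr
          · have : c / (1 - ε) ≤ 1 := by rw [div_le_one (by linarith)]; linarith
            linarith
          · field_simp; linarith
      _ = K := by rw [← hεK]; field_simp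
  have hφP : ∀ x y, -φ b + φ (P x y) = y := by
    intro x y; simp [hP, hφd, hφe]
  have m00 := hPm 0 (1 / 2) h0abs (by linarith) (by linarith)
  have m10 := hPm c (1 / 2) hcabs (by linarith) (by linarith)
  have m01 := hPm 0 ε h0abs (by linarith) (by linarith)
  have m11 := hPm c ε hcabs (by linarith) (by linarith)
  have D1 : (1 / 2) * Real.log (K / 4) ≤ hDist C (P 0 (1 / 2)) (P c ε) := by
    have := hDist_lower h m00 m11 φ 0 (-φ b) 1 hφ (by simp)
    rw [hφP, hφP] at this
    simp only [zero_apply, add_zero, div_one, mul_one] at this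
    rwa [hK4] at this
  have D2 : (1 / 2) * Real.log (K / 4 * (1 / (3 * ε))) ≤ hDist C (P c (1 / 2)) (P 0 ε) := by
    obtain ⟨g, hg⟩ := geometric_hahn_banach_open_point h.conv h.op h1
    set a := g (b + (1 : ℝ) • d + (1 : ℝ) • e) with ha
    have hgP : ∀ x y, a + (-g) (P x y) = g e * (1 - x) + g d * (1 - y) := by
      intro x y; simp [hP, ha]; ring
    have hgC : ∀ x ∈ C, 0 < a + (-g) x := by
      intro x hx; have := hg x hx; simp; linarith
    have := hDist_lower h m10 m01 φ (-g) (-φ b) a hφ hgC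
    rw [hφP, hφP, hgP, hgP] at this
    refine le_trans ?_ this
    have e1 := hgC _ (hA 0 (by simp))
    have e2 := hgC _ hYC
    have e3 := hgC _ (hPm (1 - ε) (ε / 2) (by rw [abs_of_nonneg]; linarith) le_rfl (by linarith))
    rw [show b + (1 : ℝ) • d + (0 : ℝ) • e = P 0 1 from rfl, hgP] at e1
    rw [show b + Y • d + (0 : ℝ) • e = P 0 Y from rfl, hgP] at e2
    rw [hgP] at e3
    set A := g e
    set B := g d
    have hA0 : 0 < A := by linarith
    have hB1 : B ≤ A * ε := by
      by_contra hcon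
      push Not at hcon
      have hB : 0 < B := lt_trans (by positivity) hcon
      have : B * (K - 1) ≤ B * (Y - 1) := by gcongr
      nlinarith
    have hB2 : -(2 * A * ε) ≤ B := by
      by_contra hcon
      push Not at hcon
      have : B * (1 - ε / 2) < -(2 * A * ε) * (1 - ε / 2) := by gcongr; linarith
      nlinarith [mul_pos hA0 hε0]
    have n1 : A * (1 - 2 * ε) ≤ A * (1 - 0) + B * (1 - ε) := by nlinarith [mul_pos hA0 hε0]
    have n2 : A * (1 - c) + B * (1 - 1 / 2) ≤ A * (5 / 2 * ε) := by rw [hc]; nlinarith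
    have n3 : 0 < A * (1 - c) + B * (1 - 1 / 2) := by rw [← hgP]; exact hgC _ m10
    rw [hK4]
    refine mul_le_mul_of_nonneg_left (Real.log_le_log (by positivity)
      (mul_le_mul_of_nonneg_left ?_ (by positivity))) (by norm_num)
    · rw [le_div_iff₀ n3]
      calc _ ≤ 1 / (3 * ε) * (A * (5 / 2 * ε)) := by gcongr
        _ = A * (5 / 6) := by field_simp; norm_num
        _ ≤ A * (1 - 2 * ε) := by gcongr; linarith
        _ ≤ _ := n1
  have V0 := vert 0 h0abs
  have V1 := vert c hcabs
  have H0 := horiz (1 / 2) (by linarith) (by linarith)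
  have H1 := horiz ε (by linarith) (by linarith)
  have hlog : 2 * Real.log K + 4 * δ < Real.log (K / 4) + Real.log (K / 4 * (1 / (3 * ε))) := by
    rw [← Real.log_mul (by positivity) (by positivity), ← Real.log_rpow hK0,
      ← Real.log_exp (4 * δ), ← Real.log_mul (by positivity) (by positivity)]
    apply Real.log_lt_log (by positivity)
    rw [Real.rpow_two]
    have : K / 4 * (K / 4 * (1 / (3 * ε))) = K ^ 2 * (K / 96) := by rw [hε]; field_simp; norm_num
    rw [this]
    gcongr
    linarith
  have key := hδ _ m00 _ m11 _ m01 _ m10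
  unfold gromovProd at key
  have c1 := hDist_comm h m11 m10
  have c2 := hDist_comm h m01 m10
  have c3 := hDist_comm h m00 m10
  have c4 := hDist_comm h m11 m01
  have c5 := hDist_comm h m00 m11
  rcases min_choice ((hDist C (P 0 (1/2)) (P c (1/2)) + hDist C (P 0 ε) (P c (1/2)) - hDist C (P 0 (1/2)) (P 0 ε)) / 2)
    ((hDist C (P c ε) (P c (1/2)) + hDist C (P 0 ε) (P c (1/2)) - hDist C (P c ε) (P 0 ε)) / 2) with hm | hm
  · rw [hm] at key; linarith
  · rw [hm] at key; linarith

end PartB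

end

section
open MeasureTheory Set Filter
open scoped ENNReal NNReal

structure Ray (C : Set (Euc 2)) (o : Euc 2) (r0 R0 : ℝ) where
  θ : Euc 2
  e : Euc 2
  ρ : ℝ
  φ : Euc 2 →L[ℝ] ℝ
  good : GoodC C
  r0pos : 0 < r0
  hin : Metric.ball o r0 ⊆ C
  hout : C ⊆ Metric.ball o R0
  hθ : ‖θ‖ = 1
  hρ : 0 < ρ
  hb : ∀ s : ℝ, 0 ≤ s → (o + s • θ ∈ C ↔ s < ρ)
  hφθ : φ θ = -1
  hφ : ∀ x ∈ C, 0 < -φ (o + ρ • θ) + φ x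
  hφe : φ e = 0
  he : e ≠ 0
  hsp : ∀ v, ∃ β : ℝ, v = (-φ v) • θ + β • e

theorem gg_comb {n : ℕ} {C : Set (Euc n)} (h : GoodC C) {p q u : Euc n} {c a b : ℝ} (hp : p ∈ C)
    (hq : q ∈ C) (hc : 0 < c) (h1 : gg C p u < c) (h2 : gg C q u < c) (ha : 0 ≤ a) (hb : 0 ≤ b)
    (hab : a + b = 1) : gg C (a • p + b • q) u < c := by
  rw [gg_lt_iff h hp hc] at h1
  rw [gg_lt_iff h hq hc] at h2
  rw [gg_lt_iff h (h.conv hp hq ha hb hab) hc]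
  convert h.conv h1 h2 ha hb hab using 1
  have : c⁻¹ = a * c⁻¹ + b * c⁻¹ := by rw [← add_mul, hab, one_mul]
  nth_rewrite 1 [this]
  module

theorem exists_ray {C : Set (Euc 2)} (h : GoodC C) {o : Euc 2} {r0 R0 : ℝ} (hr : 0 < r0)
    (hin : Metric.ball o r0 ⊆ C) (hout : C ⊆ Metric.ball o R0) {θ : Euc 2} (hθ : ‖θ‖ = 1) :
    ∃ T : Ray C o r0 R0, T.θ = θ := by
  have ho : o ∈ C := hin (Metric.mem_ball_self hr)
  have hθ0 : θ ≠ 0 := by rintro rfl; simp at hθ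
  have hg := gg_pos h ho hθ0
  set ρ := (gg C o θ)⁻¹ with hρ
  have hρ0 : 0 < ρ := by positivity
  have hb : ∀ s : ℝ, 0 ≤ s → (o + s • θ ∈ C ↔ s < ρ) := by
    intro s hs
    rw [← gg_lt_one_iff h ho, gg_smul hs, hρ, inv_eq_one_div, lt_div_iff₀ hg]
  obtain ⟨f, hf⟩ := geometric_hahn_banach_open_point h.conv h.op
    (show o + ρ • θ ∉ C by rw [hb ρ hρ0.le]; simp)
  have hfθ : 0 < f θ := by
    have := hf o ho
    simp at this
    exact (pos_iff_pos_of_mul_pos this).1 hρ0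
  have hker : ∃ e : Euc 2, e ≠ 0 ∧ f e = 0 := by
    have h1 : 0 < Module.finrank ℝ (LinearMap.ker (f : Euc 2 →ₗ[ℝ] ℝ)) := by
      have := LinearMap.finrank_range_add_finrank_ker (f : Euc 2 →ₗ[ℝ] ℝ)
      have h2 := Submodule.finrank_le (LinearMap.range (f : Euc 2 →ₗ[ℝ] ℝ))
      simp at this h2
      omega
    obtain ⟨⟨e, he⟩, he0⟩ := Module.finrank_pos_iff_exists_ne_zero.1 h1
    exact ⟨e, fun h => he0 (by simpa using h), he⟩
  obtain ⟨e, he0, hfe⟩ := hker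
  have hsp : ∀ v, f v = 0 → ∃ β : ℝ, v = β • e := by
    intro v hv
    have hli : ¬ LinearIndependent ℝ ![θ, e, v] := by
      intro hl
      have := hl.fintype_card_le_finrank
      simp at this
    rw [Fintype.not_linearIndependent_iff] at hli
    obtain ⟨g, hg0, i, hi⟩ := hli
    simp [Fin.sum_univ_three] at hg0
    have h0 : g 0 = 0 := by
      have := congrArg f hg0
      simp [hfe, hv] at this
      rcases this with h | h
      · exact h
      · exact absurd h hfθ.ne'
    have h2 : g 2 ≠ 0 := by
      intro h2
      rw [h0, h2] at hg0
      simp [he0] at hg0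
      fin_cases i <;> simp_all
    refine ⟨-(g 1) / g 2, ?_⟩
    rw [h0, zero_smul, zero_add] at hg0
    have := congrArg (fun x => (g 2)⁻¹ • x) hg0
    simp only [smul_add, smul_smul, inv_mul_cancel₀ h2, one_smul, smul_zero] at this
    rw [eq_neg_of_add_eq_zero_right this, ← neg_smul]
    congr 1; field_simp
  refine ⟨⟨θ, e, ρ, -(f θ)⁻¹ • f, h, hr, hin, hout, hθ, hρ0, hb, ?_, ?_, ?_, he0, ?_⟩, rfl⟩
  · simp [hfθ.ne']
  · intro x hx
    have := hf x hx
    simp only [smul_apply, smul_eq_mul]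
    have : 0 < (f θ)⁻¹ * (f (o + ρ • θ) - f x) := mul_pos (by positivity) (by linarith)
    linarith
  · simp [hfe]
  · intro v
    obtain ⟨β, hβ⟩ := hsp (v - ((f θ)⁻¹ * f v) • θ) (by simp; field_simp; simp)
    refine ⟨β, ?_⟩
    rw [← hβ]; simp

namespace Ray
variable {C : Set (Euc 2)} {o : Euc 2} {r0 R0 : ℝ} (T : Ray C o r0 R0)
include T

theorem ho : o ∈ C := T.hin (Metric.mem_ball_self T.r0pos)

def pt (t : ℝ) : Euc 2 := o + (T.ρ - t) • T.θ

theorem pt_mem {t : ℝ} (h0 : 0 < t) (h1 : t ≤ T.ρ) : T.pt t ∈ C :=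
  (T.hb _ (by linarith)).2 (by linarith)

theorem R0pos : r0 ≤ R0 := by
  by_contra hc
  push Not at hc
  have h1 : o + max R0 0 • T.θ ∈ Metric.ball o r0 := by
    simp only [mem_ball_iff_norm, add_sub_cancel_left, norm_smul, T.hθ, mul_one, Real.norm_eq_abs]
    rw [abs_of_nonneg (le_max_right _ _)]; exact max_lt hc T.r0pos
  have := T.hout (T.hin h1)
  simp only [mem_ball_iff_norm, add_sub_cancel_left, norm_smul, T.hθ, mul_one, Real.norm_eq_abs] at this
  exact absurd ((le_max_left R0 0).trans (le_abs_self _)) (not_le.2 this)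

theorem rho_le : T.ρ ≤ R0 := by
  by_contra hc
  push Not at hc
  have h0 : 0 < R0 := T.r0pos.trans_le T.R0pos
  have := T.hout ((T.hb R0 h0.le).2 hc)
  simp [norm_smul, T.hθ] at this
  exact absurd this (not_lt.2 (le_abs_self _))

theorem gg_o_le (u : Euc 2) : gg C o u ≤ ‖u‖ / r0 := by
  apply le_of_forall_gt
  intro a ha
  have h0 := T.r0pos
  have ha0 : 0 < a := lt_of_le_of_lt (by positivity) ha
  rw [gg_lt_iff T.good T.ho ha0]
  apply T.hin
  rw [div_lt_iff₀ h0] at ha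
  simp [norm_smul, abs_of_pos ha0]
  rwa [inv_mul_lt_iff₀ ha0]

theorem gg_ge {p : Euc 2} (hp : p ∈ C) (u : Euc 2) : ‖u‖ / (2 * R0) ≤ gg C p u := by
  have h0 : 0 < R0 := T.r0pos.trans_le T.R0pos
  rcases eq_or_ne u 0 with rfl | hu
  · simp
  by_contra hc
  push Not at hc
  have hu0 := norm_pos_iff.2 hu
  have ha0 : 0 < ‖u‖ / (2 * R0) := by positivity
  rw [gg_lt_iff T.good hp ha0] at hc
  have h1 := T.hout hc
  have h2 := T.hout hp
  have h3 := dist_triangle_right (p + (‖u‖ / (2 * R0))⁻¹ • u) p o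
  rw [Metric.mem_ball] at h1 h2
  rw [dist_eq_norm, add_sub_cancel_left, norm_smul, norm_inv, Real.norm_of_nonneg ha0.le] at h3
  have : (‖u‖ / (2 * R0))⁻¹ * ‖u‖ = 2 * R0 := by field_simp
  linarith

theorem gmono {t τ : ℝ} (h0 : 0 < t) (h1 : t ≤ τ) (h2 : τ ≤ T.ρ) (u : Euc 2) :
    gg C (T.pt τ) u ≤ (2 * R0 / r0) * gg C (T.pt t) u := by
  have hr := T.r0pos
  have hR := T.R0pos
  have hC1 : 1 ≤ 2 * R0 / r0 := by rw [le_div_iff₀ hr]; linarith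
  have hpt := T.pt_mem h0 (h1.trans h2)
  have g0 : 0 ≤ gg C (T.pt t) u := gg_nonneg
  apply le_of_forall_gt
  intro a ha
  have ha0 : 0 < a := lt_of_le_of_lt (by positivity) ha
  rcases eq_or_lt_of_le (h1.trans h2) with he | hlt
  · rw [show τ = t by linarith]
    nlinarith
  have e1 : gg C (T.pt t) u < a := by nlinarith
  have e2 : gg C o u < a := by
    refine lt_of_le_of_lt (T.gg_o_le u) (lt_of_le_of_lt ?_ ha)
    have := T.gg_ge hpt u
    calc ‖u‖ / r0 = 2 * R0 / r0 * (‖u‖ / (2 * R0)) := by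
          have : R0 ≠ 0 := by linarith
          field_simp
      _ ≤ _ := by gcongr
  have hρt : 0 < T.ρ - t := by linarith
  have := gg_comb T.good hpt T.ho ha0 e1 e2 (a := (T.ρ - τ) / (T.ρ - t)) (b := (τ - t) / (T.ρ - t))
    (div_nonneg (by linarith) hρt.le) (div_nonneg (by linarith) hρt.le) (by field_simp; ring)
  have e3 : T.pt τ = ((T.ρ - τ) / (T.ρ - t)) • T.pt t + ((τ - t) / (T.ρ - t)) • o := by
    unfold pt
    match_scalars <;> field_simp <;> ring
  rwa [← e3] at this

theorem fth {t : ℝ} (h0 : 0 < t) (h1 : t ≤ T.ρ) : fNorm C (T.pt t) T.θ ≤ (1 + R0 / r0) / 2 / t := by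
  have hp := T.pt_mem h0 h1
  have hr := T.r0pos
  rw [fNorm_eq T.good hp]
  have e1 : gg C (T.pt t) T.θ ≤ 1 / t := by
    apply le_of_forall_gt
    intro a ha
    have ha0 : 0 < a := lt_trans (by positivity) ha
    rw [gg_lt_iff T.good hp ha0]
    have : a⁻¹ < t := by rw [inv_lt_comm₀ ha0 h0]; simpa using ha
    have hm := (T.hb (T.ρ - t + a⁻¹) (by have := inv_pos.2 ha0; linarith)).2 (by linarith)
    convert hm using 1
    unfold pt; module
  have e2 : gg C (T.pt t) (-T.θ) ≤ R0 / r0 / t := by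
    apply le_of_forall_gt
    intro a ha
    have hR := T.R0pos
    have hρR := T.rho_le
    have hR0 : 0 < R0 := by linarith
    have ha0 : 0 < a := lt_trans (by positivity) ha
    rw [gg_lt_iff T.good hp ha0]
    have h3 : a⁻¹ < r0 := by
      rw [inv_lt_comm₀ ha0 hr]
      refine lt_of_le_of_lt ?_ ha
      rw [div_div, le_div_iff₀ (by positivity)]
      field_simp; linarith
    have ha1 := inv_pos.2 ha0
    have h4 : o + (-a⁻¹) • T.θ ∈ C := T.hin (by simp [norm_smul, T.hθ, abs_of_pos ha0, h3])
    have h5 : T.pt t + a⁻¹ • -T.θ = o + (T.ρ - t - a⁻¹) • T.θ := by unfold pt; module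
    rw [h5]
    by_cases hs : 0 ≤ T.ρ - t - a⁻¹
    · exact (T.hb _ hs).2 (by linarith)
    · push Not at hs
      have := T.good.conv T.ho h4 (a := 1 - (a⁻¹ - (T.ρ - t)) * a) (b := (a⁻¹ - (T.ρ - t)) * a)
        (by have : (a⁻¹ - (T.ρ - t)) * a ≤ a⁻¹ * a := by gcongr; linarith
            rw [inv_mul_cancel₀ ha0.ne'] at this; linarith)
        (mul_nonneg (by linarith) ha0.le) (by ring)
      convert this using 1
      match_scalars
      · ring
      · field_simp; ring
  calc _ ≤ 1 / 2 * (1 / t + R0 / r0 / t) := by gcongr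
    _ = _ := by ring

noncomputable def NN (t : ℝ) (e : Euc 2) : ℝ := max (gg C (T.pt t) e) (gg C (T.pt t) (-e))

theorem NN_neg (t : ℝ) (e : Euc 2) : T.NN t (-e) = T.NN t e := by
  unfold NN; rw [neg_neg, max_comm]

theorem NN_pos {t : ℝ} (h0 : 0 < t) (h1 : t ≤ T.ρ) : 0 < T.NN t T.e :=
  lt_max_of_lt_left (gg_pos T.good (T.pt_mem h0 h1) T.he)

theorem step1 {δ K t : ℝ} (hd0 : 0 ≤ δ) (hδ : IsDeltaHyp C δ) (hK : 200 * Real.exp (4 * δ) ≤ K)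
    (h0 : 0 < t) (h1 : t ≤ T.ρ / K) {e : Euc 2} (he : e ≠ 0) (hφe : T.φ e = 0)
    (hmax : gg C (T.pt t) (-e) ≤ gg C (T.pt t) e) :
    gg C (T.pt t) e ≤ (1 - 2 / K) * T.NN (t / K) e := by
  have hex : 1 ≤ Real.exp (4 * δ) := Real.one_le_exp (by positivity)
  have hK200 : 200 ≤ K := by linarith
  have hK0 : 0 < K := by linarith
  have hρ := T.hρ
  have htρ : t ≤ T.ρ := h1.trans (div_le_self hρ.le (by linarith))
  have h1' : t * K ≤ T.ρ := by rwa [le_div_iff₀ hK0] at h1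
  by_contra hcon
  push Not at hcon
  have hpt := T.pt_mem h0 htρ
  have hg := gg_pos T.good hpt he
  have hptK := T.pt_mem (div_pos h0 hK0) ((div_le_self h0.le (by linarith)).trans htρ)
  set R := (gg C (T.pt t) e)⁻¹ with hR
  have hR0 : 0 < R := by positivity
  have hRg : R * gg C (T.pt t) e = 1 := by rw [hR]; field_simp
  have hk0 : 0 < 1 - 2 / K := by
    have : 2 / K ≤ 1 / 100 := by rw [div_le_iff₀ hK0]; linarith
    linarith
  have hb1 : (1 - 2 / K) * (R * gg C (T.pt (t / K)) e) < 1 := by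
    have : (1 - 2 / K) * gg C (T.pt (t / K)) e < gg C (T.pt t) e :=
      lt_of_le_of_lt (by gcongr; exact le_max_left _ _) hcon
    nlinarith
  have hb2 : (1 - 2 / K) * (R * gg C (T.pt (t / K)) (-e)) < 1 := by
    have : (1 - 2 / K) * gg C (T.pt (t / K)) (-e) < gg C (T.pt t) e :=
      lt_of_le_of_lt (by gcongr; exact le_max_right _ _) hcon
    nlinarith
  have base : o + T.ρ • T.θ + (1 : ℝ) • (t • -T.θ) = T.pt t := by unfold pt; module
  have baseK : o + T.ρ • T.θ + (1 / K) • (t • -T.θ) = T.pt (t / K) := by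
    unfold pt; match_scalars <;> field_simp <;> ring
  refine key_hyp T.good (δ := δ) (K := K) (Y := T.ρ / t) hd0 hδ hK (b := o + T.ρ • T.θ) (d := t • -T.θ)
    (e := R • e) (t⁻¹ • T.φ) ?_ ?_ ?_ ?_ ?_ ?_ ?_ ?_ ?_
  · intro x hx
    have := mul_pos (inv_pos.2 h0) (T.hφ x hx)
    simp only [smul_apply, smul_eq_mul]
    linarith
  · simp [T.hφθ, h0.ne']
  · simp [hφe]
  · rw [base, ← gg_lt_one_iff T.good hpt, one_smul, gg_smul hR0.le, hRg]; simp
  · intro x hx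
    rw [base, ← gg_lt_one_iff T.good hpt]
    rcases le_total 0 x with hx0 | hx0
    · rw [gg_smul hx0, gg_smul hR0.le, hRg, mul_one]; rwa [abs_of_nonneg hx0] at hx
    · rw [show x • R • e = (-x) • R • (-e) by module, gg_smul (by linarith), gg_smul hR0.le]
      rw [abs_of_nonpos hx0] at hx
      have : R * gg C (T.pt t) (-e) ≤ 1 := by rw [← hRg]; gcongr
      nlinarith
  · rw [baseK, ← gg_lt_one_iff T.good hptK, gg_smul hk0.le, gg_smul hR0.le]; exact hb1
  · rw [baseK, ← gg_lt_one_iff T.good hptK,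
      show (-(1 - 2 / K)) • R • e = (1 - 2 / K) • R • (-e) by module, gg_smul hk0.le, gg_smul hR0.le]
    exact hb2
  · rw [le_div_iff₀ h0]; linarith
  · have : o + T.ρ • T.θ + (T.ρ / t) • t • -T.θ + (0 : ℝ) • R • e = o := by
      match_scalars <;> field_simp <;> ring
    rw [this]; exact T.ho

theorem step2 {δ K t : ℝ} (hd0 : 0 ≤ δ) (hδ : IsDeltaHyp C δ) (hK : 200 * Real.exp (4 * δ) ≤ K)
    (h0 : 0 < t) (h1 : t ≤ T.ρ / K) : T.NN t T.e ≤ (1 - 2 / K) * T.NN (t / K) T.e := by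
  rcases le_total (gg C (T.pt t) (-T.e)) (gg C (T.pt t) T.e) with hle | hle
  · have := T.step1 hd0 hδ hK h0 h1 T.he T.hφe hle
    rwa [NN, max_eq_left hle]
  · have := T.step1 hd0 hδ hK h0 h1 (neg_ne_zero.2 T.he) (by simp [T.hφe]) (by rwa [neg_neg])
    rwa [NN_neg, ← max_eq_right hle] at this

theorem NN_mono {t τ : ℝ} (h0 : 0 < t) (h1 : t ≤ τ) (h2 : τ ≤ T.ρ) :
    T.NN τ T.e ≤ (2 * R0 / r0) * T.NN t T.e := by
  have : 0 ≤ 2 * R0 / r0 := div_nonneg (by linarith [T.r0pos, T.R0pos]) T.r0pos.le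
  exact max_le ((T.gmono h0 h1 h2 _).trans (by gcongr; exact le_max_left _ _))
    ((T.gmono h0 h1 h2 _).trans (by gcongr; exact le_max_right _ _))

end Ray

end

section
open MeasureTheory Set Filter
open scoped ENNReal NNReal

theorem fNorm_add_le {n : ℕ} {C : Set (Euc n)} (h : GoodC C) {p u v : Euc n} (hp : p ∈ C) :
    fNorm C p (u + v) ≤ fNorm C p u + fNorm C p v := by
  rw [fNorm_eq h hp, fNorm_eq h hp, fNorm_eq h hp, neg_add]
  linarith [gg_add_le h hp (u := u) (v := v), gg_add_le h hp (u := -u) (v := -v)]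

theorem fNorm_smul_abs {n : ℕ} {C : Set (Euc n)} (h : GoodC C) {p u : Euc n} (hp : p ∈ C) (c : ℝ) :
    fNorm C p (c • u) = |c| * fNorm C p u := by
  rcases le_total 0 c with hc | hc
  · rw [fNorm_smul h hp hc, abs_of_nonneg hc]
  · rw [← fNorm_neg h hp, ← neg_smul, fNorm_smul h hp (by linarith), abs_of_nonpos hc]

namespace Ray
variable {C : Set (Euc 2)} {o : Euc 2} {r0 R0 : ℝ} (T : Ray C o r0 R0)

theorem NN_pow {δ K α : ℝ} (hd0 : 0 ≤ δ) (hδ : IsDeltaHyp C δ) (hK : 200 * Real.exp (4 * δ) ≤ K)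
    (hα : 0 < α) (hKα : (1 - 2 / K) * K ^ α = 1) {t τ : ℝ} (h0 : 0 < t) (h1 : t ≤ τ) (h2 : τ ≤ T.ρ) :
    T.NN τ T.e ≤ ((2 * R0 / r0) ^ 2 * (K ^ α) ^ 2) * (t / τ) ^ α * T.NN t T.e := by
  have hex : 1 ≤ Real.exp (4 * δ) := Real.one_le_exp (by positivity)
  have hK200 : 200 ≤ K := by linarith
  have hK0 : 0 < K := by linarith
  have hr := T.r0pos
  have hR := T.R0pos
  have hR0 : 0 < R0 := by linarith
  have hρ := T.hρ
  have hC1 : 1 ≤ 2 * R0 / r0 := by rw [le_div_iff₀ hr]; linarith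
  set C1 := 2 * R0 / r0 with hC1d
  have hKa1 : 1 ≤ K ^ α := Real.one_le_rpow (by linarith) hα.le
  have base : ∀ t τ : ℝ, 0 < t → t ≤ τ → τ ≤ T.ρ → τ ≤ K * t →
      T.NN τ T.e ≤ C1 * K ^ α * (t / τ) ^ α * T.NN t T.e := by
    intro t τ h0 h1 h2 h3
    have hτ : 0 < τ := by linarith
    have hN := T.NN_pos h0 (h1.trans h2)
    refine (T.NN_mono h0 h1 h2).trans ?_
    have : 1 ≤ K ^ α * (t / τ) ^ α := by
      rw [← Real.mul_rpow hK0.le (by positivity)]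
      apply Real.one_le_rpow _ hα.le
      rw [mul_div_assoc', le_div_iff₀ hτ]; linarith
    calc C1 * T.NN t T.e = C1 * 1 * T.NN t T.e := by ring
      _ ≤ C1 * (K ^ α * (t / τ) ^ α) * T.NN t T.e := by gcongr
      _ = _ := by ring
  have ind : ∀ m : ℕ, ∀ t τ : ℝ, 0 < t → t ≤ τ → τ ≤ T.ρ / K → τ ≤ K ^ (m + 1) * t →
      T.NN τ T.e ≤ C1 * K ^ α * (t / τ) ^ α * T.NN t T.e := by
    intro m
    induction m with
    | zero =>
      intro t τ h0 h1 h2 h3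
      exact base t τ h0 h1 (h2.trans (div_le_self hρ.le (by linarith))) (by simpa using h3)
    | succ m ih =>
      intro t τ h0 h1 h2 h3
      by_cases hc : τ ≤ K * t
      · exact base t τ h0 h1 (h2.trans (div_le_self hρ.le (by linarith))) hc
      push Not at hc
      have hτ : 0 < τ := by linarith
      have i1 := ih t (τ / K) h0 (by rw [le_div_iff₀ hK0]; linarith)
        ((div_le_self hτ.le (by linarith)).trans h2) (by
          rw [div_le_iff₀ hK0]; calc τ ≤ _ := h3
            _ = _ := by ring)
      have i2 := T.step2 hd0 hδ hK hτ h2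
      have hk0 : 0 < 1 - 2 / K := by
        by_contra hcon
        push Not at hcon
        nlinarith
      calc _ ≤ (1 - 2 / K) * (C1 * K ^ α * (t / (τ / K)) ^ α * T.NN t T.e) := i2.trans (by gcongr)
        _ = (1 - 2 / K) * (C1 * K ^ α * (K ^ α * (t / τ) ^ α) * T.NN t T.e) := by
          rw [← Real.mul_rpow hK0.le (by positivity)]; congr 4; field_simp
        _ = ((1 - 2 / K) * K ^ α) * (C1 * K ^ α * (t / τ) ^ α * T.NN t T.e) := by ring
        _ = _ := by rw [hKα, one_mul]
  have full : ∀ t τ : ℝ, 0 < t → t ≤ τ → τ ≤ T.ρ / K →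
      T.NN τ T.e ≤ C1 * K ^ α * (t / τ) ^ α * T.NN t T.e := by
    intro t τ h0 h1 h2
    obtain ⟨m, hm⟩ := pow_unbounded_of_one_lt (τ / t) (show 1 < K by linarith)
    refine ind m t τ h0 h1 h2 ?_
    rw [div_lt_iff₀ h0] at hm
    have : K ^ m ≤ K ^ (m + 1) := pow_le_pow_right₀ (by linarith) (by omega)
    nlinarith
  have hN := T.NN_pos h0 (h1.trans h2)
  have hτ : 0 < τ := by linarith
  have hx : 0 ≤ (t / τ) ^ α := by positivity
  have big : C1 * K ^ α ≤ C1 ^ 2 * (K ^ α) ^ 2 := by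
    rw [← mul_pow]; exact le_self_pow₀ (one_le_mul_of_one_le_of_one_le hC1 hKa1) two_ne_zero
  by_cases hc : t ≤ T.ρ / K
  · by_cases hc2 : τ ≤ T.ρ / K
    · exact (full t τ h0 h1 hc2).trans (by gcongr)
    · push Not at hc2
      have i1 := full t (T.ρ / K) h0 hc le_rfl
      have i2 := T.NN_mono (by positivity) hc2.le h2
      calc _ ≤ C1 * (C1 * K ^ α * (t / (T.ρ / K)) ^ α * T.NN t T.e) := i2.trans (by gcongr)
        _ ≤ C1 * (C1 * K ^ α * (t / (τ / K)) ^ α * T.NN t T.e) := by gcongr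
        _ = C1 * (C1 * K ^ α * (K ^ α * (t / τ) ^ α) * T.NN t T.e) := by
          rw [← Real.mul_rpow hK0.le (by positivity)]; congr 4; field_simp
        _ = _ := by ring
  · push Not at hc
    rw [div_lt_iff₀ hK0] at hc
    exact (base t τ h0 h1 h2 (by linarith)).trans (by gcongr)

theorem TB_comp {t τ : ℝ} (h0 : 0 < t) (h1 : t ≤ τ) (h2 : τ ≤ T.ρ) :
    dens C (T.pt τ) ≤ (3 + 6 * ((1 + R0 / r0) / 2)) ^ 2 * ((t / τ) * (T.NN τ T.e / T.NN t T.e)) *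
      dens C (T.pt t) := by
  have hr := T.r0pos
  have hR := T.R0pos
  have hR0 : 0 < R0 := by linarith
  have hτ : 0 < τ := by linarith
  have g := T.good
  have hpt := T.pt_mem h0 (h1.trans h2)
  have hpτ := T.pt_mem hτ h2
  have N1 := T.NN_pos h0 (h1.trans h2)
  have N2 := T.NN_pos hτ h2
  have f1 := T.fth h0 (h1.trans h2)
  have f2 := T.fth hτ h2
  set c2 := (1 + R0 / r0) / 2 with hc2
  have hc20 : 0 < c2 := by positivity
  set N := T.NN t T.e
  set N' := T.NN τ T.e
  set M := 3 + 6 * c2 with hM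
  have hM0 : 0 < M := by positivity
  set a := τ / t with ha
  set b := N / N' with hb
  have ha0 : 0 < a := by positivity
  have hb0 : 0 < b := by positivity
  set D : Euc 2 →ₗ[ℝ] Euc 2 := (M⁻¹ * b) •
    LinearMap.transvection ((-((a - b) / b)) • (T.φ : Euc 2 →ₗ[ℝ] ℝ)) T.θ with hD
  have hdet : LinearMap.det D = (M⁻¹) ^ 2 * (a * b) := by
    rw [hD, LinearMap.det_smul, LinearMap.transvection.det]
    simp [T.hφθ]
    field_simp; ring
  have hDv : ∀ v, D v = M⁻¹ • (b • v + ((a - b) * (-T.φ v)) • T.θ) := by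
    intro v
    simp only [hD, LinearMap.smul_apply, LinearMap.transvection.apply, smul_eq_mul]
    match_scalars
    · ring
    · simp; field_simp
  have hsub : D '' tangentBall C (T.pt t) 1 ⊆ tangentBall C (T.pt τ) 1 := by
    rintro _ ⟨v, hv, rfl⟩
    have hv1 : fNorm C (T.pt t) v < 1 := hv
    show fNorm C (T.pt τ) (D v) < 1
    have hpφ : -T.φ (o + T.ρ • T.θ) + T.φ (T.pt t) = t := by
      unfold pt; simp [T.hφθ]
    have b1 := func_bound (v := v) g hpt T.φ _ T.hφ
    have b2 := func_bound (v := -v) g hpt T.φ _ T.hφ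
    rw [hpφ] at b1 b2
    rw [map_neg, neg_neg] at b2
    have hv2 := hv1
    rw [fNorm_eq g hpt] at hv2
    have G1 : 0 ≤ gg C (T.pt t) v := gg_nonneg
    have G2 : 0 ≤ gg C (T.pt t) (-v) := gg_nonneg
    have hφv : |T.φ v| ≤ 2 * t := abs_le.2 ⟨by nlinarith, by nlinarith⟩
    obtain ⟨β, hβ⟩ := T.hsp v
    have k1 : fNorm C (T.pt t) (β • T.e) ≤ 1 + 2 * c2 := by
      have e1 : β • T.e = v + (T.φ v) • T.θ := by
        nth_rewrite 1 [hβ]; module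
      have := fNorm_nonneg g hpt (u := T.θ)
      calc _ ≤ fNorm C (T.pt t) v + fNorm C (T.pt t) ((T.φ v) • T.θ) := by
            rw [e1]; exact fNorm_add_le g hpt
        _ ≤ 1 + (2 * t) * (c2 / t) := by rw [fNorm_smul_abs g hpt]; gcongr
        _ = _ := by field_simp
    have k2 : N / 2 ≤ fNorm C (T.pt t) T.e := by
      rw [fNorm_eq g hpt]
      have G1 : 0 ≤ gg C (T.pt t) T.e := gg_nonneg
      have G2 : 0 ≤ gg C (T.pt t) (-T.e) := gg_nonneg
      have : N ≤ gg C (T.pt t) T.e + gg C (T.pt t) (-T.e) := max_le (by linarith) (by linarith)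
      linarith
    have k3 : fNorm C (T.pt τ) T.e ≤ N' := by
      rw [fNorm_eq g hpτ]
      have : gg C (T.pt τ) T.e ≤ N' := le_max_left _ _
      have : gg C (T.pt τ) (-T.e) ≤ N' := le_max_right _ _
      linarith
    rw [fNorm_smul_abs g hpt] at k1
    have k4 : |β| * N ≤ 2 + 4 * c2 := by
      have : |β| * (N / 2) ≤ |β| * fNorm C (T.pt t) T.e := by gcongr
      linarith
    have e2 : b • v + ((a - b) * (-T.φ v)) • T.θ = (a * (-T.φ v)) • T.θ + (b * β) • T.e := by
      nth_rewrite 1 [hβ]; module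
    rw [hDv, e2, fNorm_smul g hpτ (by positivity), inv_mul_lt_iff₀ hM0, mul_one]
    have n1 := fNorm_nonneg g hpτ (u := T.θ)
    have n2 := fNorm_nonneg g hpτ (u := T.e)
    calc _ ≤ _ := fNorm_add_le g hpτ
      _ = a * |T.φ v| * fNorm C (T.pt τ) T.θ + b * |β| * fNorm C (T.pt τ) T.e := by
        rw [fNorm_smul_abs g hpτ, fNorm_smul_abs g hpτ, abs_mul, abs_mul, abs_neg, abs_of_pos ha0,
          abs_of_pos hb0]
      _ ≤ a * (2 * t) * (c2 / τ) + b * |β| * N' := by gcongr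
      _ = 2 * c2 + |β| * N := by rw [ha, hb]; field_simp
      _ ≤ 2 * c2 + (2 + 4 * c2) := by gcongr
      _ < M := by rw [hM]; linarith
  have hvol := measure_mono (μ := volume) hsub
  rw [Measure.addHaar_image_linearMap, hdet] at hvol
  have hvol2 := ENNReal.toReal_mono (TB_vol_lt_top g hpτ).ne hvol
  rw [ENNReal.toReal_mul, ENNReal.toReal_ofReal (abs_nonneg _), abs_of_pos (by positivity)] at hvol2
  have V1 := TB_vol_pos g hpt
  have V2 := TB_vol_pos g hpτ
  have hω := omega_pos (n := 2)
  unfold dens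
  set V := (volume (tangentBall C (T.pt t) 1)).toReal
  set V' := (volume (tangentBall C (T.pt τ) 1)).toReal
  calc omegaVol 2 / V' ≤ omegaVol 2 / (M⁻¹ ^ 2 * (a * b) * V) := by gcongr
    _ = _ := by rw [ha, hb]; field_simp

theorem dens_int {δ K α : ℝ} (hd0 : 0 ≤ δ) (hδ : IsDeltaHyp C δ) (hK : 200 * Real.exp (4 * δ) ≤ K)
    (hα : 0 < α) (hKα : (1 - 2 / K) * K ^ α = 1) {s : ℝ} (hs : 0 < s) (hsρ : s < T.ρ) :
    ∫⁻ r in Ioo 0 s, ENNReal.ofReal (r * dens C (o + r • T.θ)) ≤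
      ENNReal.ofReal ((3 + 6 * ((1 + R0 / r0) / 2)) ^ 2 * ((2 * R0 / r0) ^ 2 * (K ^ α) ^ 2) / α *
        (T.ρ - s) * (s * dens C (o + s • T.θ))) := by
  have hr := T.r0pos
  have hR := T.R0pos
  have hR0 : 0 < R0 := by linarith
  have hK0 : 0 < K := by have := Real.exp_pos (4 * δ); linarith
  set A := (3 + 6 * ((1 + R0 / r0) / 2)) ^ 2 with hA
  set B := (2 * R0 / r0) ^ 2 * (K ^ α) ^ 2 with hB
  have hA0 : 0 ≤ A := by positivity
  have hB0 : 0 ≤ B := by positivity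
  set t := T.ρ - s with ht
  have ht0 : 0 < t := by linarith
  have hps : o + s • T.θ = T.pt t := by unfold pt; rw [ht]; simp
  have hpC := T.pt_mem ht0 (by linarith)
  rw [hps]
  have hd := dens_pos T.good hpC
  set E := A * B * s * dens C (T.pt t) * t ^ (1 + α) with hE
  have hE0 : 0 ≤ E := by positivity
  have hpt : ∀ r ∈ Ioo 0 s, ENNReal.ofReal (r * dens C (o + r • T.θ)) ≤
      ENNReal.ofReal (E * (T.ρ - r) ^ (-1 - α)) := by
    rintro r ⟨hr0, hrs⟩
    apply ENNReal.ofReal_le_ofReal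
    have hτ : 0 < T.ρ - r := by linarith
    have e1 := T.TB_comp ht0 (show t ≤ T.ρ - r by linarith) (by linarith)
    have e2 := T.NN_pow hd0 hδ hK hα hKα ht0 (show t ≤ T.ρ - r by linarith) (by linarith)
    have hpr : o + r • T.θ = T.pt (T.ρ - r) := by unfold pt; simp
    have N1 := T.NN_pos ht0 (by linarith)
    rw [← div_le_iff₀ N1] at e2
    rw [hpr]
    calc r * dens C (T.pt (T.ρ - r)) ≤ s * (A * ((t / (T.ρ - r)) *
          (B * (t / (T.ρ - r)) ^ α)) * dens C (T.pt t)) := by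
          have : 0 < dens C (T.pt (T.ρ - r)) := dens_pos T.good (T.pt_mem hτ (by linarith))
          refine mul_le_mul hrs.le (e1.trans ?_) this.le hs.le
          gcongr
      _ = E * (T.ρ - r) ^ (-1 - α) := by
        rw [hE, Real.div_rpow ht0.le hτ.le, Real.rpow_add ht0, Real.rpow_one,
          show -1 - α = -(1 + α) by ring, Real.rpow_neg hτ.le, Real.rpow_add hτ, Real.rpow_one]
        field_simp
  have hcont : ContinuousOn (fun r : ℝ => E * (T.ρ - r) ^ (-1 - α)) (Icc 0 s) := by
    intro r hr
    apply ContinuousAt.continuousWithinAt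
    have : T.ρ - r ≠ 0 := by have := hr.2; linarith
    exact continuousAt_const.mul ((continuousAt_const.sub continuousAt_id).rpow_const (Or.inl this))
  have hii : IntervalIntegrable (fun r : ℝ => E * (T.ρ - r) ^ (-1 - α)) volume 0 s :=
    ContinuousOn.intervalIntegrable (by rwa [uIcc_of_le hs.le])
  have hint : ∫ r in (0 : ℝ)..s, E * (T.ρ - r) ^ (-1 - α) =
      E / α * (T.ρ - s) ^ (-α) - E / α * (T.ρ - 0) ^ (-α) := by
    refine intervalIntegral.integral_eq_sub_of_hasDerivAt (f := fun r => E / α * (T.ρ - r) ^ (-α)) ?_ hii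
    intro r hr
    rw [uIcc_of_le hs.le] at hr
    have h3 : 0 < T.ρ - r := by have := hr.2; linarith
    have := ((hasDerivAt_id r).const_sub T.ρ).rpow_const (p := -α) (Or.inl h3.ne')
    have h4 := this.const_mul (E / α)
    have h5 : E / α * (-1 * -α * (T.ρ - id r) ^ (-α - 1)) = E * (T.ρ - r) ^ (-1 - α) := by
      rw [show -α - 1 = -1 - α by ring, id]
      field_simp
    rw [h5] at h4
    exact h4
  calc _ ≤ ∫⁻ r in Ioo 0 s, ENNReal.ofReal (E * (T.ρ - r) ^ (-1 - α)) := setLIntegral_mono' measurableSet_Ioo hpt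
    _ ≤ ∫⁻ r in Ioc 0 s, ENNReal.ofReal (E * (T.ρ - r) ^ (-1 - α)) := lintegral_mono_set Ioo_subset_Ioc_self
    _ = ENNReal.ofReal (∫ r in Ioc 0 s, E * (T.ρ - r) ^ (-1 - α)) := by
      rw [ofReal_integral_eq_lintegral_ofReal]
      · exact (intervalIntegrable_iff_integrableOn_Ioc_of_le hs.le).1 hii
      · refine (ae_restrict_iff' measurableSet_Ioc).2 (ae_of_all _ fun r hr => ?_)
        have h3 : 0 < T.ρ - r := by have := hr.2; linarith
        show 0 ≤ _
        positivity
    _ ≤ _ := by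
      apply ENNReal.ofReal_le_ofReal
      rw [← intervalIntegral.integral_of_le hs.le, hint]
      have h5 : 0 ≤ E / α * (T.ρ - 0) ^ (-α) := by have := T.hρ; positivity
      have h6 : E / α * (T.ρ - s) ^ (-α) = A * B / α * t * (s * dens C (T.pt t)) := by
        rw [← ht, hE, Real.rpow_neg ht0.le, Real.rpow_add ht0, Real.rpow_one]
        have := Real.rpow_pos_of_pos ht0 α
        field_simp
      linarith

end Ray

end

section
open MeasureTheory Set Filter
open scoped ENNReal NNReal

section Meas
variable {n : ℕ} {C : Set (Euc n)} {p u : Euc n}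

theorem gg_meas (h : GoodC C) :
    Measurable (fun x : Euc n × Euc n => C.indicator (fun p => gg C p x.2) x.1) := by
  refine measurable_of_Iio fun a => ?_
  rcases le_or_gt a 0 with ha | ha
  · convert MeasurableSet.empty
    ext x
    simp only [mem_preimage, mem_Iio, mem_empty_iff_false, iff_false, not_lt]
    refine ha.trans (indicator_nonneg (fun p hp => gg_nonneg ..) _)
  · have : (fun x : Euc n × Euc n => C.indicator (fun p => gg C p x.2) x.1) ⁻¹' Iio a =
        (Prod.fst ⁻¹' C)ᶜ ∪ (fun x : Euc n × Euc n => x.1 + a⁻¹ • x.2) ⁻¹' C := by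
      ext x
      by_cases hx : x.1 ∈ C
      · simp [hx, gg_lt_iff h hx ha]
      · simp [hx, ha]
    rw [this]
    have hm := h.op.measurableSet
    exact (hm.preimage measurable_fst).compl.union (hm.preimage (by fun_prop))

theorem fNorm_meas (h : GoodC C) :
    Measurable (fun x : Euc n × Euc n => C.indicator (fun p => fNorm C p x.2) x.1) := by
  have h1 := gg_meas h
  have h2 : Measurable (fun x : Euc n × Euc n => C.indicator (fun p => gg C p (-x.2)) x.1) :=
    h1.comp (by fun_prop : Measurable fun x : Euc n × Euc n => (x.1, -x.2))
  have h3 := (h1.add h2).const_mul (1/2)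
  convert h3 using 2 with x
  by_cases hx : x.1 ∈ C
  · simp [hx, fNorm_eq h hx]
  · simp [hx]

theorem dens_meas (h : GoodC C) :
    Measurable (C.indicator (dens C)) := by
  have hS : MeasurableSet {x : Euc n × Euc n | C.indicator (fun p => fNorm C p x.2) x.1 < 1} :=
    (fNorm_meas h) measurableSet_Iio
  have h1 : Measurable fun p : Euc n => (omegaVol n /
    (volume (Prod.mk p ⁻¹' {x : Euc n × Euc n | C.indicator (fun p => fNorm C p x.2) x.1 < 1})).toReal) :=
    (measurable_measure_prodMk_left hS).ennreal_toReal.const_div _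
  convert h1.indicator h.op.measurableSet using 1
  refine indicator_congr fun p hp => ?_
  unfold dens tangentBall
  congr 3
  ext u
  simp [hp]

theorem fNorm_ge_bdd (h : GoodC C) (hp : p ∈ C) : ∃ R, 0 < R ∧ ∀ u, ‖u‖ ≤ R * fNorm C p u := by
  obtain ⟨R, hR, hRb⟩ := (TB_bdd h hp).subset_ball_lt 0 0
  refine ⟨R, hR, fun u => ?_⟩
  by_contra! hc
  by_cases hu : u = 0
  · subst hu
    have := mul_nonneg hR.le (fNorm_nonneg h hp (u := 0))
    simp at hc; linarith
  have hn : 0 < ‖u‖ := norm_pos_iff.2 hu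
  have h1 : (R / ‖u‖) • u ∈ tangentBall C p 1 := by
    change fNorm C p _ < 1
    rw [fNorm_smul h hp (by positivity), div_mul_eq_mul_div, div_lt_one hn]
    exact hc
  have h2 := hRb h1
  rw [mem_ball_zero_iff, norm_smul, Real.norm_of_nonneg (by positivity), div_mul_cancel₀ _ hn.ne'] at h2
  exact lt_irrefl _ h2

theorem le_dualNorm (h : GoodC C) (hp : p ∈ C) (l : Euc n →L[ℝ] ℝ) (u : Euc n) :
    l u ≤ dualNorm C p l * fNorm C p u := by
  by_cases hu : u = 0
  · subst hu
    simpa using mul_nonneg (dualNorm_nonneg h hp l) (fNorm_nonneg h hp)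
  obtain ⟨R, hR, hb⟩ := fNorm_ge_bdd h hp
  have hf := fNorm_pos h hp hu
  have : l ((fNorm C p u)⁻¹ • u) ≤ dualNorm C p l := by
    refine le_csSup ⟨‖l‖ * R, ?_⟩ ⟨_, ?_, rfl⟩
    · rintro _ ⟨v, hv, rfl⟩
      have hv' : fNorm C p v = 1 := hv
      have := hb v
      rw [hv', mul_one] at this
      exact (le_abs_self _).trans ((l.le_opNorm v).trans (by gcongr))
    · change fNorm C p _ = 1
      rw [fNorm_smul h hp (by positivity), inv_mul_cancel₀ hf.ne']
  rw [map_smul, smul_eq_mul, inv_mul_eq_div, div_le_iff₀ hf] at this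
  exact this

theorem abs_le_dualNorm (h : GoodC C) (hp : p ∈ C) (l : Euc n →L[ℝ] ℝ) (u : Euc n) :
    |l u| ≤ dualNorm C p l * fNorm C p u := by
  refine abs_le'.2 ⟨le_dualNorm h hp l u, ?_⟩
  have := le_dualNorm h hp l (-u)
  rwa [map_neg, fNorm_neg h hp] at this

theorem dual_meas (h : GoodC C) (f : Euc n → ℝ) :
    Measurable (C.indicator (fun p => dualNorm C p (fderiv ℝ f p))) := by
  refine measurable_of_Iic fun a => ?_
  rcases lt_or_ge a 0 with ha | ha
  · convert MeasurableSet.empty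
    ext x
    simp only [mem_preimage, mem_Iic, mem_empty_iff_false, iff_false, not_le]
    refine ha.trans_le (indicator_nonneg (fun p hp => dualNorm_nonneg h hp _) _)
  · let v := TopologicalSpace.denseSeq (Euc n)
    have : (C.indicator (fun p => dualNorm C p (fderiv ℝ f p))) ⁻¹' Iic a =
        Cᶜ ∪ ⋂ k, {p | fderiv ℝ f p (v k) ≤ a * C.indicator (fun p => fNorm C p (v k)) p} := by
      ext x
      by_cases hx : x ∈ C
      · simp only [mem_preimage, hx, indicator_of_mem, mem_Iic, mem_union, mem_compl_iff,
          not_true_eq_false, mem_iInter, mem_ofPred_eq, false_or]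
        constructor
        · intro hd k
          exact (le_dualNorm h hx _ _).trans (mul_le_mul_of_nonneg_right hd (fNorm_nonneg h hx))
        · intro hk
          refine dualNorm_le ha fun u => ?_
          have hcl : IsClosed {u | fderiv ℝ f x u ≤ a * fNorm C x u} :=
            isClosed_le (by fun_prop) (continuous_const.mul (fNorm_cont h hx))
          exact hcl.closure_subset_iff.2 (range_subset_iff.2 hk)
            (TopologicalSpace.denseRange_denseSeq (Euc n) u)
      · simp [hx, ha]
    rw [this]
    refine h.op.measurableSet.compl.union (MeasurableSet.iInter fun k => ?_)
    refine measurableSet_le (measurable_fderiv_apply_const ℝ f (v k)) (Measurable.const_mul ?_ a)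
    exact (fNorm_meas h).comp (by fun_prop : Measurable fun p : Euc n => (p, v k))

end Meas

theorem polar (o : Euc 2) {F : Euc 2 → ℝ≥0∞} (hF : Measurable F) :
    ∫⁻ x, F x = ∫⁻ θ : Metric.sphere (0 : Euc 2) 1, (∫⁻ r in Ioi (0:ℝ),
      ENNReal.ofReal r * F (o + r • (θ : Euc 2))) ∂(volume : Measure (Euc 2)).toSphere := by
  rw [← lintegral_add_left_eq_self F o]
  have hF' : Measurable fun x => F (o + x) := by fun_prop
  rw [← restrict_compl_singleton (μ := (volume : Measure (Euc 2))) 0,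
    ← lintegral_subtype_comap (measurableSet_singleton _).compl,
    restrict_compl_singleton]
  have hmp := (volume : Measure (Euc 2)).measurePreserving_homeomorphUnitSphereProd
  have e1 := hmp.lintegral_comp_emb (Homeomorph.measurableEmbedding _)
    (fun x : Metric.sphere (0 : Euc 2) 1 × Ioi (0:ℝ) => F (o + x.2.1 • x.1.1))
  have e2 : ∀ x : ({0}ᶜ : Set (Euc 2)), F (o + x) =
    F (o + (homeomorphUnitSphereProd (Euc 2) x).2.1 • (homeomorphUnitSphereProd (Euc 2) x).1.1) := by
    intro x
    congr 2
    have := (homeomorphUnitSphereProd (Euc 2)).symm_apply_apply x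
    conv_lhs => rw [← this]
    rfl
  simp_rw [e2]
  rw [e1, lintegral_prod _ (by fun_prop)]
  refine lintegral_congr fun θ => ?_
  rw [Measure.volumeIoiPow, lintegral_withDensity_eq_lintegral_mul _ (by fun_prop) (by fun_prop)]
  simp only [Pi.mul_apply, finrank_euclideanSpace, Fintype.card_fin, Nat.add_one_sub_one, pow_one]
  exact lintegral_subtype_comap measurableSet_Ioi
    (fun r : ℝ => ENNReal.ofReal r * F (o + r • (θ : Euc 2)))

end

section
open MeasureTheory Set Filter
open scoped ENNReal NNReal

theorem swap_tri {w g : ℝ → ℝ≥0∞} (hw : Measurable w) (hg : Measurable g) (ρ : ℝ) :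
    ∫⁻ r in Ioo 0 ρ, w r * ∫⁻ s in Ioo r ρ, g s = ∫⁻ s in Ioo 0 ρ, g s * ∫⁻ r in Ioo 0 s, w r := by
  let S : Set (ℝ × ℝ) := {x | x.1 < x.2}
  have hS : MeasurableSet S := measurableSet_lt measurable_fst measurable_snd
  let Φ : ℝ → ℝ → ℝ≥0∞ := fun r s => S.indicator (fun x => w x.1 * g x.2) (r, s)
  have hΦ : Measurable (Function.uncurry Φ) :=
    Measurable.indicator (by fun_prop) hS
  have e1 : ∀ r ∈ Ioo 0 ρ, w r * ∫⁻ s in Ioo r ρ, g s = ∫⁻ s in Ioo 0 ρ, Φ r s := by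
    intro r hr
    rw [← lintegral_const_mul _ hg]
    have : ∀ s, Φ r s = (Ioi r).indicator (fun s => w r * g s) s := by
      intro s; by_cases hs : r < s <;> simp [Φ, S, hs]
    simp_rw [this]
    rw [setLIntegral_indicator measurableSet_Ioi]
    congr 2
    ext s; simp only [mem_Ioo, mem_inter_iff, mem_Ioi] at *
    constructor <;> intro h <;> refine ⟨?_, ?_⟩ <;> try constructor
    all_goals linarith [h.1, h.2, hr.1]
  have e2 : ∀ s ∈ Ioo 0 ρ, g s * ∫⁻ r in Ioo 0 s, w r = ∫⁻ r in Ioo 0 ρ, Φ r s := by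
    intro s hs
    rw [← lintegral_const_mul _ hw]
    have : ∀ r, Φ r s = (Iio s).indicator (fun r => g s * w r) r := by
      intro r; by_cases hs : r < s <;> simp [Φ, S, hs, mul_comm]
    simp_rw [this]
    rw [setLIntegral_indicator measurableSet_Iio]
    congr 2
    ext r; simp only [mem_Ioo, mem_inter_iff, mem_Iio] at *
    constructor
    · intro h; exact ⟨h.2, h.1, h.2.trans hs.2⟩
    · intro h; exact ⟨h.2.1, h.1⟩
  rw [setLIntegral_congr_fun measurableSet_Ioo e1, setLIntegral_congr_fun measurableSet_Ioo e2]
  exact lintegral_lintegral_swap hΦ.aemeasurable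

theorem sq_le_lint {h : ℝ → ℝ} {L : ℝ≥0} (hL : LipschitzWith L h) {r ρ : ℝ} (hr : r ≤ ρ) (h0 : h ρ = 0)
    {b : ℝ → ℝ} (hb : ∀ᵐ s ∂volume.restrict (Ioo r ρ), ∃ d, HasDerivAt h d s ∧ 2 * |h s| * |d| ≤ b s) :
    ENNReal.ofReal (h r ^ 2) ≤ ∫⁻ s in Ioo r ρ, ENNReal.ofReal (b s) := by
  have hac := (hL.lipschitzOnWith (s := uIcc r ρ)).absolutelyContinuousOnInterval
  have hi := (hac.fun_mul hac).integral_deriv_eq_sub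
  rw [h0, intervalIntegral.integral_of_le hr] at hi
  have e : ENNReal.ofReal (h r ^ 2) = ‖∫ x in Ioc r ρ, deriv (fun x => h x * h x) x‖ₑ := by
    rw [hi, Real.enorm_eq_ofReal_abs]; congr 1
    rw [mul_zero, zero_sub, abs_neg, ← pow_two, abs_of_nonneg (sq_nonneg _)]
  rw [e]
  refine (enorm_integral_le_lintegral_enorm _).trans ?_
  rw [← restrict_Ioo_eq_restrict_Ioc]
  refine lintegral_mono_ae ?_
  filter_upwards [hb] with s ⟨d, hd, hs⟩
  rw [(hd.fun_mul hd).deriv, Real.enorm_eq_ofReal_abs]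
  refine ENNReal.ofReal_le_ofReal (le_trans (le_of_eq ?_) hs)
  rw [show d * h s + h s * d = 2 * h s * d by ring, abs_mul, abs_mul, abs_two]

theorem Ray.ineq {C : Set (Euc 2)} {o : Euc 2} {r0 R0 : ℝ} (T : Ray C o r0 R0) {B : ℝ}
    (hdi : ∀ s, 0 < s → s < T.ρ → ∫⁻ r in Ioo 0 s, ENNReal.ofReal (r * dens C (o + r • T.θ)) ≤
      ENNReal.ofReal (B * (T.ρ - s) * (s * dens C (o + s • T.θ))))
    {f : Euc 2 → ℝ} {L : ℝ≥0} (hf : LipschitzWith L f) (hs : tsupport f ⊆ C)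
    (hd : ∀ᵐ r ∂volume.restrict (Ioi (0:ℝ)), DifferentiableAt ℝ f (o + r • T.θ)) :
    ∫⁻ r in Ioi (0:ℝ), ENNReal.ofReal r * ENNReal.ofReal (f (o + r • T.θ) ^ 2 * C.indicator (dens C) (o + r • T.θ))
    ≤ ∫⁻ r in Ioi (0:ℝ), ENNReal.ofReal r * ENNReal.ofReal ((1 + R0 / r0) * B * (|f (o + r • T.θ)| *
      C.indicator (fun p => dualNorm C p (fderiv ℝ f p)) (o + r • T.θ)) * C.indicator (dens C) (o + r • T.θ)) := by
  have hg := T.good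
  have hmem : ∀ r, r ∈ Ioo 0 T.ρ → o + r • T.θ ∈ C := fun r hr => (T.hb r hr.1.le).2 hr.2
  have hR := T.R0pos
  have hr0 := T.r0pos
  have hc : 0 ≤ 1 + R0 / r0 := by have : 0 < R0 := hr0.trans_le hR; positivity
  have hDm : Measurable fun r : ℝ => C.indicator (dens C) (o + r • T.θ) :=
    (dens_meas hg).comp (by fun_prop)
  have hGm : Measurable fun r : ℝ => C.indicator (fun p => dualNorm C p (fderiv ℝ f p)) (o + r • T.θ) :=
    (dual_meas hg f).comp (by fun_prop)
  have hhm : Measurable fun r : ℝ => f (o + r • T.θ) := by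
    have := hf.continuous.measurable; fun_prop
  have hL : LipschitzWith L (fun r : ℝ => f (o + r • T.θ)) := by
    refine LipschitzWith.of_dist_le_mul fun x y => ?_
    refine (hf.dist_le_mul _ _).trans_eq ?_
    rw [dist_add_left, dist_eq_norm, ← sub_smul, norm_smul, T.hθ, mul_one, dist_eq_norm]
  have hz : f (o + T.ρ • T.θ) = 0 := by
    refine image_eq_zero_of_notMem_tsupport fun hm => ?_
    exact lt_irrefl _ ((T.hb _ T.hρ.le).1 (hs hm))
  set w : ℝ → ℝ≥0∞ := fun r => ENNReal.ofReal (r * C.indicator (dens C) (o + r • T.θ)) with hw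
  have hwm : Measurable w := by fun_prop
  set g : ℝ → ℝ≥0∞ := fun s => ENNReal.ofReal ((1 + R0 / r0) * (|f (o + s • T.θ)| *
      C.indicator (fun p => dualNorm C p (fderiv ℝ f p)) (o + s • T.θ)) / (T.ρ - s)) with hgdef
  have hgm : Measurable g := by
    have : Measurable fun s : ℝ => |f (o + s • T.θ)| := hhm.abs
    fun_prop
  have hpt : ∀ r ∈ Ioo 0 T.ρ, ENNReal.ofReal (f (o + r • T.θ) ^ 2) ≤ ∫⁻ s in Ioo r T.ρ, g s := by
    intro r hr
    refine sq_le_lint hL hr.2.le hz ?_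
    have hd' : ∀ᵐ s ∂volume.restrict (Ioo r T.ρ), DifferentiableAt ℝ f (o + s • T.θ) :=
      ae_restrict_of_ae_restrict_of_subset (fun s hs => hr.1.trans hs.1) hd
    filter_upwards [hd', ae_restrict_mem measurableSet_Ioo] with s hds hsI
    have hsI' : s ∈ Ioo 0 T.ρ := ⟨hr.1.trans hsI.1, hsI.2⟩
    refine ⟨fderiv ℝ f (o + s • T.θ) T.θ, ?_, ?_⟩
    · refine hds.hasFDerivAt.comp_hasDerivAt s ?_
      simpa using ((hasDerivAt_id s).smul_const T.θ).const_add o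
    · have hpC := hmem s hsI'
      have h1 := abs_le_dualNorm hg hpC (fderiv ℝ f (o + s • T.θ)) T.θ
      have ht : 0 < T.ρ - s := by linarith [hsI.2]
      have h2 := T.fth ht (by linarith [hsI'.1])
      rw [Ray.pt, sub_sub_cancel] at h2
      have h3 := h1.trans (mul_le_mul_of_nonneg_left h2 (dualNorm_nonneg hg hpC _))
      have h4 := mul_le_mul_of_nonneg_left h3 (by positivity : 0 ≤ 2 * |f (o + s • T.θ)|)
      refine h4.trans (le_of_eq ?_)
      rw [indicator_of_mem hpC]
      field_simp
  calc _ ≤ ∫⁻ r in Ioo 0 T.ρ, ENNReal.ofReal r * ENNReal.ofReal (f (o + r • T.θ) ^ 2 * C.indicator (dens C) (o + r • T.θ)) := by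
        rw [← lintegral_indicator measurableSet_Ioi, ← lintegral_indicator measurableSet_Ioo]
        refine lintegral_mono fun r => ?_
        by_cases hr : r ∈ Ioo 0 T.ρ
        · rw [indicator_of_mem hr, indicator_of_mem (show r ∈ Ioi 0 from hr.1)]
        · by_cases hr0 : r ∈ Ioi (0:ℝ)
          · have : o + r • T.θ ∉ C := fun hm => hr ⟨hr0, (T.hb r (le_of_lt hr0)).1 hm⟩
            simp [indicator_of_mem hr0, indicator_of_notMem this]
          · simp [indicator_of_notMem hr0]
    _ ≤ ∫⁻ r in Ioo 0 T.ρ, w r * ∫⁻ s in Ioo r T.ρ, g s := by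
        refine setLIntegral_mono' measurableSet_Ioo fun r hr => ?_
        refine le_trans (le_of_eq ?_) (mul_le_mul_right (hpt r hr) (w r))
        have hDn := (dens_pos hg (hmem r hr)).le
        have hrp := hr.1.le
        rw [hw]
        simp only [indicator_of_mem (hmem r hr)]
        rw [← ENNReal.ofReal_mul hrp, ← ENNReal.ofReal_mul (by positivity)]
        congr 1; ring
    _ = ∫⁻ s in Ioo 0 T.ρ, g s * ∫⁻ r in Ioo 0 s, w r := swap_tri hwm hgm _
    _ ≤ ∫⁻ r in Ioo 0 T.ρ, ENNReal.ofReal r * ENNReal.ofReal ((1 + R0 / r0) * B * (|f (o + r • T.θ)| *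
      C.indicator (fun p => dualNorm C p (fderiv ℝ f p)) (o + r • T.θ)) * C.indicator (dens C) (o + r • T.θ)) := by
        refine setLIntegral_mono' measurableSet_Ioo fun s hs => ?_
        have e : ∫⁻ r in Ioo 0 s, w r = ∫⁻ r in Ioo 0 s, ENNReal.ofReal (r * dens C (o + r • T.θ)) := by
          refine setLIntegral_congr_fun measurableSet_Ioo fun r hr => ?_
          rw [hw]
          simp only [indicator_of_mem (hmem r ⟨hr.1, hr.2.trans hs.2⟩)]
        rw [e]
        refine (mul_le_mul_right (hdi s hs.1 hs.2) _).trans (le_of_eq ?_)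
        have hDn := (dens_pos hg (hmem s hs)).le
        have hGn := dualNorm_nonneg hg (hmem s hs) (fderiv ℝ f (o + s • T.θ))
        have hsp := hs.1
        have ht : 0 < T.ρ - s := by linarith [hs.2]
        rw [hgdef]
        simp only [indicator_of_mem (hmem s hs)]
        rw [← ENNReal.ofReal_mul hsp.le, ← ENNReal.ofReal_mul (by positivity)]
        congr 1; field_simp
    _ ≤ _ := lintegral_mono_set fun r hr => hr.1

end

section
open MeasureTheory Set Filter
open scoped ENNReal NNReal

theorem ae_ray {f : Euc 2 → ℝ} {L : ℝ≥0} (hf : LipschitzWith L f) (o : Euc 2) :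
    ∀ᵐ θ : Metric.sphere (0 : Euc 2) 1 ∂(volume : Measure (Euc 2)).toSphere,
      ∀ᵐ r ∂volume.restrict (Ioi (0:ℝ)), DifferentiableAt ℝ f (o + r • (θ : Euc 2)) := by
  have hm : MeasurableSet {x | ¬ DifferentiableAt ℝ f x} := (measurableSet_of_differentiableAt ℝ f).compl
  have h0 : volume {x | ¬ DifferentiableAt ℝ f x} = 0 := hf.ae_differentiableAt
  have hF : Measurable ({x | ¬ DifferentiableAt ℝ f x}.indicator (fun _ => (1:ℝ≥0∞))) :=
    measurable_const.indicator hm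
  have hp := polar o hF
  rw [lintegral_indicator_const hm, h0, mul_zero] at hp
  have hmm : Measurable fun x : Metric.sphere (0 : Euc 2) 1 × ℝ => ENNReal.ofReal x.2 *
    {x | ¬ DifferentiableAt ℝ f x}.indicator (fun _ => (1:ℝ≥0∞)) (o + x.2 • (x.1 : Euc 2)) :=
    (by fun_prop : Measurable fun x : Metric.sphere (0 : Euc 2) 1 × ℝ => ENNReal.ofReal x.2).mul
      (hF.comp (by fun_prop))
  have h1 := (lintegral_eq_zero_iff (Measurable.lintegral_prod_right' hmm)).1 hp.symm
  filter_upwards [h1] with θ hθ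
  have h2 := (lintegral_eq_zero_iff (hmm.comp measurable_prodMk_left)).1 hθ
  filter_upwards [h2, ae_restrict_mem measurableSet_Ioi] with r hr hr0
  by_contra hc
  simp only [Function.comp_apply, Pi.zero_apply, mul_eq_zero, ENNReal.ofReal_eq_zero] at hr
  rcases hr with hr | hr
  · exact absurd hr (not_le.2 hr0)
  · rw [indicator_of_mem (show _ ∈ {x | ¬ DifferentiableAt ℝ f x} from hc)] at hr
    exact one_ne_zero hr

theorem main_lint {C : Set (Euc 2)} {o : Euc 2} {r0 R0 B : ℝ} (h : GoodC C) (hr0 : 0 < r0)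
    (hin : Metric.ball o r0 ⊆ C) (hout : C ⊆ Metric.ball o R0)
    (hdi : ∀ T : Ray C o r0 R0, ∀ s, 0 < s → s < T.ρ →
      ∫⁻ r in Ioo 0 s, ENNReal.ofReal (r * dens C (o + r • T.θ)) ≤
      ENNReal.ofReal (B * (T.ρ - s) * (s * dens C (o + s • T.θ))))
    {f : Euc 2 → ℝ} {L : ℝ≥0} (hf : LipschitzWith L f) (hs : tsupport f ⊆ C) :
    ∫⁻ x, ENNReal.ofReal (f x ^ 2 * C.indicator (dens C) x) ≤
    ∫⁻ x, ENNReal.ofReal ((1 + R0 / r0) * B * (|f x| *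
      C.indicator (fun p => dualNorm C p (fderiv ℝ f p)) x) * C.indicator (dens C) x) := by
  have hDm := dens_meas h
  have hGm := dual_meas h f
  have hfm := hf.continuous.measurable
  have hfa : Measurable fun x => |f x| := hfm.abs
  rw [polar o (by fun_prop), polar o (by fun_prop)]
  refine lintegral_mono_ae ?_
  filter_upwards [ae_ray hf o] with θ hθ
  obtain ⟨T, hT⟩ := exists_ray h hr0 hin hout (θ := (θ : Euc 2)) (by simp)
  rw [← hT] at hθ ⊢
  exact T.ineq (hdi T) hf hs hθ

section
variable {C : Set (Euc 2)} {o : Euc 2} {r0 R0 : ℝ}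

theorem fNorm_ge (h : GoodC C) (hr0 : 0 < r0)
    (hin : Metric.ball o r0 ⊆ C) (hout : C ⊆ Metric.ball o R0) {p : Euc 2} (hp : p ∈ C) (u : Euc 2) :
    ‖u‖ ≤ 2 * R0 * fNorm C p u := by
  obtain ⟨T, hT⟩ := exists_ray h hr0 hin hout (θ := EuclideanSpace.single 0 1) (by simp)
  have h1 := T.gg_ge hp u
  have h2 := T.gg_ge hp (-u)
  have hR : 0 < R0 := hr0.trans_le T.R0pos
  rw [norm_neg] at h2
  rw [fNorm_eq h hp]
  have : ‖u‖ / (2 * R0) ≤ 1/2 * (gg C p u + gg C p (-u)) := by linarith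
  rwa [div_le_iff₀' (by positivity)] at this

theorem dens_bdd (h : GoodC C) {K : Set (Euc 2)} (hK : IsCompact K) (hKC : K ⊆ C) :
    ∃ M, ∀ p ∈ K, C.indicator (dens C) p ≤ M := by
  obtain ⟨η, hη, hsub⟩ := hK.exists_thickening_subset_open h.op hKC
  refine ⟨omegaVol 2 / (volume (Metric.ball (0 : Euc 2) η)).toReal, fun p hp => ?_⟩
  rw [indicator_of_mem (hKC hp), dens]
  have hb : Metric.ball (0 : Euc 2) η ⊆ tangentBall C p 1 := by
    intro u hu
    rw [mem_ball_zero_iff] at hu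
    refine fNorm_lt_one h ?_ ?_ (hKC hp) <;> refine hsub (Metric.mem_thickening_iff.2 ⟨p, hp, ?_⟩)
    · simpa [dist_eq_norm] using hu
    · simpa [dist_eq_norm] using hu
  refine div_le_div_of_nonneg_left omega_pos.le ?_ ?_
  · exact ENNReal.toReal_pos (Metric.measure_ball_pos _ _ hη).ne' measure_ball_lt_top.ne
  · exact ENNReal.toReal_mono (TB_vol_lt_top h (hKC hp)).ne (measure_mono hb)

theorem integ_aux {K : Set (Euc 2)} (hK : IsCompact K) {F : Euc 2 → ℝ} (hF : Measurable F) {M : ℝ}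
    (hM : ∀ x ∈ K, ‖F x‖ ≤ M) (h0 : ∀ x ∉ K, F x = 0) : Integrable F := by
  have : IntegrableOn F K :=
    Measure.integrableOn_of_bounded hK.measure_lt_top.ne hF.aestronglyMeasurable
      ((ae_restrict_mem hK.measurableSet).mono hM)
  rwa [integrableOn_iff_integrable_of_support_subset] at this
  intro x hx
  by_contra hc
  exact hx (h0 x hc)

theorem setInt_h (h : GoodC C) (F : Euc 2 → ℝ) :
    ∫ p in C, F p ∂hMeasure C = ∫ p, C.indicator F p * C.indicator (dens C) p := by
  have hC := h.op.measurableSet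
  have hm : AEMeasurable (fun p => ENNReal.ofReal (dens C p)) (volume.restrict C) := by
    refine ⟨fun p => ENNReal.ofReal (C.indicator (dens C) p), (dens_meas h).ennreal_ofReal, ?_⟩
    filter_upwards [ae_restrict_mem hC] with p hp
    rw [indicator_of_mem hp]
  have e : (hMeasure C).restrict C = (volume.restrict C).withDensity fun p => ENNReal.ofReal (dens C p) := by
    unfold hMeasure
    rw [restrict_withDensity hC, Measure.restrict_restrict hC, inter_self]
    rfl
  rw [e, integral_withDensity_eq_integral_toReal_smul₀ hm (by simp), ← integral_indicator hC]
  refine integral_congr_ae (Eventually.of_forall fun p => ?_)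
  by_cases hp : p ∈ C
  · simp [hp, (dens_pos h hp).le, mul_comm]
  · simp [hp]

theorem ray_lower (h : GoodC C) (hr0 : 0 < r0) {B : ℝ} (hB : 0 < B)
    (hin : Metric.ball o r0 ⊆ C) (hout : C ⊆ Metric.ball o R0)
    (hdi : ∀ T : Ray C o r0 R0, ∀ s, 0 < s → s < T.ρ →
      ∫⁻ r in Ioo 0 s, ENNReal.ofReal (r * dens C (o + r • T.θ)) ≤
      ENNReal.ofReal (B * (T.ρ - s) * (s * dens C (o + s • T.θ)))) {f : Euc 2 → ℝ} (hf : f ∈ testFuns C) :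
    1 / ((1 + R0 / r0) * B) ^ 2 ≤ rayleigh C C f := by
  obtain ⟨⟨L, hL⟩, hne, hcs, hs⟩ := hf
  have hml := main_lint h hr0 hin hout hdi hL hs
  set M := (1 + R0 / r0) * B with hMdef
  have hR0 : 0 < R0 := by
    by_contra! hc
    have := hout (hin (Metric.mem_ball_self hr0))
    rw [Metric.ball_eq_empty.2 hc] at this
    exact this
  have hM : 0 < M := by positivity
  have hDm := dens_meas h
  have hGm := dual_meas h f
  have hfm := hL.continuous.measurable
  obtain ⟨D0, hD0⟩ := dens_bdd h hcs hs
  have hDn : ∀ x, 0 ≤ C.indicator (dens C) x := indicator_nonneg fun p hp => (dens_pos h hp).le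
  set G := C.indicator (fun p => dualNorm C p (fderiv ℝ f p)) with hG
  have hGn : ∀ x, 0 ≤ G x := indicator_nonneg fun p hp => dualNorm_nonneg h hp _
  have hGb : ∀ x ∈ tsupport f, G x ≤ L * (2 * R0) := by
    intro x hx
    rw [hG, indicator_of_mem (hs hx)]
    refine dualNorm_le (by positivity) fun u => ?_
    have h1 := (le_abs_self _).trans ((fderiv ℝ f x).le_opNorm u)
    have h2 := norm_fderiv_le_of_lipschitz ℝ hL (x₀ := x)
    calc _ ≤ _ := h1
      _ ≤ L * (2 * R0 * fNorm C x u) := by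
        gcongr; exact fNorm_ge h hr0 hin hout (hs hx) u
      _ = _ := by ring
  have hG0 : ∀ x ∉ tsupport f, G x = 0 := by
    intro x hx
    have : fderiv ℝ f x = 0 := fderiv_of_notMem_tsupport ℝ hx
    by_cases hxC : x ∈ C
    · rw [hG, indicator_of_mem hxC, this, dualNorm_zero]
    · rw [hG, indicator_of_notMem hxC]
  obtain ⟨F0, hF0⟩ := hcs.exists_bound_of_continuousOn hL.continuous.continuousOn
  have i1 : Integrable fun x => f x ^ 2 * C.indicator (dens C) x := by
    refine integ_aux hcs (by fun_prop) (M := F0 ^ 2 * D0) (fun x hx => ?_) fun x hx => ?_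
    · rw [norm_mul, norm_pow, Real.norm_of_nonneg (hDn x)]
      have := hF0 x hx; have := hD0 x hx; have := hDn x
      gcongr
    · rw [image_eq_zero_of_notMem_tsupport hx]; ring
  have i2 : Integrable fun x => G x ^ 2 * C.indicator (dens C) x := by
    refine integ_aux hcs (by fun_prop) (M := (L * (2 * R0)) ^ 2 * D0) (fun x hx => ?_) fun x hx => ?_
    · rw [norm_mul, norm_pow, Real.norm_of_nonneg (hDn x), Real.norm_of_nonneg (hGn x)]
      have := hGb x hx; have := hD0 x hx; have := hDn x; have := hGn x
      gcongr
    · rw [hG0 x hx]; ring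
  have n1 : ∀ x, 0 ≤ f x ^ 2 * C.indicator (dens C) x := fun x => mul_nonneg (sq_nonneg _) (hDn x)
  have n2 : ∀ x, 0 ≤ G x ^ 2 * C.indicator (dens C) x := fun x => mul_nonneg (sq_nonneg _) (hDn x)
  have hI : 0 < ∫ x, f x ^ 2 * C.indicator (dens C) x := by
    rw [integral_pos_iff_support_of_nonneg n1 i1]
    have : (Function.support fun x => f x ^ 2 * C.indicator (dens C) x) = Function.support f := by
      ext x
      simp only [Function.mem_support, ne_eq, mul_eq_zero, OfNat.ofNat_ne_zero, not_false_eq_true,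
        pow_eq_zero_iff, not_or]
      refine ⟨fun hx => hx.1, fun hx => ⟨hx, ?_⟩⟩
      have hxC := hs (subset_tsupport f hx)
      rw [indicator_of_mem hxC]
      exact (dens_pos h hxC).ne'
    rw [this]
    refine hL.continuous.isOpen_support.measure_pos _ ?_
    exact Function.support_nonempty_iff.2 hne
  have hle : ∫ x, f x ^ 2 * C.indicator (dens C) x ≤ M ^ 2 * ∫ x, G x ^ 2 * C.indicator (dens C) x := by
    have i3 : Integrable fun x => 1/2 * (f x ^ 2 * C.indicator (dens C) x) +
        M ^ 2 / 2 * (G x ^ 2 * C.indicator (dens C) x) :=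
      (i1.const_mul (1/2)).add (i2.const_mul (M ^ 2 / 2))
    have h3 : ∫⁻ x, ENNReal.ofReal (M * (|f x| * G x) * C.indicator (dens C) x) ≤
        ∫⁻ x, ENNReal.ofReal (1/2 * (f x ^ 2 * C.indicator (dens C) x) +
          M ^ 2 / 2 * (G x ^ 2 * C.indicator (dens C) x)) := by
      refine lintegral_mono fun x => ENNReal.ofReal_le_ofReal ?_
      have := mul_nonneg (sq_nonneg (|f x| - M * G x)) (hDn x)
      have e := sq_abs (f x)
      rw [← e]
      nlinarith
    have h4 := hml.trans h3
    rw [← ofReal_integral_eq_lintegral_ofReal i1 (Eventually.of_forall n1),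
      ← ofReal_integral_eq_lintegral_ofReal i3 (Eventually.of_forall fun x => ?_)] at h4
    · have h5 := (ENNReal.ofReal_le_ofReal_iff (integral_nonneg fun x => ?_)).1 h4
      · rw [integral_add (i1.const_mul (1/2)) (i2.const_mul (M ^ 2 / 2)),
          integral_const_mul, integral_const_mul] at h5
        linarith
      · exact add_nonneg (mul_nonneg (by norm_num) (n1 x)) (mul_nonneg (by positivity) (n2 x))
    · exact add_nonneg (mul_nonneg (by norm_num) (n1 x)) (mul_nonneg (by positivity) (n2 x))
  have e1 : ∫ p in C, f p ^ 2 ∂hMeasure C = ∫ x, f x ^ 2 * C.indicator (dens C) x := by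
    rw [setInt_h h]
    refine integral_congr_ae (Eventually.of_forall fun p => ?_)
    by_cases hp : p ∈ C <;> simp [hp]
  have e2 : ∫ p in C, dualNorm C p (fderiv ℝ f p) ^ 2 ∂hMeasure C =
      ∫ x, G x ^ 2 * C.indicator (dens C) x := by
    rw [setInt_h h]
    refine integral_congr_ae (Eventually.of_forall fun p => ?_)
    by_cases hp : p ∈ C <;> simp [hp, hG]
  rw [rayleigh, e1, e2, div_le_div_iff₀ (by positivity) hI]
  linarith

theorem testFuns_ne (hr0 : 0 < r0) (hin : Metric.ball o r0 ⊆ C) : (testFuns C).Nonempty := by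
  have hL : LipschitzWith 1 fun x : Euc 2 => max (r0 / 2 - ‖x - o‖) 0 := by
    have h1 : LipschitzWith 1 fun x : Euc 2 => r0 / 2 - ‖x - o‖ := by
      refine LipschitzWith.of_dist_le_mul fun x y => ?_
      rw [Real.dist_eq, NNReal.coe_one, one_mul, dist_eq_norm]
      have := abs_norm_sub_norm_le (y - o) (x - o)
      rw [sub_sub_sub_cancel_right, norm_sub_rev y x] at this
      convert this using 2
      ring
    exact h1.max_const 0
  have hsub : tsupport (fun x : Euc 2 => max (r0 / 2 - ‖x - o‖) 0) ⊆ Metric.closedBall o (r0 / 2) := by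
    refine closure_minimal (fun x hx => ?_) Metric.isClosed_closedBall
    rw [mem_closedBall_iff_norm]
    by_contra! hc
    exact hx (max_eq_right (by linarith))
  refine ⟨_, ⟨1, hL⟩, ?_, ?_, ?_⟩
  · intro h0
    have := congrFun h0 o
    simp at this
    linarith
  · exact (isCompact_closedBall o (r0 / 2)).of_isClosed_subset (isClosed_tsupport _) hsub
  · exact hsub.trans ((Metric.closedBall_subset_ball (by linarith)).trans hin)
end

theorem dirB {C : Set (Euc 2)} (h : GoodC C) (hne : C.Nonempty) {δ : ℝ} (hd0 : 0 ≤ δ)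
    (hδ : IsDeltaHyp C δ) : 0 < lambda1 C := by
  obtain ⟨o, ho⟩ := hne
  obtain ⟨r0, hr0, hin⟩ := Metric.isOpen_iff.1 h.op o ho
  obtain ⟨R0, hR0, hout⟩ := h.bdd.subset_ball_lt 0 o
  set K := 200 * Real.exp (4 * δ) with hK
  have hK200 : 200 ≤ K := by
    have := Real.one_le_exp (by positivity : 0 ≤ 4 * δ)
    linarith
  have hKp : 0 < K := by linarith
  have hx0 : 0 < 1 - 2 / K := by
    rw [sub_pos, div_lt_one hKp]; linarith
  have hx1 : 1 - 2 / K < 1 := by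
    have : 0 < 2 / K := by positivity
    linarith
  have hlK : 0 < Real.log K := Real.log_pos (by linarith)
  set α := -Real.log (1 - 2 / K) / Real.log K with hα
  have hαp : 0 < α := div_pos (neg_pos.2 (Real.log_neg hx0 hx1)) hlK
  have hKα : (1 - 2 / K) * K ^ α = 1 := by
    rw [Real.rpow_def_of_pos hKp, hα, mul_div_cancel₀ _ hlK.ne', Real.exp_neg, Real.exp_log hx0,
      mul_inv_cancel₀ hx0.ne']
  have hKpow : 0 < K ^ α := Real.rpow_pos_of_pos hKp _
  set B := (3+6*((1+R0/r0)/2))^2*((2*R0/r0)^2*(K^α)^2)/α with hB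
  have hBp : 0 < B := by positivity
  have hdi : ∀ T : Ray C o r0 R0, ∀ s, 0 < s → s < T.ρ →
      ∫⁻ r in Ioo 0 s, ENNReal.ofReal (r * dens C (o + r • T.θ)) ≤
      ENNReal.ofReal (B * (T.ρ - s) * (s * dens C (o + s • T.θ))) :=
    fun T s hs hsρ => T.dens_int hd0 hδ le_rfl hαp hKα hs hsρ
  have hM : 0 < 1 / ((1 + R0 / r0) * B) ^ 2 := by positivity
  refine hM.trans_le (le_csInf ((testFuns_ne hr0 hin).image _) ?_)
  rintro _ ⟨f, hf, rfl⟩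
  exact ray_lower h hr0 hBp hin hout hdi hf

end

/-- For a bounded open convex subset `C` of `ℝ²`, the bottom of the
spectrum `λ₁(C)` is nonzero if and only if `(C, d_C)` is `δ`-hyperbolic for some
`δ ≥ 0`. -/
theorem stmt0 (C : Set (Euc 2)) (hconv : Convex ℝ C) (hopen : IsOpen C)
    (hbdd : Bornology.IsBounded C) (hne : C.Nonempty) :
    lambda1 C ≠ 0 ↔ ∃ δ : ℝ, 0 ≤ δ ∧ IsDeltaHyp C δ := by
  have h : GoodC C := ⟨hconv, hopen, hbdd⟩
  constructor
  · intro hl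
    have hnn : ∀ x ∈ rayleigh C C '' testFuns C, 0 ≤ x := by
      rintro _ ⟨f, -, rfl⟩
      exact div_nonneg (integral_nonneg fun p => sq_nonneg _) (integral_nonneg fun p => sq_nonneg _)
    have hc : 0 < lambda1 C := lt_of_le_of_ne (Real.sInf_nonneg hnn) hl.symm
    exact dirA h hc fun f hf => csInf_le ⟨0, hnn⟩ ⟨f, hf, rfl⟩
  · rintro ⟨δ, hd0, hδ⟩
    exact (dirB h hne hd0 hδ).ne'
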